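/- Under Assumptions A1, A2, A3, as n → ∞ the conditional law L(Z_n | T = n+1) converges weakly to the law L(Y) of a non-degenerate random variable Y which is finite with probability 1 (i.e., the limiting distribution is concentrated on the natural numbers with no atom at infinity). -/

import Mathlib

open MeasureTheory ProbabilityTheory Filter Set Topology

noncomputable section

namespace BPREpaper

variable {Ω : Type*} [MeasurableSpace Ω]

/-- The random walk `S n = X 1 + ... + X n` (increments indexed from `1`, `S 0 = 0`). -/
def walk (X : ℕ → Ω → ℝ) (n : ℕ) (ω : Ω) : ℝ := ∑ i ∈ Finset.Icc 1 n, X i ω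

/-- `Mwalk X n = max (S 1, ..., S n)` for `n ≥ 1` (junk value `0` for `n = 0`). -/
def Mwalk (X : ℕ → Ω → ℝ) : ℕ → Ω → ℝ
  | 0, _ => 0
  | n + 1, ω =>
      (Finset.Icc 1 (n + 1)).sup' (Finset.nonempty_Icc.mpr (by omega)) fun i => walk X i ω

/-- `Lwalk X n = min (S 1, ..., S n)` for `n ≥ 1` (junk value `0` for `n = 0`). -/
def Lwalk (X : ℕ → Ω → ℝ) : ℕ → Ω → ℝ
  | 0, _ => 0
  | n + 1, ω =>
      (Finset.Icc 1 (n + 1)).inf' (Finset.nonempty_Icc.mpr (by omega)) fun i => walk X i ω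

/-- minimum of `S 0, S 1, ..., S n`. -/
def minWalk (X : ℕ → Ω → ℝ) (n : ℕ) (ω : Ω) : ℝ :=
  (Finset.range (n + 1)).inf' (by simp) fun i => walk X i ω

/-- `τ(n)`: the first moment at which the minimum of `S 0, ..., S n` is attained. -/
def tauWalk (X : ℕ → Ω → ℝ) (n : ℕ) (ω : Ω) : ℕ :=
  sInf {i : ℕ | walk X i ω = minWalk X n ω}

/-- The renewal function `u(x) = 1 + ∑_{k ≥ 1} P(-S_k ≤ x, M_k < 0)` for `x ≥ 0`,
`u(x) = 0` for `x < 0`. -/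
def uFun (μ : Measure Ω) (X : ℕ → Ω → ℝ) (x : ℝ) : ℝ :=
  if 0 ≤ x then
    1 + ∑' k : ℕ, (μ {ω | -walk X (k + 1) ω ≤ x ∧ Mwalk X (k + 1) ω < 0}).toReal
  else 0

/-- The renewal function `v(x) = 1 + ∑_{k ≥ 1} P(-S_k > x, L_k ≥ 0)` for `x ≤ 0`,
`v(x) = 0` for `x > 0`. -/
def vFun (μ : Measure Ω) (X : ℕ → Ω → ℝ) (x : ℝ) : ℝ :=
  if x ≤ 0 then
    1 + ∑' k : ℕ, (μ {ω | x < -walk X (k + 1) ω ∧ 0 ≤ Lwalk X (k + 1) ω}).toReal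
  else 0

/-- The event `{∀ 1 ≤ i ≤ n, x + S_i ≥ 0} = {L_n ≥ 0}` for the walk started at `x`. -/
def posSet (X : ℕ → Ω → ℝ) (x : ℝ) (n : ℕ) : Set Ω :=
  {ω | ∀ i ∈ Finset.Icc 1 n, 0 ≤ x + walk X i ω}

/-- The event `{∀ 1 ≤ i ≤ n, x + S_i < 0} = {M_n < 0}` for the walk started at `x`. -/
def negSet (X : ℕ → Ω → ℝ) (x : ℝ) (n : ℕ) : Set Ω :=
  {ω | ∀ i ∈ Finset.Icc 1 n, x + walk X i ω < 0}

/-- A distribution on `ℝ` is non-lattice: it is not concentrated on any arithmetic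
progression `a + hℤ`. -/
def NonLattice (ν : Measure ℝ) : Prop :=
  ¬ ∃ a h : ℝ, ν {x | ∃ k : ℤ, x = a + k * h} = 1

/-- `ν` is an `α`-stable law on `ℝ`. -/
def IsStableLaw (α : ℝ) (ν : Measure ℝ) : Prop :=
  ∀ a b : ℝ, 0 < a → 0 < b → ∃ c d : ℝ, 0 < c ∧ a ^ α + b ^ α = c ^ α ∧
    ((ν.map (fun x => a * x)).prod (ν.map (fun x => b * x))).map (fun p : ℝ × ℝ => p.1 + p.2)
      = ν.map (fun x => c * x + d)

/-- Weak convergence of a sequence of laws on `ℝ`, tested against bounded continuous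
functions. -/
def WeakTendsto (μs : ℕ → Measure ℝ) (ν : Measure ℝ) : Prop :=
  ∀ g : BoundedContinuousFunction ℝ ℝ,
    Tendsto (fun n => ∫ x, g x ∂(μs n)) atTop (𝓝 (∫ x, g x ∂ν))

/-- Assumption A4: there are norming constants `c n → ∞` such that `S n / c n` converges in
distribution to an `α`-stable law concentrated neither on `[0,∞)` nor on `(-∞,0]`; the
increment distribution is non-lattice. -/
def AssumptionA4 (μ : Measure Ω) (X : ℕ → Ω → ℝ) (c : ℕ → ℝ) : Prop :=
  Tendsto c atTop atTop ∧ NonLattice (μ.map (X 1)) ∧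
    ∃ (α : ℝ) (ν : Measure ℝ), IsProbabilityMeasure ν ∧ IsStableLaw α ν ∧
      0 < ν (Set.Iio 0) ∧ 0 < ν (Set.Ioi 0) ∧
      WeakTendsto (fun n => μ.map fun ω => walk X n ω / c n) ν

/-- A family of random elements indexed by `ι` which is i.i.d. (the common distribution
being that of the element with index `i0`). -/
def IIDfam {ι : Type*} {E : Type*} [MeasurableSpace E] (μ : Measure Ω) (Q : ι → Ω → E)
    (i0 : ι) : Prop :=
  (∀ i, Measurable (Q i)) ∧ iIndepFun Q μ ∧
    ∀ i, IdentDistrib (Q i) (Q i0) μ μ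

/-- An i.i.d. sequence indexed by `ℕ` (indices from `1` are the relevant ones). -/
def IIDseq {E : Type*} [MeasurableSpace E] (μ : Measure Ω) (Q : ℕ → Ω → E) : Prop :=
  IIDfam μ Q 1

/-- `P` is the h-transform measure `P_x⁺`: for every `n` and every bounded
`F n`-measurable `g`, `E_P[g] = u(x)⁻¹ E_x[g · u(S_n); L_n ≥ 0]`. -/
def IsPplus (μ : Measure Ω) (X : ℕ → Ω → ℝ) (F : ℕ → MeasurableSpace Ω) (x : ℝ)
    (P : Measure Ω) : Prop :=
  IsProbabilityMeasure P ∧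
    ∀ (n : ℕ) (g : Ω → ℝ), Measurable[F n] g → (∃ C, ∀ ω, |g ω| ≤ C) →
      ∫ ω, g ω ∂P =
        (uFun μ X x)⁻¹ * ∫ ω in posSet X x n, g ω * uFun μ X (x + walk X n ω) ∂μ

/-- `P` is the h-transform measure `P_x⁻`: for every `n` and every bounded
`F n`-measurable `g`, `E_P[g] = v(x)⁻¹ E_x[g · v(S_n); M_n < 0]`. -/
def IsPminus (μ : Measure Ω) (X : ℕ → Ω → ℝ) (F : ℕ → MeasurableSpace Ω) (x : ℝ)
    (P : Measure Ω) : Prop :=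
  IsProbabilityMeasure P ∧
    ∀ (n : ℕ) (g : Ω → ℝ), Measurable[F n] g → (∃ C, ∀ ω, |g ω| ≤ C) →
      ∫ ω, g ω ∂P =
        (vFun μ X x)⁻¹ * ∫ ω in negSet X x n, g ω * vFun μ X (x + walk X n ω) ∂μ

/-- The filtration generated by the environment `Q 1, ..., Q n`. -/
def envFiltration {E : Type*} [MeasurableSpace E] (Q : ℕ → Ω → E) (n : ℕ) :
    MeasurableSpace Ω :=
  ⨆ i ∈ Finset.Icc 1 n, MeasurableSpace.comap (Q i) inferInstance

/-- The σ-algebra generated by the whole environment `Q 1, Q 2, ...`. -/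
def envSigma {E : Type*} [MeasurableSpace E] (Q : ℕ → Ω → E) : MeasurableSpace Ω :=
  ⨆ i, MeasurableSpace.comap (Q (i + 1)) inferInstance




/-- Probability generating function of the (random) offspring law `Q n`. -/
def pgf (Q : ℕ → Ω → Measure ℕ) (n : ℕ) (ω : Ω) (s : ℝ) : ℝ :=
  ∑' i : ℕ, (Q n ω {i}).toReal * s ^ i

/-- Mean `m(Q_n)` of the offspring law `Q n`. -/
def meanQ (Q : ℕ → Ω → Measure ℕ) (n : ℕ) (ω : Ω) : ℝ :=
  ∑' i : ℕ, (i : ℝ) * (Q n ω {i}).toReal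

/-- `X_n = log f_n'(1)`, the increments of the associated random walk. -/
def Xenv (Q : ℕ → Ω → Measure ℕ) (n : ℕ) (ω : Ω) : ℝ := Real.log (meanQ Q n ω)

/-- `η_n = f_n''(1) / (2 f_n'(1)^2)`. -/
def etaEnv (Q : ℕ → Ω → Measure ℕ) (n : ℕ) (ω : Ω) : ℝ :=
  (∑' i : ℕ, ((i : ℝ) * ((i : ℝ) - 1)) * (Q n ω {i}).toReal) / (2 * meanQ Q n ω ^ 2)

/-- The associated random walk `S_n = X_1 + ... + X_n`. -/
def Senv (Q : ℕ → Ω → Measure ℕ) : ℕ → Ω → ℝ := walk (Xenv Q)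

/-- The composition `f_{j,n}(s) = f_{j+1}(f_{j+2}(⋯ f_n(s) ⋯))`, with `f_{j,n} = id` for
`n ≤ j`. -/
def pgfComp (Q : ℕ → Ω → Measure ℕ) (j : ℕ) : ℕ → Ω → ℝ → ℝ
  | 0, _, s => s
  | n + 1, ω, s => if n + 1 ≤ j then s else pgfComp Q j n ω (pgf Q (n + 1) ω s)

/-- `b_n = ∑_{i=0}^{n-1} η_{i+1} e^{-S_i}`. -/
def bEnv (Q : ℕ → Ω → Measure ℕ) (n : ℕ) (ω : Ω) : ℝ :=
  ∑ i ∈ Finset.range n, etaEnv Q (i + 1) ω * Real.exp (-(Senv Q i ω))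

/-- `B⁺ = ∑_{i=0}^∞ η_{i+1} e^{-S_i}`. -/
def Bplus (Q : ℕ → Ω → Measure ℕ) (ω : Ω) : ℝ :=
  ∑' i : ℕ, etaEnv Q (i + 1) ω * Real.exp (-(Senv Q i ω))

/-- `B⁻ = ∑_{i=1}^∞ η_i e^{S_i}`. -/
def Bminus (Q : ℕ → Ω → Measure ℕ) (ω : Ω) : ℝ :=
  ∑' i : ℕ, etaEnv Q (i + 1) ω * Real.exp (Senv Q (i + 1) ω)

/-- `V_∞(r) = 1 / (B⁻ + (1 - r)⁻¹)`. -/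
def Vinf (Q : ℕ → Ω → Measure ℕ) (r : ℝ) (ω : Ω) : ℝ := (Bminus Q ω + (1 - r)⁻¹)⁻¹

/-- All the offspring generating functions are fractional linear:
`1/(1 - f_n(s)) = e^{-X_n}/(1-s) + η_n`. -/
def FracLinear (Q : ℕ → Ω → Measure ℕ) : Prop :=
  ∀ n, 1 ≤ n → ∀ ω : Ω, ∀ s : ℝ, 0 ≤ s → s < 1 →
    (1 - pgf Q n ω s)⁻¹ = Real.exp (-(Xenv Q n ω)) / (1 - s) + etaEnv Q n ω

/-- Assumption A1 with explicit constant `χ`. -/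
def AssumptionA1With (μ : Measure Ω) (Q : ℕ → Ω → Measure ℕ) (χ : ℝ) : Prop :=
  0 < χ ∧ χ < 1 / 2 ∧ ∀ n, 1 ≤ n →
    ∀ᵐ ω ∂μ, χ ≤ pgf Q n ω 0 ∧ pgf Q n ω 0 ≤ 1 - χ ∧ χ ≤ etaEnv Q n ω

/-- Assumption A1: for some `χ ∈ (0,1/2)`, `χ ≤ f(0) ≤ 1 - χ` and `η ≥ χ` a.s. -/
def AssumptionA1 (μ : Measure Ω) (Q : ℕ → Ω → Measure ℕ) : Prop :=
  ∃ χ : ℝ, AssumptionA1With μ Q χ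

/-- Assumption A2: `X` has zero mean, finite positive variance and is non-lattice. -/
def AssumptionA2 (μ : Measure Ω) (Q : ℕ → Ω → Measure ℕ) : Prop :=
  Integrable (Xenv Q 1) μ ∧ (∫ ω, Xenv Q 1 ω ∂μ) = 0 ∧
    Integrable (fun ω => Xenv Q 1 ω ^ 2) μ ∧ 0 < ∫ ω, Xenv Q 1 ω ^ 2 ∂μ ∧
    NonLattice (μ.map (Xenv Q 1))

/-- `ζ(a) = ∑_{y ≥ a} y² Q({y}) / m(Q)²`. -/
def zetaEnv (Q : ℕ → Ω → Measure ℕ) (a : ℕ) (ω : Ω) : ℝ :=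
  (∑' y : ℕ, if a ≤ y then (y : ℝ) ^ 2 * (Q 1 ω {y}).toReal else 0) / meanQ Q 1 ω ^ 2

/-- Assumption A3: `E[(log⁺ ζ(a))^{2+ε}] < ∞` for some `ε > 0`, `a ∈ ℕ`. -/
def AssumptionA3 (μ : Measure Ω) (Q : ℕ → Ω → Measure ℕ) : Prop :=
  ∃ ε : ℝ, 0 < ε ∧ ∃ a : ℕ, 1 ≤ a ∧
    Integrable (fun ω => Real.log (max (zetaEnv Q a ω) 1) ^ (2 + ε)) μ

/-- The extinction moment `T = min {k ≥ 0 : Z_k = 0}`. -/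
def extinctTime (Z : ℕ → Ω → ℕ) (ω : Ω) : ℕ := sInf {k | Z k ω = 0}

/-- The branching property of `Z` in the environment `Q` (started from one particle):
given the environment and `Z_k`, the conditional generating function of `Z_n` is
`f_{k,n}(s)^{Z_k}`; the state `0` is absorbing. -/
def BranchingProperty (μ : Measure Ω) (Q : ℕ → Ω → Measure ℕ) (Z : ℕ → Ω → ℕ) : Prop :=
  (∀ ω, Z 0 ω = 1) ∧ (∀ n, Measurable (Z n)) ∧ (∀ n ω, Z n ω = 0 → Z (n + 1) ω = 0) ∧
    ∀ k n : ℕ, k ≤ n → ∀ s : ℝ, 0 ≤ s → s ≤ 1 →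
      (μ[fun ω => s ^ Z n ω | envSigma Q ⊔ MeasurableSpace.comap (Z k) inferInstance])
        =ᵐ[μ] fun ω => pgfComp Q k n ω s ^ Z k ω



/-- Data of a Wiener–Hopf factorisation of `1 - z f` in a commutative ring, with respect to two
non-unital subrings with trivial intersection. -/
structure WHData {A : Type*} [CommRing A] (P N : NonUnitalSubring A) (f : A)
    (m p hp hm fp fm : ℕ → A) : Prop where
  disj : ∀ x, x ∈ P → x ∈ N → x = 0
  one : (1 : A) ∈ P
  m0 : m 0 = 1
  p0 : p 0 = 1
  mN : ∀ n, m (n + 1) ∈ N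
  pP : ∀ n, p n ∈ P
  hpP : ∀ n, hp (n + 1) ∈ P
  hmN : ∀ n, hm (n + 1) ∈ N
  hp0 : hp 0 = 0
  hm0 : hm 0 = 0
  mstep : ∀ n, m n * f = m (n + 1) + hp (n + 1)
  pstep : ∀ n, p n * f = p (n + 1) + hm (n + 1)
  fP : ∀ n, fp (n + 1) ∈ P
  fN : ∀ n, fm (n + 1) ∈ N
  fpow : ∀ n, f ^ (n + 1) = fp (n + 1) + fm (n + 1)

namespace WHData

open PowerSeries

variable {A : Type*} [CommRing A] {P N : NonUnitalSubring A} {f : A}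
    {m p hp hm fp fm : ℕ → A}

lemma mulStep (a b : ℕ → A) (h0 : a 0 = 1) (hb0 : b 0 = 0)
    (h : ∀ n, a n * f = a (n + 1) + b (n + 1)) :
    PowerSeries.mk a * (1 - PowerSeries.X * PowerSeries.C f) = 1 - PowerSeries.mk b := by
  ext n
  rw [mul_sub, mul_one, mul_comm PowerSeries.X, ← mul_assoc]
  rcases n with _ | n
  · simp [h0, hb0]
  · simp only [map_sub, coeff_mk, coeff_succ_mul_X, coeff_mul_C, h]
    simp [PowerSeries.coeff_one]

lemma coeff_mul_mem (S : NonUnitalSubring A) (a b : PowerSeries A)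
    (ha : ∀ n, coeff n a ∈ S) (hb : ∀ n, coeff n b ∈ S) (n : ℕ) : coeff n (a * b) ∈ S := by
  rw [coeff_mul]
  exact sum_mem fun x _ => S.mul_mem (ha _) (hb _)

variable (h : WHData P N f m p hp hm fp fm)
include h

lemma prod_eq : PowerSeries.mk p * (1 - PowerSeries.mk hp) = 1 ∧
    PowerSeries.mk m * (1 - PowerSeries.mk hm) = 1 := by
  have e1 := mulStep m hp h.m0 h.hp0 h.mstep
  have e2 := mulStep p hm h.p0 h.hm0 h.pstep
  have key : PowerSeries.mk p * (1 - PowerSeries.mk hp)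
      = PowerSeries.mk m * (1 - PowerSeries.mk hm) := by
    rw [← e1, ← e2]; ring
  have hP : ∀ n, coeff n (PowerSeries.mk p * (1 - PowerSeries.mk hp)) ∈ P := by
    apply coeff_mul_mem
    · intro n; simpa using h.pP n
    · rintro (_ | n)
      · simpa [h.hp0] using h.one
      · simpa [PowerSeries.coeff_one] using h.hpP n
  have hN : ∀ n, coeff (n + 1) (PowerSeries.mk m * (1 - PowerSeries.mk hm)) ∈ N := by
    intro n
    have hm' : PowerSeries.mk m = 1 + (PowerSeries.mk m - 1) := by ring
    have : PowerSeries.mk m * (1 - PowerSeries.mk hm) = 1 + ((PowerSeries.mk m - 1)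
        - PowerSeries.mk hm - (PowerSeries.mk m - 1) * PowerSeries.mk hm) := by ring
    rw [this, map_add, map_sub, map_sub]
    have c1 : ∀ n, coeff n (PowerSeries.mk m - 1) ∈ N := by
      rintro (_ | n)
      · simp [h.m0, N.zero_mem]
      · simpa [PowerSeries.coeff_one] using h.mN n
    have c2 : ∀ n, coeff n (PowerSeries.mk hm) ∈ N := by
      rintro (_ | n)
      · simp [h.hm0, N.zero_mem]
      · simpa using h.hmN n
    have c3 := coeff_mul_mem N _ _ c1 c2
    have : coeff (n + 1) (1 : PowerSeries A) = 0 := by simp [PowerSeries.coeff_one]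
    rw [this, zero_add]
    exact N.sub_mem (N.sub_mem (c1 _) (c2 _)) (c3 _)
  have one : PowerSeries.mk p * (1 - PowerSeries.mk hp) = 1 := by
    ext n
    rcases n with _ | n
    · simp [h.p0, h.hp0]
    · rw [h.disj _ (hP (n + 1)) (key ▸ hN n)]
      simp [PowerSeries.coeff_one]
  exact ⟨one, key ▸ one⟩

omit h in
lemma renew_of (a b : ℕ → A) (hb0 : b 0 = 0)
    (e : PowerSeries.mk a * (1 - PowerSeries.mk b) = 1) (n : ℕ) :
    a (n + 1) = ∑ k ∈ Finset.range (n + 1), b (k + 1) * a (n - k) := by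
  have e' : PowerSeries.mk a = 1 + PowerSeries.mk b * PowerSeries.mk a := by
    rw [← e]; ring
  have := congrArg (coeff (n + 1)) e'
  rw [map_add, coeff_mul, Finset.Nat.sum_antidiagonal_eq_sum_range_succ
    (fun i j => coeff i (PowerSeries.mk b) * coeff j (PowerSeries.mk a)),
    Finset.sum_range_succ'] at this
  simpa [hb0, PowerSeries.coeff_one] using this

lemma renewP (n : ℕ) : p (n + 1) = ∑ k ∈ Finset.range (n + 1), hp (k + 1) * p (n - k) :=
  renew_of p hp h.hp0 h.prod_eq.1 n

lemma renewN (n : ℕ) : m (n + 1) = ∑ k ∈ Finset.range (n + 1), hm (k + 1) * m (n - k) :=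
  renew_of m hm h.hm0 h.prod_eq.2 n

lemma logDeriv : (∀ n, coeff n (derivative A (PowerSeries.mk m) * (1 - PowerSeries.mk hm))
      = fm (n + 1)) ∧
    ∀ n, coeff n (derivative A (PowerSeries.mk p) * (1 - PowerSeries.mk hp)) = fp (n + 1) := by
  obtain ⟨o1, o2⟩ := h.prod_eq
  have e1 := mulStep m hp h.m0 h.hp0 h.mstep
  have e2 := mulStep p hm h.p0 h.hm0 h.pstep
  set W := PowerSeries.mk m
  set V := PowerSeries.mk p
  set Q : PowerSeries A := 1 - PowerSeries.X * PowerSeries.C f with hQ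
  have g1 : W * V * Q = 1 := by rw [mul_right_comm, e1, mul_comm, o1]
  have hg : W * V = PowerSeries.mk (fun n => f ^ n) := by
    have g2 : PowerSeries.mk (fun n => f ^ n) * Q = 1 := by
      have := mulStep (f := f) (fun n => f ^ n) (fun _ => 0) (by simp) rfl
        (by intro n; simp [pow_succ])
      rw [this]
      ext n; simp
    calc W * V = W * V * (PowerSeries.mk (fun n => f ^ n) * Q) := by rw [g2, mul_one]
      _ = PowerSeries.mk (fun n => f ^ n) * (W * V * Q) := by ring
      _ = _ := by rw [g1, mul_one]
  have hd : derivative A (W * V) * Q = W * V * PowerSeries.C f := by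
    have := congrArg (derivative A) g1
    have dQ : derivative A Q = - PowerSeries.C f := by
      rw [hQ, map_sub]
      ext n
      simp
    rw [Derivation.leibniz, dQ] at this
    simp only [smul_eq_mul] at this
    have d1 : derivative A (1 : PowerSeries A) = 0 := by simp
    rw [d1] at this
    linear_combination this
  have hsum : derivative A W * (1 - PowerSeries.mk hm) + derivative A V * (1 - PowerSeries.mk hp)
      = PowerSeries.mk (fun n => f ^ (n + 1)) := by
    rw [← e1, ← e2]
    have : derivative A W * (V * Q) + derivative A V * (W * Q) = derivative A (W * V) * Q := by
      rw [Derivation.leibniz]; simp only [smul_eq_mul]; ring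
    rw [this, hd, hg]
    ext n; simp [pow_succ]
  have hN : ∀ n, coeff n (derivative A W * (1 - PowerSeries.mk hm)) ∈ N := by
    have c1 : ∀ n, coeff n (derivative A W) ∈ N := by
      intro n
      rw [coeff_derivative, mul_comm, ← Nat.cast_succ, ← nsmul_eq_mul]
      exact nsmul_mem (by simpa [W] using h.mN n) _
    have c2 : ∀ n, coeff n (PowerSeries.mk hm) ∈ N := by
      rintro (_ | n)
      · simp [h.hm0, N.zero_mem]
      · simpa using h.hmN n
    intro n
    rw [mul_sub, mul_one, map_sub]
    exact N.sub_mem (c1 n) (coeff_mul_mem N _ _ c1 c2 n)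
  have hP : ∀ n, coeff n (derivative A V * (1 - PowerSeries.mk hp)) ∈ P := by
    apply coeff_mul_mem
    · intro n
      rw [coeff_derivative, mul_comm, ← Nat.cast_succ, ← nsmul_eq_mul]
      exact nsmul_mem (by simpa [V] using h.pP (n + 1)) _
    · rintro (_ | n)
      · simpa [h.hp0] using h.one
      · simpa [PowerSeries.coeff_one] using h.hpP n
  have hz : ∀ n, coeff n (derivative A W * (1 - PowerSeries.mk hm)) - fm (n + 1) = 0 := by
    intro n
    refine h.disj _ ?_ (N.sub_mem (hN n) (h.fN n))
    have := congrArg (coeff n) hsum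
    rw [map_add, coeff_mk, h.fpow] at this
    have e : coeff n (derivative A W * (1 - PowerSeries.mk hm)) - fm (n + 1)
        = fp (n + 1) - coeff n (derivative A V * (1 - PowerSeries.mk hp)) := by
      linear_combination this
    rw [e]
    exact P.sub_mem (h.fP n) (hP n)
  refine ⟨fun n => sub_eq_zero.1 (hz n), fun n => ?_⟩
  have := congrArg (coeff n) hsum
  rw [map_add, coeff_mk, h.fpow] at this
  linear_combination this - hz n

omit h in
lemma spitzer_of (a b c : ℕ → A) (e : PowerSeries.mk a * (1 - PowerSeries.mk b) = 1)
    (hd : ∀ n, coeff n (derivative A (PowerSeries.mk a) * (1 - PowerSeries.mk b)) = c (n + 1))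
    (n : ℕ) : (n + 1 : ℕ) • a (n + 1) = ∑ k ∈ Finset.range (n + 1), c (k + 1) * a (n - k) := by
  have e' : derivative A (PowerSeries.mk a)
      = (derivative A (PowerSeries.mk a) * (1 - PowerSeries.mk b)) * PowerSeries.mk a := by
    rw [mul_assoc, mul_comm (1 - _), e, mul_one]
  have := congrArg (coeff n) e'
  rw [coeff_mul, Finset.Nat.sum_antidiagonal_eq_sum_range_succ
    (fun i j => coeff i (derivative A (PowerSeries.mk a) * (1 - PowerSeries.mk b))
      * coeff j (PowerSeries.mk a)), coeff_derivative] at this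
  simp only [hd, coeff_mk] at this
  rw [← this, nsmul_eq_mul, mul_comm]
  push_cast; rfl

lemma spitzerN (n : ℕ) :
    (n + 1 : ℕ) • m (n + 1) = ∑ k ∈ Finset.range (n + 1), fm (k + 1) * m (n - k) :=
  spitzer_of m hm fm h.prod_eq.2 h.logDeriv.1 n

lemma spitzerP (n : ℕ) :
    (n + 1 : ℕ) • p (n + 1) = ∑ k ∈ Finset.range (n + 1), fp (k + 1) * p (n - k) :=
  spitzer_of p hp fp h.prod_eq.1 h.logDeriv.2 n

end WHData

section

open scoped ENNReal

/-- Convolution powers of a measure on the line. -/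
def cpow (F : Measure ℝ) : ℕ → Measure ℝ
  | 0 => Measure.dirac 0
  | n + 1 => cpow F n ∗ F

/-- The law at time `n` of the random walk with step law `F` killed on leaving `D`. -/
def kill (F : Measure ℝ) (D : Set ℝ) : ℕ → Measure ℝ
  | 0 => Measure.dirac 0
  | n + 1 => (kill F D n ∗ F).restrict D

/-- The law of the position of the walk at its first exit from `D`, on the event that this
happens at time `n`. -/
def hit (F : Measure ℝ) (D : Set ℝ) : ℕ → Measure ℝ
  | 0 => 0
  | n + 1 => (kill F D n ∗ F).restrict Dᶜ

instance cpow_prob (F : Measure ℝ) [IsProbabilityMeasure F] (n : ℕ) :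
    IsProbabilityMeasure (cpow F n) := by
  induction n with
  | zero => exact inferInstanceAs (IsProbabilityMeasure (Measure.dirac 0))
  | succ n ih => exact inferInstanceAs (IsProbabilityMeasure (cpow F n ∗ F))

instance kill_fin (F : Measure ℝ) [IsProbabilityMeasure F] (D : Set ℝ) (n : ℕ) :
    IsFiniteMeasure (kill F D n) := by
  induction n with
  | zero => exact inferInstanceAs (IsFiniteMeasure (Measure.dirac 0))
  | succ n ih => exact inferInstanceAs (IsFiniteMeasure ((kill F D n ∗ F).restrict D))

instance hit_fin (F : Measure ℝ) [IsProbabilityMeasure F] (D : Set ℝ) (n : ℕ) :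
    IsFiniteMeasure (hit F D n) := by
  cases n with
  | zero => exact inferInstanceAs (IsFiniteMeasure (0 : Measure ℝ))
  | succ n => exact inferInstanceAs (IsFiniteMeasure ((kill F D n ∗ F).restrict Dᶜ))

lemma charFun_add_measure (μ ν : Measure ℝ) [IsFiniteMeasure μ] [IsFiniteMeasure ν] :
    charFun (μ + ν) = charFun μ + charFun ν := by
  ext t
  simp only [charFun_apply_real, Pi.add_apply]
  apply integral_add_measure <;>
  · apply Integrable.of_bound (C := 1) (by fun_prop)
    refine Eventually.of_forall fun x => ?_
    rw [show Complex.exp (t * x * Complex.I) = Complex.exp ((t * x : ℝ) * Complex.I) by simp,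
      Complex.norm_exp_ofReal_mul_I]

lemma charFun_conv' (μ ν : Measure ℝ) [IsFiniteMeasure μ] [IsFiniteMeasure ν] :
    charFun (μ ∗ ν) = charFun μ * charFun ν := by
  ext t; exact charFun_conv t

lemma charFun_sum_measure {ι : Type*} (s : Finset ι) (μ : ι → Measure ℝ)
    [∀ i, IsFiniteMeasure (μ i)] : charFun (∑ i ∈ s, μ i) = ∑ i ∈ s, charFun (μ i) := by
  classical
  induction s using Finset.induction_on with
  | empty => ext t; simp
  | insert a s ha ih => rw [Finset.sum_insert ha, Finset.sum_insert ha, charFun_add_measure, ih]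

lemma charFun_nsmul_measure (n : ℕ) (μ : Measure ℝ)
    [IsFiniteMeasure μ] : charFun (n • μ) = n • charFun μ := by
  have := charFun_sum_measure (Finset.range n) (fun _ => μ)
  simpa using this

lemma ae_conv_mem {D : Set ℝ} (hDm : MeasurableSet D) {μ ν : Measure ℝ} [SFinite ν]
    (h : ∀ᵐ x ∂μ, ∀ᵐ y ∂ν, x + y ∈ D) : ∀ᵐ x ∂(μ ∗ ν), x ∈ D := by
  have hs : MeasurableSet {x : ℝ × ℝ | x.1 + x.2 ∈ D} := measurable_fst.add measurable_snd hDm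
  exact (ae_map_iff (p := fun x => x ∈ D) (measurable_fst.add measurable_snd).aemeasurable hDm).2
    ((Measure.ae_prod_mem_iff_ae_ae_mem hs).2 h)

/-- Differences of characteristic functions of finite measures carried by `D`. -/
def charSub (D : Set ℝ) (hDm : MeasurableSet D) (hD : ∀ x ∈ D, ∀ y ∈ D, x + y ∈ D) :
    NonUnitalSubring (ℝ → ℂ) where
  carrier := {g | ∃ μ ν : Measure ℝ, IsFiniteMeasure μ ∧ IsFiniteMeasure ν ∧
    (∀ᵐ x ∂μ, x ∈ D) ∧ (∀ᵐ x ∂ν, x ∈ D) ∧ g = charFun μ - charFun ν}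
  zero_mem' := ⟨0, 0, inferInstance, inferInstance, by simp, by simp, by simp⟩
  add_mem' := by
    rintro _ _ ⟨μ, ν, h1, h2, h3, h4, rfl⟩ ⟨μ', ν', h1', h2', h3', h4', rfl⟩
    refine ⟨μ + μ', ν + ν', inferInstance, inferInstance, ?_, ?_, ?_⟩
    · rw [ae_add_measure_iff]; exact ⟨h3, h3'⟩
    · rw [ae_add_measure_iff]; exact ⟨h4, h4'⟩
    · rw [charFun_add_measure, charFun_add_measure]; ring
  neg_mem' := by
    rintro _ ⟨μ, ν, h1, h2, h3, h4, rfl⟩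
    exact ⟨ν, μ, h2, h1, h4, h3, by ring⟩
  mul_mem' := by
    have conv : ∀ μ ν : Measure ℝ, IsFiniteMeasure μ → IsFiniteMeasure ν →
        (∀ᵐ x ∂μ, x ∈ D) → (∀ᵐ x ∂ν, x ∈ D) → ∀ᵐ x ∂(μ ∗ ν), x ∈ D := by
      intro μ ν _ _ h3 h4
      refine ae_conv_mem hDm ?_
      filter_upwards [h3] with x hx
      filter_upwards [h4] with y hy
      exact hD x hx y hy
    rintro _ _ ⟨μ, ν, h1, h2, h3, h4, rfl⟩ ⟨μ', ν', h1', h2', h3', h4', rfl⟩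
    refine ⟨μ ∗ μ' + ν ∗ ν', μ ∗ ν' + ν ∗ μ', inferInstance, inferInstance, ?_, ?_, ?_⟩
    · rw [ae_add_measure_iff]
      exact ⟨conv _ _ h1 h1' h3 h3', conv _ _ h2 h2' h4 h4'⟩
    · rw [ae_add_measure_iff]
      exact ⟨conv _ _ h1 h2' h3 h4', conv _ _ h2 h1' h4 h3'⟩
    · rw [charFun_add_measure, charFun_add_measure]
      simp only [charFun_conv']; ring

lemma mem_charSub {D : Set ℝ} {hDm : MeasurableSet D} {hD : ∀ x ∈ D, ∀ y ∈ D, x + y ∈ D}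
    (μ : Measure ℝ) [IsFiniteMeasure μ] (h : ∀ᵐ x ∂μ, x ∈ D) :
    charFun μ ∈ charSub D hDm hD :=
  ⟨μ, 0, inferInstance, inferInstance, h, by simp, by ext t; simp⟩

lemma charSub_disj {D : Set ℝ} {hDm : MeasurableSet D} {hD : ∀ x ∈ D, ∀ y ∈ D, x + y ∈ D}
    {E : Set ℝ} {hEm : MeasurableSet E} {hE : ∀ x ∈ E, ∀ y ∈ E, x + y ∈ E}
    (hDE : E ⊆ Dᶜ) (g : ℝ → ℂ) (h1 : g ∈ charSub D hDm hD) (h2 : g ∈ charSub E hEm hE) :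
    g = 0 := by
  obtain ⟨μ, ν, f1, f2, s1, s2, rfl⟩ := h1
  obtain ⟨μ', ν', f1', f2', s1', s2', h⟩ := h2
  have e : μ + ν' = ν + μ' := by
    apply Measure.ext_of_charFun
    rw [charFun_add_measure, charFun_add_measure]
    linear_combination h
  have e2 := congrArg (fun m => m.restrict D) e
  have z : ∀ m : Measure ℝ, (∀ᵐ x ∂m, x ∈ E) → m.restrict D = 0 := by
    intro m hm
    rw [Measure.restrict_eq_zero]
    refine measure_mono_null ?_ (ae_iff.1 hm)
    intro x hx hxE
    exact hDE hxE hx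
  simp only [Measure.restrict_add, z _ s1', z _ s2', add_zero,
    Measure.restrict_eq_self_of_ae_mem s1, Measure.restrict_eq_self_of_ae_mem s2] at e2
  rw [e2, sub_self]

variable (F : Measure ℝ) [IsProbabilityMeasure F]

omit [IsProbabilityMeasure F] in
lemma kill_add_hit {D : Set ℝ} (hD : MeasurableSet D) (n : ℕ) :
    kill F D n ∗ F = kill F D (n + 1) + hit F D (n + 1) :=
  (Measure.restrict_add_restrict_compl hD).symm

lemma charFun_cpow (n : ℕ) : charFun (cpow F n) = charFun F ^ n := by
  induction n with
  | zero => ext t; simp [cpow, charFun_dirac]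
  | succ n ih => rw [cpow, charFun_conv', ih, pow_succ]

omit [IsProbabilityMeasure F] in
lemma ae_kill_mem {D : Set ℝ} (hD : MeasurableSet D) (n : ℕ) :
    ∀ᵐ x ∂(kill F D (n + 1)), x ∈ D := ae_restrict_mem hD

lemma whData : WHData
    (charSub (Ici 0) measurableSet_Ici fun _ hx _ hy => add_nonneg (α := ℝ) hx hy)
    (charSub (Iio 0) measurableSet_Iio fun _ hx _ hy => add_neg (α := ℝ) hx hy)
    (charFun F) (fun n => charFun (kill F (Iio 0) n)) (fun n => charFun (kill F (Ici 0) n))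
    (fun n => charFun (hit F (Iio 0) n)) (fun n => charFun (hit F (Ici 0) n))
    (fun n => charFun ((cpow F n).restrict (Ici 0)))
    (fun n => charFun ((cpow F n).restrict (Iio 0))) where
  disj := charSub_disj (by simp)
  one := by
    have : (1 : ℝ → ℂ) = charFun (Measure.dirac (0 : ℝ)) := by ext t; simp [charFun_dirac]
    rw [this]
    exact mem_charSub _ (by rw [ae_dirac_eq]; simp)
  m0 := by ext t; simp [kill, charFun_dirac]
  p0 := by ext t; simp [kill, charFun_dirac]
  mN n := mem_charSub _ (ae_kill_mem F measurableSet_Iio n)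
  pP n := by
    rcases n with _ | n
    · exact mem_charSub _ (by rw [kill, ae_dirac_eq]; simp)
    · exact mem_charSub _ (ae_kill_mem F measurableSet_Ici n)
  hpP n := mem_charSub _ (by
    rw [hit, compl_Iio]; exact ae_restrict_mem measurableSet_Ici)
  hmN n := mem_charSub _ (by
    rw [hit, compl_Ici]; exact ae_restrict_mem measurableSet_Iio)
  hp0 := by ext t; simp [hit]
  hm0 := by ext t; simp [hit]
  mstep n := by rw [← charFun_conv', kill_add_hit F measurableSet_Iio, charFun_add_measure]
  pstep n := by rw [← charFun_conv', kill_add_hit F measurableSet_Ici, charFun_add_measure]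
  fP n := mem_charSub _ (ae_restrict_mem measurableSet_Ici)
  fN n := mem_charSub _ (ae_restrict_mem measurableSet_Iio)
  fpow n := by
    rw [← charFun_cpow, ← charFun_add_measure, ← compl_Iio,
      Measure.restrict_compl_add_restrict measurableSet_Iio]

/-- The two half lines. -/
def HalfLine (D : Set ℝ) : Prop := D = Iio 0 ∨ D = Ici 0

lemma HalfLine.meas {D : Set ℝ} (h : HalfLine D) : MeasurableSet D := by
  rcases h with rfl | rfl
  · exact measurableSet_Iio
  · exact measurableSet_Ici

lemma HalfLine.compl {D : Set ℝ} (h : HalfLine D) : HalfLine Dᶜ := by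
  rcases h with rfl | rfl
  · right; simp
  · left; simp

lemma kill_spitzer {D : Set ℝ} (hD : HalfLine D) (n : ℕ) : (n + 1) • kill F D (n + 1)
    = ∑ k ∈ Finset.range (n + 1), (cpow F (k + 1)).restrict D ∗ kill F D (n - k) := by
  apply Measure.ext_of_charFun
  rw [charFun_sum_measure, charFun_nsmul_measure]
  simp only [charFun_conv']
  rcases hD with rfl | rfl
  · exact (whData F).spitzerN n
  · exact (whData F).spitzerP n

lemma kill_renewal {D : Set ℝ} (hD : HalfLine D) (n : ℕ) : kill F D (n + 1)
    = ∑ k ∈ Finset.range (n + 1), hit F Dᶜ (k + 1) ∗ kill F D (n - k) := by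
  apply Measure.ext_of_charFun
  rw [charFun_sum_measure]
  simp only [charFun_conv']
  rcases hD with rfl | rfl
  · rw [compl_Iio]; exact (whData F).renewN n
  · rw [compl_Ici]; exact (whData F).renewP n

lemma conv_sum_left {ι : Type*} (s : Finset ι) (μ : ι → Measure ℝ) (ν : Measure ℝ) [SFinite ν] :
    (∑ i ∈ s, μ i) ∗ ν = ∑ i ∈ s, μ i ∗ ν := by
  refine Measure.ext_of_lintegral _ fun f hf => ?_
  rw [Measure.lintegral_conv hf, lintegral_finsetSum_measure, lintegral_finsetSum_measure]
  exact Finset.sum_congr rfl fun i _ => (Measure.lintegral_conv hf).symm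

lemma restrict_sum {ι : Type*} (s : Finset ι) (μ : ι → Measure ℝ) (E : Set ℝ) :
    (∑ i ∈ s, μ i).restrict E = ∑ i ∈ s, (μ i).restrict E := by
  classical
  induction s using Finset.induction_on with
  | empty => simp
  | insert a s ha ih =>
    rw [Finset.sum_insert ha, Finset.sum_insert ha, Measure.restrict_add, ih]

lemma restrict_conv_neg (μ ν : Measure ℝ) [SFinite μ] [SFinite ν] (a : ℝ)
    (hν : ∀ᵐ x ∂ν, x < 0) :
    (μ.restrict (Iio a) ∗ ν).restrict (Iio a) = μ.restrict (Iio a) ∗ ν := by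
  apply Measure.restrict_eq_self_of_ae_mem
  refine ae_conv_mem measurableSet_Iio ?_
  filter_upwards [ae_restrict_mem measurableSet_Iio] with x hx
  filter_upwards [hν] with y hy
  simp only [mem_Iio] at *
  linarith

lemma restrict_conv_nonneg (μ ν : Measure ℝ) [SFinite μ] [SFinite ν] (a : ℝ)
    (hν : ∀ᵐ x ∂ν, 0 ≤ x) :
    (μ.restrict (Iio a) ∗ ν).restrict (Iio a) = (μ ∗ ν).restrict (Iio a) := by
  refine Measure.ext_of_lintegral _ fun f hf => ?_
  have hf' : Measurable ((Iio a).indicator f) := hf.indicator measurableSet_Iio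
  rw [← lintegral_indicator measurableSet_Iio, ← lintegral_indicator measurableSet_Iio,
    Measure.lintegral_conv hf', Measure.lintegral_conv hf',
    ← lintegral_indicator measurableSet_Iio]
  refine lintegral_congr fun x => ?_
  by_cases hx : x < a
  · rw [indicator_of_mem (by exact hx)]
  · rw [indicator_of_notMem (by exact hx)]
    symm
    rw [lintegral_eq_zero_iff (by fun_prop)]
    filter_upwards [hν] with y hy
    rw [indicator_of_notMem]
    · rfl
    · simp only [mem_Iio, not_lt] at *
      linarith

/-- Decomposition of the walk killed at the level `a > 0` at the time of its maximum. -/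
lemma kill_level (a : ℝ) (ha : 0 < a) (n : ℕ) : kill F (Iio a) n
    = ∑ k ∈ Finset.range (n + 1), (kill F (Ici 0) k).restrict (Iio a) ∗ kill F (Iio 0) (n - k) := by
  induction n with
  | zero =>
    have : (Measure.dirac (0 : ℝ)).restrict (Iio a) = Measure.dirac 0 := by
      apply Measure.restrict_eq_self_of_ae_mem
      rw [ae_dirac_eq]; simpa using ha
    simp [kill, this]
  | succ n ih =>
    have step : kill F (Iio a) (n + 1) = ∑ k ∈ Finset.range (n + 1),
        ((kill F (Ici 0) k).restrict (Iio a) ∗ kill F (Iio 0) (n + 1 - k) +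
          (kill F (Ici 0) k ∗ hit F (Iio 0) (n + 1 - k)).restrict (Iio a)) := by
      rw [kill, ih, conv_sum_left, restrict_sum]
      refine Finset.sum_congr rfl fun k hk => ?_
      have hk' : n + 1 - k = (n - k) + 1 := by have := Finset.mem_range.1 hk; omega
      rw [Measure.conv_assoc, kill_add_hit F measurableSet_Iio, Measure.conv_add,
        Measure.restrict_add, restrict_conv_neg, restrict_conv_nonneg, hk']
      · rw [hit, compl_Iio]; exact ae_restrict_mem measurableSet_Ici
      · exact ae_kill_mem F measurableSet_Iio _
    rw [step, Finset.sum_add_distrib, Finset.sum_range_succ _ (n + 1)]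
    congr 1
    rw [← restrict_sum, Nat.sub_self]
    have : ∑ k ∈ Finset.range (n + 1), kill F (Ici 0) k ∗ hit F (Iio 0) (n + 1 - k)
        = kill F (Ici 0) (n + 1) := by
      rw [kill_renewal F (Or.inr rfl), compl_Ici, ← Finset.sum_range_reflect]
      refine Finset.sum_congr rfl fun k hk => ?_
      have hk' := Finset.mem_range.1 hk
      rw [Measure.conv_comm]
      congr 2
      · omega
    rw [this]
    simp [kill]

end

/-- The tent function. -/
def tent (t : ℝ) : ℝ := max 0 (1 - |t|)

/-- The Fejér kernel, the Fourier transform of the tent function. -/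
def fej (x : ℝ) : ℝ := ∫ t, tent t * Real.cos (t * x)

lemma continuous_tent : Continuous tent := by unfold tent; fun_prop

lemma tent_nonneg (t : ℝ) : 0 ≤ tent t := le_max_left _ _

lemma tent_le_one (t : ℝ) : tent t ≤ 1 := by
  unfold tent; exact max_le zero_le_one (by linarith [abs_nonneg t])

lemma tent_eq_zero {t : ℝ} (h : 1 ≤ |t|) : tent t = 0 := by
  unfold tent; exact max_eq_left (by linarith)

lemma hasCompactSupport_tent : HasCompactSupport tent :=
  HasCompactSupport.intro (isCompact_Icc (a := (-1 : ℝ)) (b := 1)) fun t ht => by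
    refine tent_eq_zero ?_
    by_contra h
    exact ht (abs_le.1 (not_le.1 h).le)

lemma integrable_tent : Integrable tent :=
  continuous_tent.integrable_of_hasCompactSupport hasCompactSupport_tent

lemma integrable_tent_mul (g : ℝ → ℝ) (hg : Continuous g) : Integrable (fun t => tent t * g t) :=
  (continuous_tent.mul hg).integrable_of_hasCompactSupport hasCompactSupport_tent.mul_right

lemma tent_fourier (x : ℝ) :
    ∫ t : ℝ, (tent t : ℂ) * Complex.exp (t * x * Complex.I) = (fej x : ℂ) := by
  have hs : ∫ t : ℝ, tent t * Real.sin (t * x) = 0 := by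
    have := integral_neg_eq_self (fun t : ℝ => tent t * Real.sin (t * x)) volume
    have e : ∀ t : ℝ, tent (-t) * Real.sin (-t * x) = -(tent t * Real.sin (t * x)) := by
      intro t; simp [tent]
    simp only [e, integral_neg] at this
    linarith
  have e : ∀ t : ℝ, (tent t : ℂ) * Complex.exp (t * x * Complex.I)
      = ((tent t * Real.cos (t * x) : ℝ) : ℂ)
        + ((tent t * Real.sin (t * x) : ℝ) : ℂ) * Complex.I := by
    intro t
    rw [Complex.exp_mul_I]
    push_cast; ring
  simp only [e]
  rw [integral_add, integral_mul_const, integral_complex_ofReal, integral_complex_ofReal, hs]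
  · simp [fej]
  · exact (integrable_tent_mul _ (by fun_prop)).ofReal
  · exact ((integrable_tent_mul _ (by fun_prop)).ofReal (𝕜 := ℂ)).mul_const _

lemma fej_interval (x : ℝ) : fej x = 2 * ∫ t in (0 : ℝ)..1, (1 - t) * Real.cos (t * x) := by
  have e : ∀ t : ℝ, tent t * Real.cos (t * x)
      = (fun s => max 0 (1 - s) * Real.cos (s * x)) |t| := by
    intro t
    have : Real.cos (|t| * x) = Real.cos (t * x) := by
      rcases abs_choice t with h | h <;> rw [h]
      rw [neg_mul, Real.cos_neg]
    simp [tent, this]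
  unfold fej
  simp only [e]
  rw [integral_comp_abs (f := fun s => max 0 (1 - s) * Real.cos (s * x)),
    intervalIntegral.integral_of_le zero_le_one,
    setIntegral_eq_of_subset_of_forall_sdiff_eq_zero (s := Ioc 0 1) (t := Ioi 0)
      measurableSet_Ioi (fun y hy => hy.1)]
  · congr 1
    refine setIntegral_congr_fun measurableSet_Ioc fun t ht => ?_
    rw [max_eq_right (by linarith [ht.2])]
  · intro t ht
    have : 1 < t := by
      by_contra h
      exact ht.2 ⟨ht.1, not_lt.1 h⟩
    rw [max_eq_left (by linarith), zero_mul]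

lemma fej_zero : fej 0 = 1 := by
  rw [fej_interval]
  simp only [mul_zero, Real.cos_zero, mul_one]
  rw [intervalIntegral.integral_sub (by simp) (by simp)]
  norm_num

lemma fej_eq {x : ℝ} (hx : x ≠ 0) : fej x = 2 * (1 - Real.cos x) / x ^ 2 := by
  rw [fej_interval]
  have hd : ∀ t ∈ uIcc (0 : ℝ) 1, HasDerivAt
      (fun t => (1 - t) * (Real.sin (t * x) / x) - Real.cos (t * x) / x ^ 2)
      ((1 - t) * Real.cos (t * x)) t := by
    intro t _
    have h1 : HasDerivAt (fun t : ℝ => 1 - t) (-1) t := by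
      simpa using (hasDerivAt_id t).const_sub 1
    have h0 : HasDerivAt (fun t : ℝ => t * x) x t := by
      simpa using (hasDerivAt_id t).mul_const x
    have h2 := (h0.sin).div_const x
    have h3 := (h0.cos).div_const (x ^ 2)
    refine ((h1.mul h2).sub h3).congr_deriv ?_
    field_simp
    ring
  rw [intervalIntegral.integral_eq_sub_of_hasDerivAt hd]
  · simp; field_simp; ring
  · exact Continuous.intervalIntegrable (by fun_prop) _ _

lemma fej_nonneg (x : ℝ) : 0 ≤ fej x := by
  by_cases hx : x = 0
  · rw [hx, fej_zero]; exact zero_le_one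
  · rw [fej_eq hx]
    exact div_nonneg (by linarith [Real.cos_le_one x]) (sq_nonneg x)

lemma fej_le_one (x : ℝ) : fej x ≤ 1 := by
  by_cases hx : x = 0
  · rw [hx, fej_zero]
  · rw [fej_eq hx, div_le_one (by positivity)]
    linarith [Real.one_sub_sq_div_two_le_cos (x := x)]

lemma fej_upper (x : ℝ) : fej x ≤ 5 * (1 + x ^ 2)⁻¹ := by
  have h1 := fej_le_one x
  have h2 : fej x * x ^ 2 ≤ 4 := by
    by_cases hx : x = 0
    · rw [hx]; norm_num
    · rw [fej_eq hx, div_mul_cancel₀ _ (by positivity)]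
      linarith [Real.neg_one_le_cos x]
  rw [← div_eq_mul_inv, le_div_iff₀ (by positivity)]
  linarith

lemma fej_lower {x : ℝ} (hx : |x| ≤ 1) : 1 / 4 ≤ fej x := by
  by_cases h0 : x = 0
  · rw [h0, fej_zero]; norm_num
  · rw [fej_eq h0, le_div_iff₀ (by positivity)]
    have := Real.cos_le_one_sub_mul_cos_sq (x := x) (hx.trans (by linarith [Real.pi_gt_three]))
    have hpi : 2 / Real.pi ^ 2 ≥ 1 / 8 := by
      rw [ge_iff_le, div_le_div_iff₀ (by norm_num) (by positivity)]
      nlinarith [Real.pi_gt_three, Real.pi_le_four]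
    nlinarith [sq_nonneg x]

lemma continuous_fej : Continuous fej := by
  unfold fej
  refine continuous_of_dominated (bound := tent) ?_ ?_ integrable_tent ?_
  · intro x
    exact (continuous_tent.mul (by fun_prop)).aestronglyMeasurable
  · intro x
    refine Eventually.of_forall fun t => ?_
    rw [Real.norm_eq_abs, abs_mul, abs_of_nonneg (tent_nonneg t)]
    exact mul_le_of_le_one_right (tent_nonneg t) (Real.abs_cos_le_one _)
  · exact Eventually.of_forall fun t => by fun_prop

lemma fej_add_shift_pos (x : ℝ) : 0 < fej x + fej (x - 1) := by
  by_contra h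
  have h1 : fej x = 0 := by linarith [fej_nonneg x, fej_nonneg (x - 1)]
  have h2 : fej (x - 1) = 0 := by linarith [fej_nonneg x, fej_nonneg (x - 1)]
  have key : ∀ y, fej y = 0 → Real.cos y = 1 := by
    intro y hy
    by_cases h0 : y = 0
    · rw [h0, fej_zero] at hy; norm_num at hy
    · rw [fej_eq h0, div_eq_zero_iff] at hy
      rcases hy with hy | hy
      · linarith
      · exact absurd hy (by positivity)
  obtain ⟨m, hm⟩ := (Real.cos_eq_one_iff x).1 (key _ h1)
  obtain ⟨k, hk⟩ := (Real.cos_eq_one_iff (x - 1)).1 (key _ h2)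
  have e : ((m - k : ℤ) : ℝ) * (2 * Real.pi) = 1 := by push_cast; linarith
  have hpos : 0 < (m - k : ℤ) := by
    by_contra hn
    have : ((m - k : ℤ) : ℝ) ≤ 0 := by exact_mod_cast not_lt.1 hn
    nlinarith [Real.pi_gt_three]
  have : (1 : ℝ) ≤ ((m - k : ℤ) : ℝ) := by exact_mod_cast hpos
  nlinarith [Real.pi_gt_three]

lemma integrable_fej : Integrable fej := by
  refine (integrable_inv_one_add_sq.const_mul 5).mono' continuous_fej.aestronglyMeasurable ?_
  refine Eventually.of_forall fun x => ?_
  rw [Real.norm_eq_abs, abs_of_nonneg (fej_nonneg x)]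
  exact fej_upper x

lemma fej_fourier (v : ℝ) :
    ∫ x : ℝ, (fej x : ℂ) * Complex.exp (v * x * Complex.I) = 2 * Real.pi * tent v := by
  have hpi : 0 < 2 * Real.pi := by positivity
  set f : ℝ → ℂ := fun t => (tent t : ℂ) with hf
  have hfc : Continuous f := Complex.continuous_ofReal.comp continuous_tent
  have hF : ∀ w, FourierTransform.fourier f w = (fej (2 * Real.pi * w) : ℂ) := by
    intro w
    rw [Real.fourier_real_eq_integral_exp_smul, ← tent_fourier,
      ← integral_neg_eq_self]
    refine integral_congr_ae (Eventually.of_forall fun t => ?_)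
    simp only [hf, smul_eq_mul]
    rw [mul_comm]
    congr 2
    · simp [tent]
    · push_cast; ring
  have h1 : FourierTransformInv.fourierInv (FourierTransform.fourier f) = f := by
    refine hfc.fourierInv_fourier_eq (integrable_tent.ofReal) ?_
    have : FourierTransform.fourier f = fun w => (fej (2 * Real.pi * w) : ℂ) := funext hF
    rw [this]
    exact (integrable_fej.comp_mul_left' hpi.ne').ofReal
  have h2 := congrFun h1 v
  rw [Real.fourierInv_eq'] at h2
  simp only [hF, smul_eq_mul] at h2
  have h3 := Measure.integral_comp_mul_left
    (fun x : ℝ => (fej x : ℂ) * Complex.exp (v * x * Complex.I)) (2 * Real.pi)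
  have e : ∫ w : ℝ, (fej (2 * Real.pi * w) : ℂ) * Complex.exp (v * ((2 * Real.pi * w : ℝ) : ℂ)
      * Complex.I) = f v := by
    rw [← h2]
    refine integral_congr_ae (Eventually.of_forall fun w => ?_)
    simp only
    rw [mul_comm]
    congr 2
    simp only [RCLike.inner_apply, conj_trivial]
    push_cast; ring
  rw [e, abs_of_pos (by positivity)] at h3
  rw [hf] at h3
  simp only [Complex.real_smul] at h3
  rw [h3]
  push_cast
  rw [← mul_assoc, mul_inv_cancel₀ (by exact_mod_cast hpi.ne'), one_mul]

section

/-- A centred, square integrable, non-degenerate and non-lattice step law. -/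
structure StepLaw (F : Measure ℝ) : Prop where
  mean : ∫ x, x ∂F = 0
  int2 : Integrable (fun x : ℝ => x ^ 2) F
  var : 0 < ∫ x, x ^ 2 ∂F
  nl : NonLattice F

variable {F : Measure ℝ} [IsProbabilityMeasure F]

lemma NonLattice.norm_charFun_lt_one (h : NonLattice F) {t : ℝ} (ht : t ≠ 0) :
    ‖charFun F t‖ < 1 := by
  refine lt_of_le_of_ne (norm_charFun_le_one t) fun h1 => h ?_
  set z := charFun F t with hz
  set θ := Complex.arg z with hθ
  have hzexp : z = Complex.exp (θ * Complex.I) := by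
    have := Complex.norm_mul_exp_arg_mul_I z
    rw [h1] at this; rw [← this]; simp [hθ]
  have hint : ∀ g : ℝ → ℝ, Continuous g → Integrable
      (fun x => Complex.exp (g x * Complex.I)) F := by
    intro g hg
    apply Integrable.of_bound (C := 1)
      (Continuous.aestronglyMeasurable (by fun_prop))
    exact Eventually.of_forall fun x => (Complex.norm_exp_ofReal_mul_I _).le
  have e1 : ∫ x : ℝ, Complex.exp ((t * x - θ : ℝ) * Complex.I) ∂F = 1 := by
    have : ∀ x : ℝ, Complex.exp ((t * x - θ : ℝ) * Complex.I)
        = Complex.exp (t * x * Complex.I) * Complex.exp (-(θ * Complex.I)) := by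
      intro x
      rw [← Complex.exp_add]; congr 1; push_cast; ring
    simp only [this]
    rw [integral_mul_const, ← charFun_apply_real, ← hz, hzexp, ← Complex.exp_add]
    simp
  have e2 : ∫ x : ℝ, (1 - Real.cos (t * x - θ)) ∂F = 0 := by
    have hc : Integrable (fun x => Real.cos (t * x - θ)) F :=
      Integrable.of_bound (C := 1) (Continuous.aestronglyMeasurable (by fun_prop))
        (Eventually.of_forall fun x => Real.abs_cos_le_one _)
    have h3 := Complex.reCLM.integral_comp_comm (hint (fun x => t * x - θ) (by fun_prop))
    rw [e1] at h3
    simp only [Complex.reCLM_apply, Complex.exp_ofReal_mul_I_re, Complex.one_re] at h3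
    rw [integral_sub (by simp) hc, h3]; simp
  rw [integral_eq_zero_iff_of_nonneg (fun x => by
      simpa using Real.cos_le_one (t * x - θ)) (by
      apply Integrable.of_bound (C := 2) (Continuous.aestronglyMeasurable (by fun_prop))
      refine Eventually.of_forall fun x => ?_
      rw [Real.norm_eq_abs, abs_le]
      constructor <;> linarith [Real.cos_le_one (t * x - θ),
        Real.neg_one_le_cos (t * x - θ)])] at e2
  refine ⟨θ / t, 2 * Real.pi / t, ?_⟩
  have : {x : ℝ | ∃ k : ℤ, x = θ / t + k * (2 * Real.pi / t)} =ᵐ[F] univ := by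
    rw [eventuallyEq_univ]
    filter_upwards [e2] with x hx
    have hx' : Real.cos (t * x - θ) = 1 := by
      have : 1 - Real.cos (t * x - θ) = 0 := hx
      linarith
    obtain ⟨k, hk⟩ := (Real.cos_eq_one_iff _).1 hx'
    refine ⟨k, ?_⟩
    field_simp
    linarith
  rw [measure_congr this, measure_univ]

namespace StepLaw

variable (hF : StepLaw F)
include hF

omit [IsProbabilityMeasure F] in
lemma sd_pos : 0 < √(∫ x, x ^ 2 ∂F) := Real.sqrt_pos.2 hF.var

omit hF [IsProbabilityMeasure F] in
lemma charFun_scaled (σ t : ℝ) : charFun (F.map fun x => σ⁻¹ * x) t = charFun F (σ⁻¹ * t) :=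
  charFun_map_mul _ _

omit [IsProbabilityMeasure F] in
lemma scaled_moments : (∫ x, (√(∫ x, x ^ 2 ∂F))⁻¹ * x ∂F = 0) ∧
    ∫ x, ((fun x : ℝ => (√(∫ x, x ^ 2 ∂F))⁻¹ * x) ^ 2) x ∂F = 1 := by
  constructor
  · rw [integral_const_mul, hF.mean, mul_zero]
  · simp only [Pi.pow_apply, mul_pow]
    rw [integral_const_mul, inv_pow, Real.sq_sqrt hF.var.le, inv_mul_cancel₀ hF.var.ne']

lemma norm_charFun_le_near : ∃ c > 0, ∃ δ > 0, ∀ t, |t| < δ →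
    ‖charFun F t‖ ≤ Real.exp (-c * t ^ 2) := by
  set σ := √(∫ x, x ^ 2 ∂F) with hσ
  have hσ0 : 0 < σ := hF.sd_pos
  have := taylor_charFun_two (P := F) (X := fun x => σ⁻¹ * x) (by fun_prop)
    hF.scaled_moments.1 hF.scaled_moments.2
  have h2 := this.bound (show (0 : ℝ) < 1 / 4 by norm_num)
  rw [Metric.eventually_nhds_iff] at h2
  obtain ⟨δ, hδ, h2⟩ := h2
  refine ⟨σ ^ 2 / 4, by positivity, min δ 1 / σ, by positivity, fun t ht => ?_⟩
  rw [lt_div_iff₀ hσ0] at ht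
  have ht' : |t * σ| < min δ 1 := by rwa [abs_mul, abs_of_pos hσ0]
  have h3 := @h2 (t * σ) (by rw [dist_zero_right]; exact ht'.trans_le (min_le_left _ _))
  have ht1 : |t * σ| < 1 := ht'.trans_le (min_le_right _ _)
  rw [charFun_scaled, show σ⁻¹ * (t * σ) = t by field_simp] at h3
  have hsq : (t * σ) ^ 2 ≤ 1 := by
    rw [← sq_abs]; nlinarith [abs_nonneg (t * σ)]
  have h4 : ‖charFun F t‖ ≤ 1 / 4 * (t * σ) ^ 2 + (1 - (t * σ) ^ 2 / 2) := by
    have e : charFun F t = (charFun F t - (1 - ((t * σ : ℝ) : ℂ) ^ 2 / 2))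
      + ((1 - (t * σ) ^ 2 / 2 : ℝ) : ℂ) := by push_cast; ring
    rw [e]
    refine (norm_add_le _ _).trans (add_le_add ?_ ?_)
    · refine h3.trans (le_of_eq ?_)
      rw [norm_pow, Real.norm_eq_abs, sq_abs]
    · rw [Complex.norm_real, Real.norm_eq_abs, abs_of_nonneg (by linarith)]
  refine h4.trans ?_
  have := Real.add_one_le_exp (-(σ ^ 2 / 4) * t ^ 2)
  nlinarith

lemma norm_charFun_le_exp (a : ℝ) : ∃ c > 0, ∀ t, |t| ≤ a →
    ‖charFun F t‖ ≤ Real.exp (-c * t ^ 2) := by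
  obtain ⟨c, hc, δ, hδ, h⟩ := hF.norm_charFun_le_near
  have hK : IsCompact ({t : ℝ | δ ≤ |t|} ∩ Icc (-a) a) :=
    isCompact_Icc.inter_left (isClosed_le continuous_const continuous_abs)
  have hcont : Continuous fun t => ‖charFun F t‖ := continuous_charFun.norm
  rcases ({t : ℝ | δ ≤ |t|} ∩ Icc (-a) a).eq_empty_or_nonempty with he | hne
  · refine ⟨c, hc, fun t ht => h t ?_⟩
    by_contra hn
    have : t ∈ ({t : ℝ | δ ≤ |t|} ∩ Icc (-a) a) := ⟨not_lt.1 hn, abs_le.1 ht⟩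
    rw [he] at this; exact this
  · obtain ⟨t0, ht0, hmax⟩ := hK.exists_isMaxOn hne hcont.continuousOn
    have ht00 : t0 ≠ 0 := by
      rintro rfl
      have : δ ≤ |(0 : ℝ)| := ht0.1
      rw [abs_zero] at this; linarith
    have hlt := hF.nl.norm_charFun_lt_one ht00
    set ε := 1 - ‖charFun F t0‖
    have hε : 0 < ε := by simp only [ε]; linarith
    refine ⟨min c (ε / (a ^ 2 + 1)), lt_min hc (by positivity), fun t ht => ?_⟩
    by_cases htd : |t| < δ
    · refine (h t htd).trans (Real.exp_le_exp.2 ?_)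
      have := min_le_left c (ε / (a ^ 2 + 1))
      nlinarith [sq_nonneg t]
    · have h1 : ‖charFun F t‖ ≤ 1 - ε := by
        have := hmax (show t ∈ _ from ⟨not_lt.1 htd, abs_le.1 ht⟩)
        simp only [ε, sub_sub_cancel]; exact this
      have h2 := Real.add_one_le_exp (-(min c (ε / (a ^ 2 + 1))) * t ^ 2)
      have h3 : min c (ε / (a ^ 2 + 1)) * t ^ 2 ≤ ε := by
        have h5 : t ^ 2 ≤ a ^ 2 := by rw [← sq_abs t]; gcongr
        calc min c (ε / (a ^ 2 + 1)) * t ^ 2 ≤ ε / (a ^ 2 + 1) * (a ^ 2 + 1) := by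
              gcongr
              · exact min_le_right _ _
              · linarith
          _ = ε := by field_simp
      linarith

lemma tendsto_charFun_pow (w : ℝ) : Tendsto (fun n : ℕ => charFun F ((√n)⁻¹ * w) ^ n) atTop
    (𝓝 (Real.exp (-(∫ x, x ^ 2 ∂F) * w ^ 2 / 2) : ℝ)) := by
  have hσ0 := hF.sd_pos
  have := tendsto_charFun_inv_sqrt_mul_pow (P := F)
    (X := fun x => (√(∫ x, x ^ 2 ∂F))⁻¹ * x) (by fun_prop)
    hF.scaled_moments.1 hF.scaled_moments.2 (√(∫ x, x ^ 2 ∂F) * w)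
  simp only [charFun_scaled] at this
  convert this using 2
  · rename_i n
    congr 2
    field_simp
  · rw [Complex.ofReal_exp]
    congr 1
    push_cast
    rw [mul_pow, ← Complex.ofReal_pow (√(∫ x, x ^ 2 ∂F)), Real.sq_sqrt hF.var.le]
    ring

end StepLaw

end

section

section AECont

lemma tendsto_integral_of_ae_continuousAt_nonneg {ν : ℕ → ProbabilityMeasure ℝ}
    {ν₀ : ProbabilityMeasure ℝ} (h : Tendsto ν atTop (𝓝 ν₀)) {g : ℝ → ℝ} (hg : Measurable g)
    {B : ℝ} (h0 : ∀ x, 0 ≤ g x) (hB : ∀ x, g x ≤ B)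
    (hc : ∀ᵐ x ∂(ν₀ : Measure ℝ), ContinuousAt g x) :
    Tendsto (fun n => ∫ x, g x ∂(ν n : Measure ℝ)) atTop (𝓝 (∫ x, g x ∂(ν₀ : Measure ℝ))) := by
  have hint : ∀ m : ProbabilityMeasure ℝ, Integrable g (m : Measure ℝ) := fun m =>
    Integrable.of_bound (C := B) hg.aestronglyMeasurable
      (Eventually.of_forall fun x => by rw [Real.norm_eq_abs, abs_of_nonneg (h0 x)]; exact hB x)
  simp only [fun m : ProbabilityMeasure ℝ =>
    (hint m).integral_eq_integral_meas_lt (Eventually.of_forall h0)]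
  refine tendsto_integral_of_dominated_convergence
    (fun t : ℝ => (Iic B).indicator (fun _ => (1 : ℝ)) t) ?_ ?_ ?_ ?_
  · intro n
    refine Measurable.aestronglyMeasurable ?_
    refine Antitone.measurable fun s t hst => ?_
    exact measureReal_mono fun x hx => lt_of_le_of_lt hst hx
  · change IntegrableOn (fun t : ℝ => (Iic B).indicator (fun _ => (1 : ℝ)) t) (Ioi 0) volume
    rw [integrableOn_indicator_iff measurableSet_Iic]
    refine integrableOn_const (by
      rw [inter_comm, Ioi_inter_Iic]
      simp) (by simp)
  · intro n
    refine Eventually.of_forall fun t => ?_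
    by_cases ht : t ≤ B
    · simp only [indicator, mem_Iic, ht, if_true]
      rw [Real.norm_eq_abs, abs_of_nonneg measureReal_nonneg]
      exact measureReal_le_one
    · have : {a | t < g a} = ∅ := by
        ext a; simp only [mem_ofPred_eq, mem_empty_iff_false, iff_false, not_lt]
        linarith [hB a]
      simp [this, indicator, ht]
  · have hcount := Measure.countable_meas_level_set_pos (μ := (ν₀ : Measure ℝ)) hg
    have hae : ∀ᵐ t ∂(volume.restrict (Ioi (0:ℝ))), (ν₀ : Measure ℝ) {a | g a = t} = 0 := by
      refine ae_restrict_of_ae ?_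
      have := hcount.ae_notMem (volume : Measure ℝ)
      filter_upwards [this] with t ht
      simpa using ht
    filter_upwards [hae] with t ht
    have hfr : (ν₀ : Measure ℝ) (frontier {a | t < g a}) = 0 := by
      have hsub : frontier {a | t < g a} ⊆ {a | g a = t} ∪ {a | ¬ ContinuousAt g a} := by
        intro a ha
        by_cases hca : ContinuousAt g a
        · left
          rcases lt_trichotomy (g a) t with hlt | heq | hgt
          · exfalso
            have := (hca.eventually (gt_mem_nhds hlt))
            rw [frontier, Set.mem_sdiff] at ha
            rw [mem_closure_iff_frequently] at ha
            refine ha.1 (this.mono fun y hy hy' => ?_)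
            exact absurd hy (not_lt.2 (le_of_lt hy'))
          · exact heq
          · exfalso
            have := (hca.eventually (lt_mem_nhds hgt))
            rw [frontier, Set.mem_sdiff] at ha
            exact ha.2 (mem_interior_iff_mem_nhds.2 this)
        · right; exact hca
      refine measure_mono_null hsub (measure_union_null ht ?_)
      exact hc
    have := ProbabilityMeasure.tendsto_measure_of_null_frontier_of_tendsto' h hfr
    exact (ENNReal.tendsto_toReal (measure_ne_top _ _)).comp this

lemma tendsto_integral_of_ae_continuousAt {ν : ℕ → ProbabilityMeasure ℝ}
    {ν₀ : ProbabilityMeasure ℝ} (h : Tendsto ν atTop (𝓝 ν₀)) {g : ℝ → ℝ} (hg : Measurable g)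
    {B : ℝ} (hB : ∀ x, |g x| ≤ B) (hc : ∀ᵐ x ∂(ν₀ : Measure ℝ), ContinuousAt g x) :
    Tendsto (fun n => ∫ x, g x ∂(ν n : Measure ℝ)) atTop (𝓝 (∫ x, g x ∂(ν₀ : Measure ℝ))) := by
  have h1 := tendsto_integral_of_ae_continuousAt_nonneg h (g := fun x => g x + B)
    (hg.add_const B) (B := B + B) (fun x => by linarith [neg_abs_le (g x), hB x])
    (fun x => by linarith [le_abs_self (g x), hB x])
    (hc.mono fun x hx => hx.add continuousAt_const)
  have hint : ∀ m : ProbabilityMeasure ℝ, Integrable g (m : Measure ℝ) := fun m =>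
    Integrable.of_bound (C := B) hg.aestronglyMeasurable (Eventually.of_forall hB)
  have e : ∀ m : ProbabilityMeasure ℝ, ∫ x, (g x + B) ∂(m : Measure ℝ)
      = ∫ x, g x ∂(m : Measure ℝ) + B := fun m => by
    rw [integral_add (hint m) (integrable_const _)]; simp
  simp only [e] at h1
  simpa using h1.sub_const B

end AECont

lemma integral_fej_charFun (ν : Measure ℝ) [IsFiniteMeasure ν] (c v : ℝ) :
    ∫ x : ℝ, (fej (x - c) : ℂ) * Complex.exp (v * x * Complex.I) ∂ν
      = ∫ u : ℝ, (tent u : ℂ) * Complex.exp (-(u * c) * Complex.I) * charFun ν (u + v) := by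
  have e1 : ∀ x : ℝ, (fej (x - c) : ℂ) * Complex.exp (v * x * Complex.I)
      = ∫ u : ℝ, (tent u : ℂ) * Complex.exp (-(u * c) * Complex.I)
          * Complex.exp ((u + v : ℝ) * x * Complex.I) := by
    intro x
    rw [← tent_fourier, ← integral_mul_const]
    congr 1; ext u
    rw [mul_assoc, mul_assoc (tent u : ℂ), ← Complex.exp_add, ← Complex.exp_add]
    congr 2; push_cast; ring
  simp only [e1]
  rw [integral_integral_swap]
  · congr 1; ext u
    rw [integral_const_mul, ← charFun_apply_real]
  · have hb : Integrable (fun p : ℝ × ℝ => tent p.2) (ν.prod volume) :=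
      integrable_tent.comp_snd ν
    refine hb.mono' (Continuous.aestronglyMeasurable ?_) (Eventually.of_forall fun p => ?_)
    · have := continuous_tent
      fun_prop
    · have e : ∀ p : ℝ × ℝ, ‖Complex.exp (-(p.2 * p.1) * Complex.I)‖ = 1 := by
        intro p
        have := Complex.norm_exp_ofReal_mul_I (-(p.2 * p.1))
        push_cast at this; exact this
      have h1 := Complex.norm_exp_ofReal_mul_I (-(p.2 * c))
      have h2 := Complex.norm_exp_ofReal_mul_I ((p.2 + v) * p.1)
      push_cast at h1 h2
      simp only [Function.uncurry, norm_mul, Complex.norm_real]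
      push_cast
      rw [h1, h2, mul_one, mul_one, Real.norm_eq_abs, abs_of_nonneg (tent_nonneg _)]

variable {F : Measure ℝ} [IsProbabilityMeasure F]

namespace StepLaw

variable (hF : StepLaw F)
include hF

lemma exists_integral_fej_le : ∃ C > 0, ∀ n : ℕ, 1 ≤ n → ∀ c : ℝ,
    ∫ x, fej (x - c) ∂(cpow F n) ≤ C / √n := by
  obtain ⟨a, ha, h⟩ := hF.norm_charFun_le_exp 1
  refine ⟨√(Real.pi / a), by positivity, fun n hn c => ?_⟩
  have hn0 : (0 : ℝ) < n := by exact_mod_cast hn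
  have h1 := integral_fej_charFun (cpow F n) c 0
  simp only [Complex.ofReal_zero, zero_mul, Complex.exp_zero, mul_one, add_zero] at h1
  rw [integral_complex_ofReal] at h1
  have h2 : ‖((∫ x, fej (x - c) ∂(cpow F n) : ℝ) : ℂ)‖ ≤ ∫ u : ℝ, Real.exp (-(a * n) * u ^ 2) := by
    rw [h1]
    refine norm_integral_le_of_norm_le (integrable_exp_neg_mul_sq (by positivity)) ?_
    refine Eventually.of_forall fun u => ?_
    have h3 := Complex.norm_exp_ofReal_mul_I (-(u * c))
    push_cast at h3
    rw [norm_mul, norm_mul, h3, mul_one, charFun_cpow, Complex.norm_real, Real.norm_eq_abs,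
      abs_of_nonneg (tent_nonneg u), Pi.pow_apply, norm_pow]
    by_cases hu : 1 ≤ |u|
    · rw [tent_eq_zero hu, zero_mul]; positivity
    · calc tent u * ‖charFun F u‖ ^ n ≤ 1 * (Real.exp (-a * u ^ 2)) ^ n := by
            gcongr
            · exact tent_le_one u
            · exact h u (not_le.1 hu).le
        _ = _ := by rw [one_mul, ← Real.exp_nat_mul]; congr 1; ring
  rw [integral_gaussian, Complex.norm_real, Real.norm_eq_abs] at h2
  refine (le_abs_self _).trans (h2.trans (le_of_eq ?_))
  rw [← div_div, Real.sqrt_div' _ hn0.le]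

omit hF in
lemma integrable_fej_sub (ν : Measure ℝ) [IsFiniteMeasure ν] (c : ℝ) :
    Integrable (fun x => fej (x - c)) ν :=
  Integrable.of_bound (C := 1)
    (Continuous.aestronglyMeasurable (continuous_fej.comp (by fun_prop)))
    (Eventually.of_forall fun x => by
      rw [Real.norm_eq_abs, abs_of_nonneg (fej_nonneg _)]; exact fej_le_one _)

lemma exists_cpow_Ico_le : ∃ C > 0, ∀ n : ℕ, 1 ≤ n → ∀ c : ℝ,
    (cpow F n).real (Ico c (c + 1)) ≤ C / √n := by
  obtain ⟨C, hC, h⟩ := hF.exists_integral_fej_le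
  refine ⟨4 * C, by positivity, fun n hn c => ?_⟩
  have h1 : ∫ x, (Ico c (c + 1)).indicator (fun _ => (1 / 4 : ℝ)) x ∂(cpow F n)
      ≤ ∫ x, fej (x - c) ∂(cpow F n) := by
    refine integral_mono ((integrable_const _).indicator measurableSet_Ico)
      (integrable_fej_sub _ c) fun x => ?_
    by_cases hx : x ∈ Ico c (c + 1)
    · simp only [indicator, hx, if_true]
      exact fej_lower (by rw [abs_le]; constructor <;> linarith [hx.1, hx.2])
    · simp only [indicator, hx, if_false]; exact fej_nonneg _
  rw [integral_indicator_const _ measurableSet_Ico, smul_eq_mul] at h1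
  have := h n hn c
  rw [mul_div_assoc]; linarith

end StepLaw

end

section

variable {F : Measure ℝ} [IsProbabilityMeasure F]

/-- A strictly positive integrable weight whose Fourier transform has compact support. -/
def wt (x : ℝ) : ℝ := fej x + fej (x - 1)

lemma wt_pos (x : ℝ) : 0 < wt x := fej_add_shift_pos x

lemma continuous_wt : Continuous wt :=
  continuous_fej.add (continuous_fej.comp (by fun_prop))

lemma wt_le_two (x : ℝ) : wt x ≤ 2 := by
  unfold wt; linarith [fej_le_one x, fej_le_one (x - 1)]

lemma integrable_wt_volume : Integrable wt := integrable_fej.add (integrable_fej.comp_sub_right 1)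

lemma integrable_wt (ν : Measure ℝ) [IsFiniteMeasure ν] : Integrable wt ν :=
  Integrable.of_bound (C := 2) continuous_wt.aestronglyMeasurable
    (Eventually.of_forall fun x => by
      rw [Real.norm_eq_abs, abs_of_pos (wt_pos x)]; exact wt_le_two x)

lemma integrable_ofReal_mul_exp {ν : Measure ℝ} {g : ℝ → ℝ} (hg : Integrable g ν) (v : ℝ) :
    Integrable (fun x : ℝ => (g x : ℂ) * Complex.exp (v * x * Complex.I)) ν := by
  refine hg.ofReal.mul_bdd (c := 1) (Continuous.aestronglyMeasurable (by fun_prop)) ?_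
  refine Eventually.of_forall fun x => ?_
  have := Complex.norm_exp_ofReal_mul_I (v * x)
  push_cast at this; exact this.le

lemma fej_sub_fourier (c v : ℝ) :
    ∫ x : ℝ, (fej (x - c) : ℂ) * Complex.exp (v * x * Complex.I)
      = Complex.exp (v * c * Complex.I) * (2 * Real.pi * tent v) := by
  rw [← fej_fourier, ← integral_const_mul,
    ← integral_sub_right_eq_self (fun x : ℝ => Complex.exp (v * c * Complex.I) *
      ((fej x : ℂ) * Complex.exp (v * x * Complex.I))) c]
  congr 1; ext x
  rw [mul_left_comm, ← Complex.exp_add]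
  congr 2; push_cast; ring

namespace StepLaw

variable (hF : StepLaw F)
include hF

lemma tendsto_integral_fej_charFun (c v : ℝ) :
    Tendsto (fun n : ℕ => (√n : ℂ) *
        ∫ x : ℝ, (fej (x - c) : ℂ) * Complex.exp (v * x * Complex.I) ∂(cpow F n)) atTop
      (𝓝 (Complex.exp (v * c * Complex.I) * tent v *
        ∫ w : ℝ, ((Real.exp (-(∫ x, x ^ 2 ∂F) * w ^ 2 / 2) : ℝ) : ℂ))) := by
  obtain ⟨a, ha, hdec⟩ := hF.norm_charFun_le_exp (1 + |v|)
  have key : ∀ n : ℕ, 1 ≤ n → (√n : ℂ) *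
        ∫ x : ℝ, (fej (x - c) : ℂ) * Complex.exp (v * x * Complex.I) ∂(cpow F n)
      = ∫ w : ℝ, (tent ((√n)⁻¹ * w - v) : ℂ) *
          Complex.exp (-(((√n)⁻¹ * w - v : ℝ) * c) * Complex.I) * charFun F ((√n)⁻¹ * w) ^ n := by
    intro n hn
    have hn0 : (0 : ℝ) < √n := Real.sqrt_pos.2 (by exact_mod_cast hn)
    rw [integral_fej_charFun]
    have h1 := Measure.integral_comp_mul_left (fun w : ℝ => (tent (w - v) : ℂ) *
          Complex.exp (-((w - v : ℝ) * c) * Complex.I) * charFun F w ^ n) (√n)⁻¹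
    rw [h1, inv_inv, abs_of_pos hn0, Complex.real_smul]
    congr 1
    rw [← integral_sub_right_eq_self (fun u : ℝ => (tent u : ℂ) * Complex.exp (-(u * c) * Complex.I)
      * charFun (cpow F n) (u + v)) v]
    simp only [sub_add_cancel, charFun_cpow, Pi.pow_apply]
  have h2 : Tendsto (fun n : ℕ => ∫ w : ℝ, (tent ((√n)⁻¹ * w - v) : ℂ) *
          Complex.exp (-(((√n)⁻¹ * w - v : ℝ) * c) * Complex.I) * charFun F ((√n)⁻¹ * w) ^ n) atTop
      (𝓝 (∫ w : ℝ, Complex.exp (v * c * Complex.I) * tent v *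
        ((Real.exp (-(∫ x, x ^ 2 ∂F) * w ^ 2 / 2) : ℝ) : ℂ))) := by
    refine tendsto_integral_filter_of_dominated_convergence (fun w => Real.exp (-a * w ^ 2)) ?_ ?_
      (integrable_exp_neg_mul_sq ha) ?_
    · refine Eventually.of_forall fun n => Continuous.aestronglyMeasurable ?_
      have h3 := continuous_tent
      have h4 : Continuous (charFun F) := continuous_charFun
      fun_prop
    · filter_upwards [eventually_ge_atTop 1] with n hn
      refine Eventually.of_forall fun w => ?_
      have hn0 : (0 : ℝ) < √n := Real.sqrt_pos.2 (by exact_mod_cast hn)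
      have h3 := Complex.norm_exp_ofReal_mul_I (-(((√n)⁻¹ * w - v) * c))
      push_cast at h3
      push_cast
      rw [norm_mul, norm_mul, h3, mul_one, Complex.norm_real, Real.norm_eq_abs,
        abs_of_nonneg (tent_nonneg _), norm_pow]
      by_cases hu : 1 ≤ |(√n)⁻¹ * w - v|
      · rw [tent_eq_zero hu, zero_mul]; positivity
      · have hw : |(√n)⁻¹ * w| ≤ 1 + |v| := by
          have : |(√n)⁻¹ * w| ≤ |(√n)⁻¹ * w - v| + |v| := by
            simpa using abs_add_le ((√n)⁻¹ * w - v) v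
          linarith [not_le.1 hu]
        calc tent ((√n)⁻¹ * w - v) * ‖charFun F ((√n)⁻¹ * w)‖ ^ n
            ≤ 1 * (Real.exp (-a * ((√n)⁻¹ * w) ^ 2)) ^ n := by
              gcongr
              · exact tent_le_one _
              · exact hdec _ hw
          _ = _ := by
            rw [one_mul, ← Real.exp_nat_mul, mul_pow, inv_pow,
              Real.sq_sqrt (Nat.cast_nonneg n)]
            congr 1
            have : (n : ℝ) ≠ 0 := by positivity
            field_simp
    · refine Eventually.of_forall fun w => ?_
      have h0 : Tendsto (fun n : ℕ => (√n)⁻¹ * w - v) atTop (𝓝 (-v)) := by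
        have : Tendsto (fun n : ℕ => (√(n : ℝ))⁻¹) atTop (𝓝 0) :=
          tendsto_inv_atTop_zero.comp
            (Real.tendsto_sqrt_atTop.comp tendsto_natCast_atTop_atTop)
        simpa using (this.mul_const w).sub_const v
      refine Tendsto.mul ?_ (hF.tendsto_charFun_pow w)
      have hcont : Continuous fun u : ℝ => (tent u : ℂ) * Complex.exp (-(u * c) * Complex.I) := by
        have h3 := continuous_tent
        fun_prop
      have h5 := (hcont.tendsto (-v)).comp h0
      have e : Complex.exp (v * c * Complex.I) * tent v
          = (tent (-v) : ℂ) * Complex.exp (-((-v : ℝ) * c) * Complex.I) := by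
        rw [show tent (-v) = tent v by simp [tent], mul_comm]
        congr 2; push_cast; ring
      rw [e]; exact h5
  rw [integral_const_mul] at h2
  refine h2.congr' ?_
  filter_upwards [eventually_ge_atTop 1] with n hn
  exact (key n hn).symm

/-- The local limit constant `1 / √(2 π σ²)`, in the form delivered by Fourier inversion. -/
def llc (_ : StepLaw F) : ℝ := (2 * Real.pi)⁻¹ * ∫ w : ℝ, Real.exp (-(∫ x, x ^ 2 ∂F) * w ^ 2 / 2)

omit [IsProbabilityMeasure F] in
lemma llc_pos : 0 < hF.llc := by
  have hv := hF.var
  have : ∫ w : ℝ, Real.exp (-(∫ x, x ^ 2 ∂F) * w ^ 2 / 2)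
      = √(Real.pi / ((∫ x, x ^ 2 ∂F) / 2)) := by
    rw [← integral_gaussian]; congr 1; ext w; congr 1; ring
  rw [llc, this]
  have := Real.pi_pos
  positivity

lemma tendsto_wt_charFun (v : ℝ) :
    Tendsto (fun n : ℕ => (√n : ℂ) *
        ∫ x : ℝ, (wt x : ℂ) * Complex.exp (v * x * Complex.I) ∂(cpow F n)) atTop
      (𝓝 (hF.llc * ∫ x : ℝ, (wt x : ℂ) * Complex.exp (v * x * Complex.I))) := by
  have split : ∀ ν : Measure ℝ, Integrable (fun x => fej (x - 0)) ν →
      Integrable (fun x => fej (x - 1)) ν →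
      ∫ x : ℝ, (wt x : ℂ) * Complex.exp (v * x * Complex.I) ∂ν
        = ∫ x : ℝ, (fej (x - 0) : ℂ) * Complex.exp (v * x * Complex.I) ∂ν
          + ∫ x : ℝ, (fej (x - 1) : ℂ) * Complex.exp (v * x * Complex.I) ∂ν := by
    intro ν h1 h2
    rw [← integral_add (integrable_ofReal_mul_exp h1 v) (integrable_ofReal_mul_exp h2 v)]
    congr 1; ext x
    rw [wt, sub_zero]; push_cast; ring
  have h := (hF.tendsto_integral_fej_charFun 0 v).add (hF.tendsto_integral_fej_charFun 1 v)
  rw [split volume (by simpa using integrable_fej) (integrable_fej.comp_sub_right 1)]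
  simp only [fun n => split (cpow F n) (integrable_fej_sub _ 0) (integrable_fej_sub _ 1), mul_add]
  convert h using 2
  rw [fej_sub_fourier, fej_sub_fourier, llc, integral_complex_ofReal]
  have := Real.pi_pos.ne'
  have h' : (Real.pi : ℂ) ≠ 0 := by exact_mod_cast this
  push_cast
  field_simp

lemma tendsto_wt : Tendsto (fun n : ℕ => √n * ∫ x : ℝ, wt x ∂(cpow F n)) atTop
      (𝓝 (hF.llc * ∫ x : ℝ, wt x)) := by
  have h := hF.tendsto_wt_charFun 0
  simp only [Complex.ofReal_zero, zero_mul, Complex.exp_zero, mul_one] at h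
  simp only [integral_complex_ofReal] at h
  have := (Complex.continuous_re.tendsto _).comp h
  simpa [Function.comp_def] using this

omit hF in
lemma exp_log_wt (x : ℝ) : Real.exp (Real.log (wt x)) = wt x := Real.exp_log (wt_pos x)

omit hF in
lemma integral_wt_pos {ν : Measure ℝ} (h : Integrable wt ν) (h0 : ν ≠ 0) : 0 < ∫ x, wt x ∂ν := by
  rw [integral_pos_iff_support_of_nonneg (fun x => (wt_pos x).le) h]
  have : Function.support wt = univ := by ext x; simp [(wt_pos x).ne']
  rw [this]
  exact (Measure.measure_univ_pos).2 h0

omit hF in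
lemma integral_tilt (ν : Measure ℝ) (g : ℝ → ℝ) :
    ∫ x, g x ∂(ν.tilted fun x => Real.log (wt x)) = (∫ x, wt x ∂ν)⁻¹ * ∫ x, wt x * g x ∂ν := by
  rw [integral_tilted]
  simp only [exp_log_wt, smul_eq_mul]
  rw [← integral_const_mul]
  congr 1; ext x; ring

omit hF in
lemma charFun_tilt (ν : Measure ℝ) (v : ℝ) :
    charFun (ν.tilted fun x => Real.log (wt x)) v
      = (((∫ x, wt x ∂ν)⁻¹ : ℝ) : ℂ)
        * ∫ x : ℝ, (wt x : ℂ) * Complex.exp (v * x * Complex.I) ∂ν := by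
  rw [charFun_apply_real, integral_tilted]
  simp only [exp_log_wt]
  rw [← integral_const_mul]
  congr 1; ext x
  rw [Complex.real_smul]; push_cast; ring

omit hF in
lemma isProb_tilt {ν : Measure ℝ} (h : Integrable wt ν) (h0 : ν ≠ 0) :
    IsProbabilityMeasure (ν.tilted fun x => Real.log (wt x)) := by
  have : NeZero ν := ⟨h0⟩
  exact isProbabilityMeasure_tilted (by simpa only [exp_log_wt] using h)

lemma tendsto_tilt {g : ℝ → ℝ} (hg : Measurable g) {B : ℝ} (hB : ∀ x, |g x| ≤ B)
    (hc : ∀ᵐ x, ContinuousAt g x) :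
    Tendsto (fun n => ∫ x, g x ∂((cpow F n).tilted fun x => Real.log (wt x))) atTop
      (𝓝 (∫ x, g x ∂((volume : Measure ℝ).tilted fun x => Real.log (wt x)))) := by
  have hp : ∀ n, IsProbabilityMeasure ((cpow F n).tilted fun x => Real.log (wt x)) := fun n =>
    isProb_tilt (integrable_wt _) (IsProbabilityMeasure.ne_zero _)
  have hp0 : IsProbabilityMeasure ((volume : Measure ℝ).tilted fun x => Real.log (wt x)) :=
    isProb_tilt integrable_wt_volume (NeZero.ne _)
  refine tendsto_integral_of_ae_continuousAt (ν := fun n => (⟨_, hp n⟩ : ProbabilityMeasure ℝ))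
    (ν₀ := (⟨_, hp0⟩ : ProbabilityMeasure ℝ))
    ?_ hg hB ?_
  · refine ProbabilityMeasure.tendsto_iff_tendsto_charFun.2 fun v => ?_
    change Tendsto (fun n => charFun ((cpow F n).tilted fun x => Real.log (wt x)) v) atTop
      (𝓝 (charFun ((volume : Measure ℝ).tilted fun x => Real.log (wt x)) v))
    simp only [charFun_tilt]
    have h1 := hF.tendsto_wt
    have hne : hF.llc * ∫ x : ℝ, wt x ≠ 0 :=
      (mul_pos hF.llc_pos (integral_wt_pos integrable_wt_volume (NeZero.ne _))).ne'
    have h2 := (((Complex.continuous_ofReal.tendsto _).comp (h1.inv₀ hne)).mul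
      (hF.tendsto_wt_charFun v))
    have hl := hF.llc_pos.ne'
    refine (h2.congr' ?_).trans_eq ?_
    · filter_upwards [eventually_ge_atTop 1] with n hn
      have hn0 : (√n : ℂ) ≠ 0 := by
        exact_mod_cast (Real.sqrt_pos.2 (by exact_mod_cast hn : (0 : ℝ) < n)).ne'
      simp only [Function.comp, mul_inv]
      generalize ∫ x : ℝ, (wt x : ℂ) * Complex.exp (v * x * Complex.I) ∂(cpow F n) = I
      push_cast
      field_simp
    · congr 1
      have hl' : (hF.llc : ℂ) ≠ 0 := by exact_mod_cast hl
      generalize ∫ x : ℝ, (wt x : ℂ) * Complex.exp (v * x * Complex.I) = I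
      rw [mul_inv]; push_cast; field_simp
  · exact (tilted_absolutelyContinuous _ _).ae_le hc

/-- Local limit theorem for bounded, compactly supported, a.e. continuous functions. -/
lemma local_limit_bounded {g : ℝ → ℝ} (hg : Measurable g) {B K : ℝ} (hB : ∀ x, |g x| ≤ B)
    (hK : ∀ x, K < |x| → g x = 0) (hc : ∀ᵐ x, ContinuousAt g x) :
    Tendsto (fun n : ℕ => √n * ∫ x, g x ∂(cpow F n)) atTop (𝓝 (hF.llc * ∫ x, g x)) := by
  obtain ⟨δ, hδ, hδK⟩ : ∃ δ > 0, ∀ x ∈ Icc (-K) K, δ ≤ wt x := by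
    rcases (Icc (-K) K).eq_empty_or_nonempty with he | hne
    · exact ⟨1, one_pos, fun x hx => by rw [he] at hx; exact hx.elim⟩
    · obtain ⟨x0, -, h0⟩ := isCompact_Icc.exists_isMinOn hne continuous_wt.continuousOn
      exact ⟨wt x0, wt_pos x0, fun x hx => h0 hx⟩
  have hB0 : 0 ≤ B := (abs_nonneg _).trans (hB 0)
  have h1 := hF.tendsto_tilt (g := fun x => g x / wt x) (hg.div continuous_wt.measurable)
    (B := B / δ) (fun x => by
      by_cases hx : K < |x|
      · rw [hK x hx]; simp; positivity
      · rw [abs_div, abs_of_pos (wt_pos x)]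
        have := hδK x (abs_le.1 (not_lt.1 hx))
        gcongr
        exact hB x)
    (hc.mono fun x hx => hx.div continuous_wt.continuousAt (wt_pos x).ne')
  have e : ∀ x, wt x * (g x / wt x) = g x := fun x => by
    field_simp [(wt_pos x).ne']
  simp only [integral_tilt, e] at h1
  have h2 := hF.tendsto_wt.mul h1
  have hw0 := (integral_wt_pos integrable_wt_volume (NeZero.ne _)).ne'
  refine (h2.congr fun n => ?_).trans_eq ?_
  · have := (integral_wt_pos (integrable_wt (cpow F n)) (IsProbabilityMeasure.ne_zero _)).ne'
    field_simp
  · congr 1; field_simp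

end StepLaw

end

section

section Envelope
open scoped ENNReal

/-- Quadratic weight. -/
def wgt (x : ℝ) : ℝ := (1 + |x|) ^ 2

lemma one_le_wgt (x : ℝ) : 1 ≤ wgt x := by
  unfold wgt; nlinarith [abs_nonneg x]

lemma wgt_pos (x : ℝ) : 0 < wgt x := one_pos.trans_le (one_le_wgt x)

lemma wgt_add_le (x y : ℝ) : wgt (x + y) ≤ wgt x * wgt y := by
  unfold wgt
  rw [← mul_pow]
  have := abs_add_le x y
  refine pow_le_pow_left₀ (by positivity) ?_ 2
  nlinarith [abs_nonneg x, abs_nonneg y, mul_nonneg (abs_nonneg x) (abs_nonneg y)]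

lemma wgt_neg (x : ℝ) : wgt (-x) = wgt x := by simp [wgt]

lemma measurable_wgt : Measurable wgt := by unfold wgt; fun_prop

/-- Supremum of `|g|` over the unit interval `[k, k + 1)`. -/
def blk (g : ℝ → ℝ) (k : ℤ) : ℝ≥0∞ := ⨆ y ∈ Ico (k : ℝ) (k + 1), ‖g y‖ₑ

/-- Weighted amalgam norm. -/
def nrm (g : ℝ → ℝ) : ℝ≥0∞ := ∑' k : ℤ, ENNReal.ofReal (wgt k) * blk g k

lemma enorm_le_blk (g : ℝ → ℝ) {k : ℤ} {y : ℝ} (hy : y ∈ Ico (k : ℝ) (k + 1)) :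
    ‖g y‖ₑ ≤ blk g k := le_iSup₂ (f := fun y (_ : y ∈ Ico (k : ℝ) (k + 1)) => ‖g y‖ₑ) y hy

lemma mem_Ico_floor (y : ℝ) : y ∈ Ico (⌊y⌋ : ℝ) (⌊y⌋ + 1) :=
  ⟨Int.floor_le y, Int.lt_floor_add_one y⟩

lemma blk_le_nrm (g : ℝ → ℝ) (k : ℤ) : blk g k ≤ nrm g := by
  refine le_trans ?_ (ENNReal.le_tsum k)
  refine le_mul_of_one_le_left zero_le ?_
  rw [ENNReal.one_le_ofReal]; exact one_le_wgt _

lemma abs_le_nrm {g : ℝ → ℝ} (h : nrm g ≠ ∞) (x : ℝ) : |g x| ≤ (nrm g).toReal := by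
  have := (enorm_le_blk g (mem_Ico_floor x)).trans (blk_le_nrm g _)
  rw [← Real.norm_eq_abs, ← toReal_enorm]
  exact ENNReal.toReal_mono h this

lemma blk_mono {g g' : ℝ → ℝ} (h : ∀ x, |g x| ≤ |g' x|) (k : ℤ) : blk g k ≤ blk g' k := by
  refine iSup₂_mono fun y _ => ?_
  rw [← ofReal_norm, ← ofReal_norm]; exact ENNReal.ofReal_le_ofReal (h y)

lemma nrm_mono {g g' : ℝ → ℝ} (h : ∀ x, |g x| ≤ |g' x|) : nrm g ≤ nrm g' :=
  ENNReal.tsum_le_tsum fun k => by gcongr; exact blk_mono h k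

lemma nrm_shift_ne_top {g : ℝ → ℝ} (h : nrm g ≠ ∞) (c : ℝ) : nrm (fun x => g (x + c)) ≠ ∞ := by
  have hb : ∀ k : ℤ, blk (fun x => g (x + c)) k ≤ blk g (k + ⌊c⌋) + blk g (k + (⌊c⌋ + 1)) := by
    intro k
    refine iSup₂_le fun y hy => ?_
    have h1 := mem_Ico_floor c
    rcases lt_or_ge (y + c) (k + ⌊c⌋ + 1) with hlt | hge
    · refine (enorm_le_blk g (k := k + ⌊c⌋) ⟨?_, ?_⟩).trans le_self_add
      · push_cast; linarith [hy.1, h1.1]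
      · push_cast; linarith
    · refine (enorm_le_blk g (k := k + (⌊c⌋ + 1)) ⟨?_, ?_⟩).trans le_add_self
      · push_cast; linarith
      · push_cast; linarith [hy.2, h1.2]
  have hs : ∀ j : ℤ, ∑' k : ℤ, ENNReal.ofReal (wgt k) * blk g (k + j)
      ≤ ENNReal.ofReal (wgt j) * nrm g := by
    intro j
    unfold nrm
    rw [← ENNReal.tsum_mul_left, ← (Equiv.addRight j).tsum_eq
      (fun k : ℤ => ENNReal.ofReal (wgt j) * (ENNReal.ofReal (wgt k) * blk g k))]
    refine ENNReal.tsum_le_tsum fun k => ?_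
    simp only [Equiv.coe_addRight]
    rw [← mul_assoc, ← ENNReal.ofReal_mul (wgt_pos _).le]
    gcongr
    have := wgt_add_le (-(j : ℝ)) ((k + j : ℤ) : ℝ)
    rw [wgt_neg] at this
    refine le_trans (le_of_eq ?_) this
    congr 1; push_cast; ring
  have : nrm (fun x => g (x + c)) ≤ ENNReal.ofReal (wgt ⌊c⌋) * nrm g
      + ENNReal.ofReal (wgt (⌊c⌋ + 1 : ℤ)) * nrm g := by
    refine le_trans ?_ (add_le_add (hs _) (hs _))
    rw [← ENNReal.tsum_add]
    refine ENNReal.tsum_le_tsum fun k => ?_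
    rw [← mul_add]
    gcongr
    exact hb k
  refine ne_top_of_le_ne_top ?_ this
  exact ENNReal.add_ne_top.2 ⟨ENNReal.mul_ne_top ENNReal.ofReal_ne_top h,
    ENNReal.mul_ne_top ENNReal.ofReal_ne_top h⟩

/-- Polynomially decaying functions have finite norm. -/
lemma nrm_ne_top_of_decay {g : ℝ → ℝ} {C : ℝ} (h : ∀ y, |g y| ≤ C / wgt y ^ 2) : nrm g ≠ ∞ := by
  have hC : 0 ≤ C := by
    have := (abs_nonneg _).trans (h 0)
    simpa [wgt] using this
  have hs : Summable fun k : ℤ => 16 * C * (1 / (k : ℝ) ^ 2) + (if k = 0 then 16 * C else 0) := by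
    refine ((Real.summable_one_div_int_pow.2 (by norm_num)).mul_left _).add ?_
    exact (hasSum_ite_eq 0 (16 * C)).summable
  have hb : ∀ k : ℤ, ENNReal.ofReal (wgt k) * blk g k
      ≤ ENNReal.ofReal (16 * C * (1 / (k : ℝ) ^ 2) + (if k = 0 then 16 * C else 0)) := by
    intro k
    have h1 : blk g k ≤ ENNReal.ofReal (16 * C / wgt k ^ 2) := by
      refine iSup₂_le fun y hy => ?_
      rw [← ofReal_norm, Real.norm_eq_abs]
      refine ENNReal.ofReal_le_ofReal ((h y).trans ?_)
      have h2 : wgt k ≤ 4 * wgt y := by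
        have h3 := wgt_add_le y (k - y)
        rw [add_sub_cancel] at h3
        have h4 : wgt (k - y) ≤ 4 := by
          have : |k - y| ≤ 1 := by rw [abs_le]; constructor <;> linarith [hy.1, hy.2]
          unfold wgt; nlinarith [abs_nonneg (k - y)]
        nlinarith [wgt_pos y]
      rw [div_le_div_iff₀ (by have := wgt_pos y; positivity) (by have := wgt_pos k; positivity)]
      have h5 : wgt k ^ 2 ≤ (4 * wgt y) ^ 2 := pow_le_pow_left₀ (wgt_pos _).le h2 2
      nlinarith
    refine (mul_le_mul_right h1 _).trans ?_
    rw [← ENNReal.ofReal_mul (wgt_pos _).le]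
    refine ENNReal.ofReal_le_ofReal ?_
    have hw := wgt_pos (k : ℝ)
    have e : wgt k * (16 * C / wgt k ^ 2) = 16 * C / wgt k := by field_simp
    rw [e]
    by_cases hk : k = 0
    · simp [hk, wgt]
    · simp only [hk, if_false, add_zero]
      rw [mul_one_div]
      have hk' : (0 : ℝ) < (k : ℝ) ^ 2 := by positivity
      gcongr
      unfold wgt; nlinarith [abs_nonneg (k : ℝ), sq_abs (k : ℝ)]
  refine ne_top_of_le_ne_top ?_ (ENNReal.tsum_le_tsum hb)
  rw [← ENNReal.ofReal_tsum_of_nonneg _ hs]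
  · exact ENNReal.ofReal_ne_top
  · intro k; split_ifs <;> positivity

lemma lintegral_le_tsum_blk (m : Measure ℝ) (g : ℝ → ℝ) :
    ∫⁻ x, ‖g x‖ₑ ∂m ≤ ∑' k : ℤ, m (Ico (k : ℝ) (k + 1)) * blk g k := by
  have hu : ⋃ k : ℤ, Ico (k : ℝ) (k + 1) = univ := iUnion_Ico_intCast ℝ
  rw [← setLIntegral_univ, ← hu,
    lintegral_iUnion (fun _ => measurableSet_Ico) (pairwise_disjoint_Ico_intCast ℝ)]
  refine ENNReal.tsum_le_tsum fun k => ?_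
  rw [mul_comm, ← setLIntegral_const]
  exact setLIntegral_mono measurable_const fun x hx => enorm_le_blk g hx

/-- `m` puts mass at most `A * wgt c` on `[c, c + 1)`. -/
def Bnd (m : Measure ℝ) (A : ℝ) : Prop := ∀ c, m.real (Ico c (c + 1)) ≤ A * wgt c

namespace Bnd

variable {m : Measure ℝ} [IsFiniteMeasure m] {A : ℝ} {g : ℝ → ℝ}

omit [IsFiniteMeasure m] in
lemma nonneg (h : Bnd m A) : 0 ≤ A := by
  have := measureReal_nonneg.trans (h 0)
  simpa [wgt] using this

lemma lintegral_le (h : Bnd m A) (g : ℝ → ℝ) :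
    ∫⁻ x, ‖g x‖ₑ ∂m ≤ ENNReal.ofReal A * nrm g := by
  refine (lintegral_le_tsum_blk m g).trans ?_
  unfold nrm
  rw [← ENNReal.tsum_mul_left]
  refine ENNReal.tsum_le_tsum fun k => ?_
  rw [← mul_assoc, ← ENNReal.ofReal_mul h.nonneg]
  gcongr
  rw [← ofReal_measureReal]
  exact ENNReal.ofReal_le_ofReal (h k)

lemma integrable (h : Bnd m A) (hg : Measurable g) (hn : nrm g ≠ ∞) : Integrable g m :=
  ⟨hg.aestronglyMeasurable, lt_of_le_of_lt (h.lintegral_le g)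
    (ENNReal.mul_lt_top ENNReal.ofReal_lt_top hn.lt_top)⟩

lemma integral_abs_le (h : Bnd m A) (hg : Measurable g) (hn : nrm g ≠ ∞) :
    ∫ x, |g x| ∂m ≤ A * (nrm g).toReal := by
  have := h.lintegral_le g
  simp only [← Real.norm_eq_abs]
  rw [integral_norm_eq_lintegral_enorm hg.aestronglyMeasurable]
  refine (ENNReal.toReal_mono (ENNReal.mul_ne_top ENNReal.ofReal_ne_top hn) this).trans ?_
  rw [ENNReal.toReal_mul, ENNReal.toReal_ofReal h.nonneg]

lemma abs_integral_le (h : Bnd m A) (hg : Measurable g) (hn : nrm g ≠ ∞) :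
    |∫ x, g x ∂m| ≤ A * (nrm g).toReal :=
  (abs_integral_le_integral_abs).trans (h.integral_abs_le hg hn)

omit [IsFiniteMeasure m] in
lemma shift (h : Bnd m A) (c : ℝ) : Bnd (m.map (· + c)) (A * wgt c) := by
  intro b
  rw [map_measureReal_apply (by fun_prop) measurableSet_Ico]
  have : (fun x => x + c) ⁻¹' Ico b (b + 1) = Ico (b - c) (b - c + 1) := by
    ext x; simp only [mem_preimage, mem_Ico]
    constructor <;> rintro ⟨h1, h2⟩ <;> constructor <;> linarith
  rw [this, mul_assoc]
  refine (h _).trans (mul_le_mul_of_nonneg_left ?_ h.nonneg)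
  have := wgt_add_le b (-c)
  rw [wgt_neg, mul_comm] at this
  exact this

lemma integral_abs_shift_le (h : Bnd m A) (hg : Measurable g) (hn : nrm g ≠ ∞) (c : ℝ) :
    ∫ x, |g (x + c)| ∂m ≤ A * wgt c * (nrm g).toReal := by
  have := (h.shift c).integral_abs_le hg hn
  rwa [integral_map (by fun_prop) (by fun_prop)] at this

end Bnd

/-- Measurable, a.e. continuous functions of finite norm. -/
structure Cls (g : ℝ → ℝ) : Prop where
  meas : Measurable g
  cont : ∀ᵐ x, ContinuousAt g x
  fin : nrm g ≠ ∞

namespace Cls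

variable {g : ℝ → ℝ}

lemma shift (h : Cls g) (c : ℝ) : Cls fun x => g (x + c) where
  meas := h.meas.comp (by fun_prop)
  cont := by
    have := (measurePreserving_add_right (volume : Measure ℝ) c).quasiMeasurePreserving.ae h.cont
    filter_upwards [this] with x hx
    exact ContinuousAt.comp (f := fun x => x + c) hx (by fun_prop)
  fin := nrm_shift_ne_top h.fin c

lemma indicator (h : Cls g) {s : Set ℝ} (hs : MeasurableSet s)
    (hfr : volume (frontier s) = 0) : Cls (s.indicator g) where
  meas := h.meas.indicator hs
  cont := by
    have h2 : ∀ᵐ x, x ∉ frontier s := measure_eq_zero_iff_ae_notMem.1 hfr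
    filter_upwards [h.cont, h2] with x hx hx2
    by_cases hi : x ∈ interior s
    · refine hx.congr ?_
      filter_upwards [mem_interior_iff_mem_nhds.1 hi] with y hy
      rw [indicator_of_mem hy]
    · have hcl : x ∉ closure s := fun hc => hx2 ⟨hc, hi⟩
      have : sᶜ ∈ 𝓝 x := by
        have := isClosed_closure.isOpen_compl.mem_nhds hcl
        exact mem_of_superset this (compl_subset_compl.2 subset_closure)
      refine continuousAt_const (y := (0:ℝ)) |>.congr ?_
      filter_upwards [this] with y hy
      rw [indicator_of_notMem hy]
  fin := ne_top_of_le_ne_top h.fin (nrm_mono fun x => by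
    by_cases hx : x ∈ s
    · rw [indicator_of_mem hx]
    · rw [indicator_of_notMem hx, abs_zero]; exact abs_nonneg _)

lemma Iio (h : Cls g) (a : ℝ) : Cls ((Set.Iio a).indicator g) :=
  h.indicator measurableSet_Iio (by simp)

lemma Ico (h : Cls g) (a b : ℝ) : Cls ((Set.Ico a b).indicator g) := by
  refine h.indicator measurableSet_Ico ?_
  rcases lt_or_ge a b with hab | hab
  · rw [frontier_Ico hab]; exact (Set.toFinite _).measure_zero _
  · simp [Ico_eq_empty_of_le hab]

lemma halfLine (h : Cls g) {D : Set ℝ} (hD : HalfLine D) : Cls (D.indicator g) := by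
  refine h.indicator hD.meas ?_
  rcases hD with rfl | rfl <;> simp

/-- Convergence of rescaled integrals extends from compactly supported functions to the
whole class. -/
lemma exists_tendsto {ν : ℕ → Measure ℝ} [∀ n, IsFiniteMeasure (ν n)] {a : ℕ → ℝ}
    (ha : ∀ n, 0 ≤ a n) {C : ℝ} (hbd : ∀ n c, a n * (ν n).real (Set.Ico c (c + 1)) ≤ C * wgt c)
    (hlim : ∀ g : ℝ → ℝ, Cls g → (∃ K, ∀ x, K < |x| → g x = 0) →
      ∃ l, Tendsto (fun n => a n * ∫ x, g x ∂(ν n)) atTop (𝓝 l))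
    (h : Cls g) : ∃ l, Tendsto (fun n => a n * ∫ x, g x ∂(ν n)) atTop (𝓝 l) := by
  have hlim' : ∀ k : ℤ, ∃ l, Tendsto
      (fun n => a n * ∫ x in Set.Ico (k : ℝ) (k + 1), g x ∂(ν n)) atTop (𝓝 l) := by
    intro k
    obtain ⟨l, hl⟩ := hlim _ (h.Ico k (k + 1)) ⟨|(k : ℝ)| + 1, fun x hx => by
      rw [indicator_of_notMem]
      rintro ⟨h1, h2⟩
      rcases abs_cases x with ⟨h3, _⟩ | ⟨h3, _⟩ <;> rcases abs_cases (k : ℝ) with ⟨h4, _⟩ | ⟨h4, _⟩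
        <;> linarith⟩
    refine ⟨l, hl.congr fun n => ?_⟩
    rw [integral_indicator measurableSet_Ico]
  choose l hl using hlim'
  have hC : 0 ≤ C := by
    have := (mul_nonneg (ha 0) measureReal_nonneg).trans (hbd 0 0)
    simpa [wgt] using this
  have hblk : ∀ k, blk g k ≠ ∞ := fun k => ne_top_of_le_ne_top h.fin (blk_le_nrm g k)
  have hterm : ∀ n k, ‖a n * ∫ x in Set.Ico ((k : ℤ) : ℝ) (k + 1), g x ∂(ν n)‖
      ≤ C * (ENNReal.ofReal (wgt k) * blk g k).toReal := by
    intro n k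
    rw [norm_mul, Real.norm_of_nonneg (ha n), ENNReal.toReal_mul,
      ENNReal.toReal_ofReal (wgt_pos _).le, ← mul_assoc]
    have h1 : ‖∫ x in Set.Ico (k : ℝ) (k + 1), g x ∂(ν n)‖
        ≤ (blk g k).toReal * (ν n).real (Set.Ico (k : ℝ) (k + 1)) := by
      refine norm_setIntegral_le_of_norm_le_const (measure_lt_top _ _) fun x hx => ?_
      rw [← toReal_enorm]
      exact ENNReal.toReal_mono (hblk k) (enorm_le_blk g hx)
    calc _ ≤ a n * ((blk g k).toReal * (ν n).real (Set.Ico (k : ℝ) (k + 1))) :=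
          mul_le_mul_of_nonneg_left h1 (ha n)
      _ = a n * (ν n).real (Set.Ico (k : ℝ) (k + 1)) * (blk g k).toReal := by ring
      _ ≤ _ := mul_le_mul_of_nonneg_right (hbd n k) ENNReal.toReal_nonneg
  refine ⟨∑' k, l k, ?_⟩
  have hint : ∀ n, Integrable g (ν n) ∨ a n = 0 := by
    intro n
    rcases (ha n).eq_or_lt with h0 | h0
    · exact Or.inr h0.symm
    · left
      refine Bnd.integrable (A := C / a n) (fun c => ?_) h.meas h.fin
      rw [div_mul_eq_mul_div, le_div_iff₀ h0, mul_comm]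
      exact hbd n c
  have e : ∀ n, a n * ∫ x, g x ∂(ν n)
      = ∑' k : ℤ, a n * ∫ x in Set.Ico (k : ℝ) (k + 1), g x ∂(ν n) := by
    intro n
    rcases hint n with hi | h0
    · rw [tsum_mul_left, ← integral_iUnion (fun _ => measurableSet_Ico)
        (pairwise_disjoint_Ico_intCast ℝ) (by rw [iUnion_Ico_intCast]; exact hi.integrableOn),
        iUnion_Ico_intCast, setIntegral_univ]
    · simp [h0]
  simp only [e]
  refine tendsto_tsum_of_dominated_convergence
    (bound := fun k => C * (ENNReal.ofReal (wgt k) * blk g k).toReal) ?_ hl ?_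
  · exact (ENNReal.summable_toReal h.fin).mul_left _
  · exact Eventually.of_forall fun n k => hterm n k

end Cls

end Envelope

variable {F : Measure ℝ} [IsProbabilityMeasure F]

/-- Local limit theorem. -/
lemma StepLaw.local_limit (hF : StepLaw F) {g : ℝ → ℝ} (h : Cls g) :
    ∃ l, Tendsto (fun n : ℕ => √n * ∫ x, g x ∂(cpow F n)) atTop (𝓝 l) := by
  obtain ⟨C, hC, hb⟩ := hF.exists_cpow_Ico_le
  refine h.exists_tendsto (fun n => Real.sqrt_nonneg _) (C := C) ?_ ?_
  · intro n c
    rcases Nat.eq_zero_or_pos n with rfl | hn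
    · simp; have := wgt_pos c; positivity
    · have h1 := hb n hn c
      have h2 : 0 < √(n : ℝ) := Real.sqrt_pos.2 (by exact_mod_cast hn)
      rw [le_div_iff₀ h2] at h1
      nlinarith [one_le_wgt c]
  · rintro g hg ⟨K, hK⟩
    exact ⟨_, hF.local_limit_bounded hg.meas (abs_le_nrm hg.fin) hK hg.cont⟩

end

/-- `(n + 1)^(-1/2)`. -/
def sq (n : ℕ) : ℝ := (√((n : ℝ) + 1))⁻¹

/-- `(n + 1)^(-3/2)`. -/
def ww (n : ℕ) : ℝ := sq n ^ 3

lemma sq_pos (n : ℕ) : 0 < sq n := by unfold sq; positivity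

lemma ww_pos (n : ℕ) : 0 < ww n := pow_pos (sq_pos n) 3

lemma sq_sq (n : ℕ) : sq n ^ 2 = ((n : ℝ) + 1)⁻¹ := by
  rw [sq, inv_pow, Real.sq_sqrt (by positivity)]

lemma sq_le_two {j n : ℕ} (h : n + 1 ≤ 4 * (j + 1)) : sq j ≤ 2 * sq n := by
  unfold sq
  have h1 : √((n : ℝ) + 1) ≤ 2 * √((j : ℝ) + 1) := by
    rw [show (2 : ℝ) = √4 by rw [show (4 : ℝ) = 2 ^ 2 by norm_num]; simp,
      ← Real.sqrt_mul (by norm_num)]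
    exact Real.sqrt_le_sqrt (by exact_mod_cast h)
  have h2 : 0 < √((n : ℝ) + 1) := by positivity
  have h3 : 0 < √((j : ℝ) + 1) := by positivity
  rw [← div_eq_mul_inv, le_div_iff₀ h2, inv_mul_le_iff₀ h3]
  linarith

lemma ww_le_eight {j n : ℕ} (h : n + 1 ≤ 4 * (j + 1)) : ww j ≤ 8 * ww n := by
  unfold ww
  calc sq j ^ 3 ≤ (2 * sq n) ^ 3 := pow_le_pow_left₀ (sq_pos j).le (sq_le_two h) 3
    _ = _ := by ring

lemma sum_sq_le (n : ℕ) : ∑ k ∈ Finset.range (n + 1), sq k ≤ 2 * (sq n)⁻¹ := by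
  have h : ∀ n : ℕ, ∑ k ∈ Finset.range n, sq k ≤ 2 * √(n : ℝ) := by
    intro n
    induction n with
    | zero => simp
    | succ n ih =>
      rw [Finset.sum_range_succ]
      have h1 : sq n ≤ 2 * (√((n : ℝ) + 1) - √n) := by
        unfold sq
        have ha : 0 ≤ √(n : ℝ) := Real.sqrt_nonneg _
        have hb : 0 < √((n : ℝ) + 1) := by positivity
        have e1 : √(n : ℝ) ^ 2 = n := Real.sq_sqrt (Nat.cast_nonneg n)
        have e2 : √((n : ℝ) + 1) ^ 2 = n + 1 := Real.sq_sqrt (by positivity)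
        rw [inv_le_iff_one_le_mul₀ hb]
        nlinarith [sq_nonneg (√((n : ℝ) + 1) - √n)]
      push_cast
      linarith
  have := h (n + 1)
  rw [sq, inv_inv]
  exact_mod_cast this

lemma summable_ww : Summable ww := by
  have h := Real.summable_one_div_nat_rpow.2 (show (1 : ℝ) < 3 / 2 by norm_num)
  have h2 := (summable_nat_add_iff 1).2 h
  refine h2.congr fun n => ?_
  rw [ww, sq, Real.sqrt_eq_rpow, inv_pow, ← Real.rpow_natCast, ← Real.rpow_mul (by positivity)]
  rw [one_div]; push_cast; norm_num

lemma tendsto_sq_ratio (k : ℕ) : Tendsto (fun n => sq (n - k) / sq n) atTop (𝓝 1) := by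
  have h1 : Tendsto (fun n : ℕ => ((n : ℝ) + 1 + k) / ((n : ℝ) + 1)) atTop (𝓝 1) := by
    have : Tendsto (fun n : ℕ => 1 + (k : ℝ) * (1 / ((n : ℝ) + 1))) atTop (𝓝 (1 + k * 0)) :=
      (tendsto_one_div_add_atTop_nhds_zero_nat.const_mul _).const_add _
    simp only [mul_zero, add_zero] at this
    refine this.congr fun n => ?_
    have : (n : ℝ) + 1 ≠ 0 := by positivity
    field_simp
  have h2 := (h1.sqrt).comp (tendsto_sub_atTop_nat k)
  rw [Real.sqrt_one] at h2
  refine h2.congr' ?_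
  filter_upwards [eventually_ge_atTop k] with n hn
  simp only [Function.comp, sq]
  rw [Nat.cast_sub hn, Real.sqrt_div' _ (by
    have : (k : ℝ) ≤ n := by exact_mod_cast hn
    linarith)]
  rw [show (n : ℝ) - k + 1 + k = n + 1 by ring]
  field_simp

lemma tendsto_ww_ratio (k : ℕ) : Tendsto (fun n => ww (n - k) / ww n) atTop (𝓝 1) := by
  have := (tendsto_sq_ratio k).pow 3
  simpa [ww, div_pow] using this

lemma tendsto_sq_zero : Tendsto sq atTop (𝓝 0) := by
  refine tendsto_inv_atTop_zero.comp (Real.tendsto_sqrt_atTop.comp ?_)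
  exact tendsto_atTop_add_const_right _ _ tendsto_natCast_atTop_atTop

lemma conv_split {v : ℕ → ℝ} {B S : ℝ} {p n : ℕ} (hv : ∀ j, 0 ≤ v j)
    (hB : ∀ j, v j ≤ B * sq j ^ (p + 1)) (hS : ∑ j ∈ Finset.range (n + 1), v j ≤ S) :
    ∑ k ∈ Finset.range (n + 1), sq k * v (n - k)
      ≤ 2 ^ (p + 2) * B * sq n ^ p + 2 * S * sq n := by
  have hB0 : 0 ≤ B := by
    have := (hv 0).trans (hB 0)
    simpa [sq] using this
  have h1 : ∀ k ∈ Finset.range (n + 1), sq k * v (n - k)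
      ≤ sq k * (B * (2 * sq n) ^ (p + 1)) + 2 * sq n * v (n - k) := by
    intro k hk
    rw [Finset.mem_range] at hk
    have hsn := sq_pos n
    have hsk := sq_pos k
    have hv' := hv (n - k)
    rcases le_or_gt (2 * k) n with h | h
    · have h2 : v (n - k) ≤ B * (2 * sq n) ^ (p + 1) := (hB _).trans (by
        have := sq_le_two (j := n - k) (n := n) (by omega)
        gcongr
        exact (sq_pos _).le)
      have := mul_le_mul_of_nonneg_left h2 hsk.le
      have : 0 ≤ 2 * sq n * v (n - k) := by positivity
      linarith
    · have h2 := sq_le_two (j := k) (n := n) (by omega)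
      have := mul_le_mul_of_nonneg_right h2 hv'
      have : 0 ≤ sq k * (B * (2 * sq n) ^ (p + 1)) := by positivity
      linarith
  refine (Finset.sum_le_sum h1).trans ?_
  have hrefl : ∑ k ∈ Finset.range (n + 1), v (n - k) = ∑ j ∈ Finset.range (n + 1), v j := by
    simpa using Finset.sum_range_reflect v (n + 1)
  rw [Finset.sum_add_distrib, ← Finset.sum_mul, ← Finset.mul_sum, hrefl]
  have hsn := sq_pos n
  have h3 : (∑ k ∈ Finset.range (n + 1), sq k) * (B * (2 * sq n) ^ (p + 1))
      ≤ 2 * (sq n)⁻¹ * (B * (2 * sq n) ^ (p + 1)) :=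
    mul_le_mul_of_nonneg_right (sum_sq_le n) (by positivity)
  have h4 : 2 * (sq n)⁻¹ * (B * (2 * sq n) ^ (p + 1)) = 2 ^ (p + 2) * B * sq n ^ p := by
    field_simp; ring
  have h5 : 2 * sq n * ∑ j ∈ Finset.range (n + 1), v j ≤ 2 * sq n * S := by gcongr
  linarith

lemma half_tannery {v b : ℕ → ℝ} {a : ℕ → ℕ → ℝ} {Cv : ℝ} {r : ℕ → ℝ} (c : ℕ)
    (hv : ∀ n, 0 < v n) (hv1 : ∀ n k, 2 * k ≤ n → v (n - k) ≤ Cv * v n)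
    (hv2 : ∀ k, Tendsto (fun n => v (n - k) / v n) atTop (𝓝 1)) (hb : Summable b)
    (hb0 : ∀ k, 0 ≤ b k) (ha : ∀ k m, |a k m| ≤ b k * v m)
    (hr : ∀ k, Tendsto (fun m => a k m / v m) atTop (𝓝 (r k))) :
    Tendsto (fun n => (∑ k ∈ Finset.range (n + 1), if 2 * k + c ≤ n then a k (n - k) else 0) / v n)
      atTop (𝓝 (∑' k, r k)) := by
  have e : ∀ n, (∑ k ∈ Finset.range (n + 1), if 2 * k + c ≤ n then a k (n - k) else 0) / v n
      = ∑' k, (if 2 * k + c ≤ n then a k (n - k) else 0) / v n := by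
    intro n
    rw [tsum_div_const, tsum_eq_sum (s := Finset.range (n + 1))]
    intro k hk
    rw [Finset.mem_range] at hk
    rw [if_neg (by omega)]
  simp only [e]
  refine tendsto_tsum_of_dominated_convergence (bound := fun k => b k * Cv) (hb.mul_right _) ?_ ?_
  · intro k
    have h1 := ((hr k).comp (tendsto_sub_atTop_nat k)).mul (hv2 k)
    rw [mul_one] at h1
    refine h1.congr' ?_
    filter_upwards [eventually_ge_atTop (2 * k + c)] with n hn
    simp only [Function.comp, if_pos hn]
    have h2 := (hv (n - k)).ne'
    field_simp
  · refine Eventually.of_forall fun n k => ?_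
    have hCv : 0 ≤ Cv := by
      have h1 := hv1 0 0 (by norm_num)
      have h2 := hv 0
      simp only [Nat.sub_zero] at h1
      nlinarith
    split_ifs with h
    · rw [norm_div, Real.norm_eq_abs, Real.norm_of_nonneg (hv n).le, div_le_iff₀ (hv n), mul_assoc]
      exact (ha _ _).trans (mul_le_mul_of_nonneg_left (hv1 n k (by omega)) (hb0 k))
    · simp; exact mul_nonneg (hb0 k) hCv

lemma conv_tannery_sq {a : ℕ → ℕ → ℝ} {C : ℝ} (ha : ∀ j k, |a j k| ≤ C * (ww j * sq k))
    (hr : ∀ j, ∃ r, Tendsto (fun k => a j k / sq k) atTop (𝓝 r)) :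
    ∃ l, Tendsto (fun n => (∑ j ∈ Finset.range (n + 1), a j (n - j)) / sq n) atTop (𝓝 l) := by
  choose r hr using hr
  have hC : 0 ≤ C := by
    have := (abs_nonneg _).trans (ha 0 0)
    simpa [ww, sq] using this
  have h1 := half_tannery (v := sq) (b := fun j => C * ww j) (a := a) (Cv := 2) (r := r) 0
    sq_pos (fun n k h => sq_le_two (by omega)) tendsto_sq_ratio (summable_ww.mul_left _)
    (fun k => by have := ww_pos k; positivity) (fun k m => by rw [mul_assoc]; exact ha k m) hr
  have h2 : Tendsto (fun n => (∑ j ∈ Finset.range (n + 1),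
      if 2 * j + 0 ≤ n then 0 else a j (n - j)) / sq n) atTop (𝓝 0) := by
    have h3 : Tendsto (fun n => 16 * C * sq n) atTop (𝓝 0) := by
      simpa using tendsto_sq_zero.const_mul (16 * C)
    refine squeeze_zero_norm (fun n => ?_) h3
    have hs := sq_pos n
    rw [norm_div, Real.norm_of_nonneg hs.le, div_le_iff₀ hs]
    refine (norm_sum_le _ _).trans ?_
    have h4 : ∀ j ∈ Finset.range (n + 1), ‖if 2 * j + 0 ≤ n then 0 else a j (n - j)‖
        ≤ C * (8 * ww n) * sq (n - j) := by
      intro j hj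
      rw [Finset.mem_range] at hj
      have hsj := sq_pos (n - j)
      have hw := ww_pos n
      split_ifs with h
      · simp; positivity
      · rw [Real.norm_eq_abs]
        refine (ha _ _).trans ?_
        have := ww_le_eight (j := j) (n := n) (by omega)
        rw [mul_assoc]; gcongr
    refine (Finset.sum_le_sum h4).trans ?_
    rw [← Finset.mul_sum]
    have h5 : ∑ j ∈ Finset.range (n + 1), sq (n - j) = ∑ j ∈ Finset.range (n + 1), sq j := by
      simpa using Finset.sum_range_reflect sq (n + 1)
    rw [h5]
    have hw := ww_pos n
    calc _ ≤ C * (8 * ww n) * (2 * (sq n)⁻¹) := by gcongr; exact sum_sq_le n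
      _ = _ := by unfold ww; field_simp; ring
  refine ⟨_, (h1.add h2).congr fun n => ?_⟩
  rw [← add_div, ← Finset.sum_add_distrib]
  congr 1
  refine Finset.sum_congr rfl fun j _ => ?_
  split_ifs <;> simp

lemma conv_tannery_ww {a : ℕ → ℕ → ℝ} {C : ℝ} (ha : ∀ j k, |a j k| ≤ C * (ww j * ww k))
    (hr : ∀ j, ∃ r, Tendsto (fun k => a j k / ww k) atTop (𝓝 r))
    (hr' : ∀ k, ∃ r, Tendsto (fun j => a j k / ww j) atTop (𝓝 r)) :
    ∃ l, Tendsto (fun n => (∑ j ∈ Finset.range (n + 1), a j (n - j)) / ww n) atTop (𝓝 l) := by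
  choose r hr using hr
  choose r' hr' using hr'
  have hC : 0 ≤ C := by
    have := (abs_nonneg _).trans (ha 0 0)
    simpa [ww, sq] using this
  have h1 := half_tannery (v := ww) (b := fun j => C * ww j) (a := a) (Cv := 8) (r := r) 0
    ww_pos (fun n k h => ww_le_eight (by omega)) tendsto_ww_ratio (summable_ww.mul_left _)
    (fun k => by have := ww_pos k; positivity) (fun k m => by rw [mul_assoc]; exact ha k m) hr
  have h2 := half_tannery (v := ww) (b := fun j => C * ww j) (a := fun k j => a j k) (Cv := 8)
    (r := r') 1 ww_pos (fun n k h => ww_le_eight (by omega)) tendsto_ww_ratio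
    (summable_ww.mul_left _) (fun k => by have := ww_pos k; positivity)
    (fun k m => by rw [mul_assoc, mul_comm (ww k)]; exact ha m k) hr'
  refine ⟨_, (h1.add h2).congr fun n => ?_⟩
  rw [← add_div]
  congr 1
  rw [← Finset.sum_range_reflect (fun k => if 2 * k + 1 ≤ n then a (n - k) k else 0),
    ← Finset.sum_add_distrib]
  refine Finset.sum_congr rfl fun j hj => ?_
  rw [Finset.mem_range] at hj
  have e : n - (n + 1 - 1 - j) = j := by omega
  rw [e]
  have e2 : n + 1 - 1 - j = n - j := by omega
  rw [e2]
  by_cases h : 2 * j ≤ n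
  · rw [if_pos (by omega), if_neg (by omega), add_zero]
  · rw [if_neg (by omega), if_pos (by omega), zero_add]

lemma sum_ww_conv_le : ∃ C > 0, ∀ n, ∑ j ∈ Finset.range (n + 1), ww j * ww (n - j) ≤ C * ww n := by
  have hpos : 0 < ∑' k, ww k := summable_ww.tsum_pos (fun k => (ww_pos k).le) 0 (ww_pos 0)
  refine ⟨16 * ∑' k, ww k, by positivity, fun n => ?_⟩
  have h1 : ∀ j ∈ Finset.range (n + 1), ww j * ww (n - j)
      ≤ 8 * ww n * ww j + 8 * ww n * ww (n - j) := by
    intro j hj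
    rw [Finset.mem_range] at hj
    have a1 := ww_pos j
    have a2 := ww_pos (n - j)
    have a3 := ww_pos n
    rcases le_or_gt (2 * j) n with h | h
    · have := ww_le_eight (j := n - j) (n := n) (by omega)
      have := mul_le_mul_of_nonneg_left this a1.le
      have : 0 ≤ 8 * ww n * ww (n - j) := by positivity
      nlinarith
    · have := ww_le_eight (j := j) (n := n) (by omega)
      have := mul_le_mul_of_nonneg_right this a2.le
      have : 0 ≤ 8 * ww n * ww j := by positivity
      nlinarith
  refine (Finset.sum_le_sum h1).trans ?_
  rw [Finset.sum_add_distrib, ← Finset.mul_sum, ← Finset.mul_sum]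
  have h5 : ∑ j ∈ Finset.range (n + 1), ww (n - j) = ∑ j ∈ Finset.range (n + 1), ww j := by
    simpa using Finset.sum_range_reflect ww (n + 1)
  have h6 : ∑ j ∈ Finset.range (n + 1), ww j ≤ ∑' k, ww k :=
    summable_ww.sum_le_tsum _ (fun k _ => (ww_pos k).le)
  rw [h5]
  have := ww_pos n
  nlinarith

/-- A sequence that is approximated arbitrarily well by convergent ones converges. -/
lemma exists_tendsto_of_approx {A : ℕ → ℝ}
    (h : ∀ ε > 0, ∃ B : ℕ → ℝ, (∃ l, Tendsto B atTop (𝓝 l)) ∧ ∀ᶠ n in atTop, |A n - B n| ≤ ε) :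
    ∃ l, Tendsto A atTop (𝓝 l) := by
  refine cauchySeq_tendsto_of_complete (Metric.cauchySeq_iff.2 fun ε hε => ?_)
  obtain ⟨B, ⟨l, hl⟩, hB⟩ := h (ε / 4) (by positivity)
  obtain ⟨N, hN⟩ := Metric.cauchySeq_iff.1 hl.cauchySeq (ε / 4) (by positivity)
  obtain ⟨M, hM⟩ := eventually_atTop.1 hB
  refine ⟨max N M, fun m hm n hn => ?_⟩
  have h1 := hM m (le_of_max_le_right hm)
  have h2 := hM n (le_of_max_le_right hn)
  have h3 := hN m (le_of_max_le_left hm) n (le_of_max_le_left hn)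
  rw [Real.dist_eq] at h3 ⊢
  have e : A m - A n = (A m - B m) + (B m - B n) - (A n - B n) := by ring
  rw [e]
  have h4 := abs_sub (A m - B m + (B m - B n)) (A n - B n)
  have h5 := abs_add_le (A m - B m) (B m - B n)
  linarith

section HalfLineBound

variable {F : Measure ℝ} [IsProbabilityMeasure F] {D : Set ℝ}

lemma conv_apply_eq (m R : Measure ℝ) [SFinite R] [SFinite m] {s : Set ℝ} (hs : MeasurableSet s) :
    (m ∗ R) s = ∫⁻ y, R ((fun z => y + z) ⁻¹' s) ∂m := by
  rw [Measure.conv, Measure.map_apply (by fun_prop) hs,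
    Measure.prod_apply (measurable_add hs)]
  rfl

lemma conv_real_le {m R : Measure ℝ} [IsFiniteMeasure R] [IsFiniteMeasure m] {s J : Set ℝ}
    (hs : MeasurableSet s) (hJ : MeasurableSet J) {A : ℝ} (hA : 0 ≤ A)
    (h : ∀ᵐ y ∂m, R.real ((fun z => y + z) ⁻¹' s) ≤ J.indicator (fun _ => A) y) :
    (m ∗ R).real s ≤ A * m.real J := by
  have h1 : (m ∗ R) s ≤ ENNReal.ofReal A * m J := by
    rw [conv_apply_eq m R hs, ← lintegral_indicator_const hJ]
    refine lintegral_mono_ae ?_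
    filter_upwards [h] with y hy
    have : R ((fun z => y + z) ⁻¹' s) = ENNReal.ofReal (R.real ((fun z => y + z) ⁻¹' s)) := by
      simp [Measure.real]
    rw [this]
    by_cases hy' : y ∈ J
    · simp only [hy', indicator_of_mem] at hy ⊢
      exact ENNReal.ofReal_le_ofReal hy
    · simp only [hy', not_false_eq_true, indicator_of_notMem] at hy ⊢
      simp [ENNReal.ofReal_eq_zero.2 hy]
  have h2 := ENNReal.toReal_mono (by finiteness) h1
  rwa [ENNReal.toReal_mul, ENNReal.toReal_ofReal hA] at h2

lemma HalfLine.abs_add (hD : HalfLine D) {y z : ℝ} (hy : y ∈ D ∨ y = 0) (hz : z ∈ D ∨ z = 0) :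
    |y + z| = |y| + |z| := by
  rcases hD with rfl | rfl
  · simp only [mem_Iio] at hy hz
    rw [abs_of_nonpos (by rcases hy with h | h <;> linarith : y ≤ 0),
      abs_of_nonpos (by rcases hz with h | h <;> linarith : z ≤ 0),
      abs_of_nonpos (by rcases hy with h | h <;> rcases hz with h' | h' <;> linarith : y + z ≤ 0)]
    ring
  · simp only [mem_Ici] at hy hz
    rw [abs_of_nonneg (by rcases hy with h | h <;> linarith : 0 ≤ y),
      abs_of_nonneg (by rcases hz with h | h <;> linarith : 0 ≤ z),
      abs_of_nonneg (by rcases hy with h | h <;> rcases hz with h' | h' <;> linarith : 0 ≤ y + z)]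

omit [IsProbabilityMeasure F] in
lemma ae_kill_mem_or (hD : HalfLine D) (n : ℕ) : ∀ᵐ y ∂(kill F D n), y ∈ D ∨ y = 0 := by
  cases n with
  | zero =>
    have : MeasurableSet {y : ℝ | y ∈ D ∨ y = 0} := hD.meas.union (measurableSet_singleton 0)
    rw [kill, ae_dirac_iff this]
    simp
  | succ n => filter_upwards [ae_kill_mem F hD.meas n] with y hy using Or.inl hy

lemma real_sum_measure {ι : Type*} (s : Finset ι) (m : ι → Measure ℝ) [∀ i, IsFiniteMeasure (m i)]
    (E : Set ℝ) : (∑ i ∈ s, m i).real E = ∑ i ∈ s, (m i).real E := by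
  rw [Measure.real, Measure.finsetSum_apply, ENNReal.toReal_sum (by finiteness)]
  rfl

lemma kill_Ico_le_sum (hD : HalfLine D) {C : ℝ} (hC : 0 ≤ C)
    (h : ∀ n : ℕ, 1 ≤ n → ∀ c, (cpow F n).real (Ico c (c + 1)) ≤ C / √n) (n : ℕ) (c : ℝ) :
    ((n : ℝ) + 1) * (kill F D (n + 1)).real (Ico c (c + 1)) ≤
      C * ∑ k ∈ Finset.range (n + 1), sq k *
        (kill F D (n - k)).real (Icc (-(|c| + 1)) (|c| + 1)) := by
  have e := congrArg (fun m => m.real (Ico c (c + 1))) (kill_spitzer F hD n)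
  simp only [real_sum_measure] at e
  have e2 : ((n + 1) • kill F D (n + 1)).real (Ico c (c + 1))
      = ((n : ℝ) + 1) * (kill F D (n + 1)).real (Ico c (c + 1)) := by
    rw [Measure.real, Measure.smul_apply, nsmul_eq_mul, ENNReal.toReal_mul, ENNReal.toReal_natCast,
      Nat.cast_add_one]
    rfl
  rw [← e2, e, Finset.mul_sum]
  refine Finset.sum_le_sum fun k _ => ?_
  rw [Measure.conv_comm, ← mul_assoc]
  refine conv_real_le measurableSet_Ico measurableSet_Icc
    (mul_nonneg hC (sq_pos k).le) ?_
  filter_upwards [ae_kill_mem_or hD (n - k)] with y hy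
  have hm : MeasurableSet ((fun z => y + z) ⁻¹' Ico c (c + 1)) :=
    (measurable_const_add y) measurableSet_Ico
  rw [measureReal_restrict_apply hm]
  by_cases hy' : y ∈ Icc (-(|c| + 1)) (|c| + 1)
  · rw [indicator_of_mem hy']
    have h1 : (fun z => y + z) ⁻¹' Ico c (c + 1) ∩ D ⊆ Ico (c - y) (c - y + 1) := by
      intro z hz
      simp only [mem_inter_iff, mem_preimage, mem_Ico] at hz ⊢
      constructor <;> linarith [hz.1.1, hz.1.2]
    refine (measureReal_mono h1).trans ((h (k + 1) (by omega) _).trans (le_of_eq ?_))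
    rw [sq]; push_cast; rw [div_eq_mul_inv]
  · rw [indicator_of_notMem hy']
    have h1 : (fun z => y + z) ⁻¹' Ico c (c + 1) ∩ D = ∅ := by
      ext z
      simp only [mem_inter_iff, mem_preimage, mem_Ico, mem_empty_iff_false, iff_false, not_and]
      intro hz hzD
      refine hy' (abs_le.1 ?_)
      have h2 := hD.abs_add hy (Or.inl hzD)
      have h3 : |y + z| ≤ |c| + 1 := by
        rw [abs_le]
        constructor <;> linarith [neg_abs_le c, le_abs_self c]
      linarith [abs_nonneg z]
    rw [h1]; simp

lemma sum_hit_le (hD : MeasurableSet D) (N : ℕ) :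
    ∑ k ∈ Finset.range N, (hit F D (k + 1)).real univ ≤ 1 := by
  have h : ∀ N, ∑ k ∈ Finset.range N, (hit F D (k + 1)).real univ
      = 1 - (kill F D N).real univ := by
    intro N
    induction N with
    | zero => simp [kill]
    | succ N ih =>
      rw [Finset.sum_range_succ, ih]
      have e := congrArg (fun m => m.real univ) (kill_add_hit F hD N)
      rw [measureReal_add_apply] at e
      have e2 : (kill F D N ∗ F).real univ = (kill F D N).real univ := by
        rw [Measure.real, conv_apply_eq _ _ MeasurableSet.univ]
        simp [Measure.real]
      linarith
  rw [h]
  linarith [measureReal_nonneg (μ := kill F D N) (s := univ)]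

lemma StepLaw.drift_pos (hF : StepLaw F) (hD : HalfLine D) :
    0 < ∫ y in D, |y| / (1 + |y|) ∂F := by
  have h0 : ∀ y : ℝ, 0 ≤ |y| / (1 + |y|) := fun y => by positivity
  have hint : Integrable (fun y : ℝ => |y| / (1 + |y|)) F := by
    refine Integrable.of_bound (Measurable.aestronglyMeasurable (by fun_prop)) 1
      (ae_of_all _ fun y => ?_)
    rw [Real.norm_of_nonneg (h0 y)]
    exact div_le_one_of_le₀ (by linarith [abs_nonneg y]) (by positivity)
  refine lt_of_le_of_ne (integral_nonneg h0) fun h => ?_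
  rw [eq_comm, setIntegral_eq_zero_iff_of_nonneg_ae (ae_of_all _ h0) hint.integrableOn] at h
  rw [EventuallyEq, ae_restrict_iff' hD.meas] at h
  have h' : ∀ᵐ y ∂F, y ∈ D → y = 0 := by
    filter_upwards [h] with y hy hyD
    have := hy hyD
    simp only [Pi.zero_apply, div_eq_zero_iff, abs_eq_zero] at this
    rcases this with h | h
    · exact h
    · linarith [abs_nonneg y]
  have hi : Integrable (fun y : ℝ => y) F :=
    ((memLp_two_iff_integrable_sq (by fun_prop)).2 hF.int2).integrable (by norm_num)
  have hz : ∀ᵐ y ∂F, y = 0 := by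
    rcases hD with rfl | rfl
    · have h1 : 0 ≤ᵐ[F] fun y => y := by
        filter_upwards [h'] with y hy
        by_contra hc
        exact hc (hy (not_le.1 hc)).ge
      exact (integral_eq_zero_iff_of_nonneg_ae h1 hi).1 hF.mean
    · have h1 : 0 ≤ᵐ[F] fun y => -y := by
        filter_upwards [h'] with y hy
        by_contra hc
        simp only [Pi.zero_apply, not_le] at hc
        have := hy (show (0 : ℝ) ≤ y by linarith)
        linarith
      have := (integral_eq_zero_iff_of_nonneg_ae h1 hi.neg).1 (by
        rw [integral_neg, hF.mean, neg_zero])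
      filter_upwards [this] with y hy
      simpa using hy
  have h3 : ∫ x, x ^ 2 ∂F = 0 := by
    rw [integral_congr_ae (g := fun _ => (0 : ℝ)) (by filter_upwards [hz] with y hy; simp [hy])]
    simp
  exact hF.var.ne' h3

lemma integral_exp_conv (hD : HalfLine D) {r : ℝ} (m ν : Measure ℝ) [IsFiniteMeasure ν]
    [IsFiniteMeasure m] (hm : ∀ᵐ y ∂m, y ∈ D ∨ y = 0) (hR : ∀ᵐ y ∂ν, y ∈ D ∨ y = 0) (hr : 0 < r) :
    ∫ y, Real.exp (-|y| / r) ∂(Measure.conv m ν)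
      = (∫ y, Real.exp (-|y| / r) ∂m) * (∫ y, Real.exp (-|y| / r) ∂ν) := by
  have hb : ∀ y : ℝ, ‖Real.exp (-|y| / r)‖ ≤ 1 := fun y => by
    rw [Real.norm_of_nonneg (Real.exp_nonneg _), Real.exp_le_one_iff, neg_div]
    have : 0 ≤ |y| / r := by positivity
    linarith
  have hmeas : Measurable fun y : ℝ => Real.exp (-|y| / r) := by fun_prop
  rw [integral_conv (Integrable.of_bound hmeas.aestronglyMeasurable 1 (ae_of_all _ hb)),
    ← integral_mul_const]
  refine integral_congr_ae ?_
  filter_upwards [hm] with y hy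
  rw [← integral_const_mul]
  refine integral_congr_ae ?_
  filter_upwards [hR] with z hz
  rw [hD.abs_add hy hz, ← Real.exp_add]
  congr 1; ring

lemma StepLaw.exists_sum_kill_le (hF : StepLaw F) (hD : HalfLine D) :
    ∃ C > 0, ∀ r : ℝ, 1 ≤ r → ∀ N : ℕ,
      ∑ n ∈ Finset.range (N + 1), (kill F D n).real (Icc (-r) r) ≤ C * r := by
  set d := ∫ y in D, |y| / (1 + |y|) ∂F with hd
  have hdpos : 0 < d := hF.drift_pos hD
  refine ⟨Real.exp 1 * d⁻¹, by positivity, fun r hr N => ?_⟩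
  have hr0 : 0 < r := by linarith
  set φ : ℝ → ℝ := fun y => Real.exp (-|y| / r) with hφ
  have hb : ∀ y : ℝ, φ y ≤ 1 := fun y => by
    rw [hφ]; simp only
    rw [Real.exp_le_one_iff, neg_div]
    have : 0 ≤ |y| / r := by positivity
    linarith
  have hmeas : Measurable φ := by fun_prop
  have hint : ∀ m : Measure ℝ, IsFiniteMeasure m → Integrable φ m := fun m _ =>
    Integrable.of_bound hmeas.aestronglyMeasurable 1
      (ae_of_all _ fun y => by rw [Real.norm_of_nonneg (Real.exp_nonneg _)]; exact hb y)
  set M : ℕ → ℝ := fun n => ∫ y, φ y ∂(kill F D n) with hM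
  set H : ℕ → ℝ := fun k => ∫ y, φ y ∂(hit F Dᶜ (k + 1)) with hH
  have hM0 : ∀ n, 0 ≤ M n := fun n => integral_nonneg fun y => Real.exp_nonneg _
  have hH0 : ∀ n, 0 ≤ H n := fun n => integral_nonneg fun y => Real.exp_nonneg _
  have hhit : ∀ k, ∀ᵐ y ∂(hit F Dᶜ (k + 1)), y ∈ D ∨ y = 0 := by
    intro k
    rw [hit, compl_compl]
    filter_upwards [ae_restrict_mem hD.meas] with y hy using Or.inl hy
  have hrec : ∀ n, M (n + 1) = ∑ k ∈ Finset.range (n + 1), H k * M (n - k) := by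
    intro n
    simp only [hM, hH]
    rw [kill_renewal F hD n, integral_finsetSum_measure (fun i _ => hint _ inferInstance)]
    refine Finset.sum_congr rfl fun k _ => ?_
    exact integral_exp_conv hD _ _ (hhit k) (ae_kill_mem_or hD _) hr0
  have hHle : ∀ k, H k ≤ (hit F Dᶜ (k + 1)).real univ := fun k => by
    have := integral_mono (hint (hit F Dᶜ (k + 1)) inferInstance) (integrable_const 1) hb
    simpa using this
  have hH00 : H 0 ≤ (hit F Dᶜ 1).real univ - d / r := by
    have e : hit F Dᶜ 1 = F.restrict D := by
      rw [hit, kill, compl_compl, Measure.dirac_zero_conv]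
    have : ∫ y in D, (1 - φ y) ∂F ≥ d / r := by
      rw [hd, ← integral_div]
      refine integral_mono_of_nonneg (ae_of_all _ fun y => by positivity)
        ((integrable_const 1).sub (hint _ inferInstance)) (ae_of_all _ fun y => ?_)
      simp only [hφ]
      have h1 : Real.exp (-|y| / r) ≤ 1 / (1 + |y| / r) := by
        rw [neg_div, Real.exp_neg, one_div]
        have : 0 ≤ |y| / r := by positivity
        gcongr
        linarith [Real.add_one_le_exp (|y| / r)]
      have h2 : |y| / (1 + |y|) / r ≤ 1 - 1 / (1 + |y| / r) := by
        have h3 : 1 - 1 / (1 + |y| / r) = |y| / (r + |y|) := by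
          have := abs_nonneg y
          field_simp; ring
        rw [h3, div_div]
        have := abs_nonneg y
        gcongr
        nlinarith
      linarith
    rw [integral_sub (integrable_const 1) (hint _ inferInstance)] at this
    simp only [hH, zero_add, e]
    simp only [integral_const, smul_eq_mul, mul_one] at this
    linarith
  have hHs : ∀ N, ∑ k ∈ Finset.range (N + 1), H k ≤ 1 - d / r := by
    intro N
    have h1 := sum_hit_le (F := F) hD.compl.meas (N + 1)
    rw [Finset.sum_range_succ'] at h1 ⊢
    have h2 := Finset.sum_le_sum fun k (_ : k ∈ Finset.range N) => hHle (k + 1)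
    simp only [zero_add] at h1
    linarith
  have hconv : ∀ N, ∑ n ∈ Finset.range (N + 1), ∑ k ∈ Finset.range (n + 1), H k * M (n - k)
      ≤ (∑ k ∈ Finset.range (N + 1), H k) * ∑ n ∈ Finset.range (N + 1), M n := by
    intro N
    rw [Finset.sum_range_diag_flip (N + 1) fun k j => H k * M j, Finset.sum_mul]
    refine Finset.sum_le_sum fun k _ => ?_
    rw [← Finset.mul_sum]
    refine mul_le_mul_of_nonneg_left ?_ (hH0 k)
    exact Finset.sum_le_sum_of_subset_of_nonneg (Finset.range_mono (by omega)) fun j _ _ => hM0 j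
  have hMs : ∑ n ∈ Finset.range (N + 1), M n ≤ d⁻¹ * r := by
    have e1 : ∑ n ∈ Finset.range (N + 1 + 1), M n
        = ∑ n ∈ Finset.range (N + 1), M (n + 1) + M 0 := Finset.sum_range_succ' _ _
    have e2 : ∑ n ∈ Finset.range (N + 1), M (n + 1)
        ≤ (1 - d / r) * ∑ n ∈ Finset.range (N + 1), M n := by
      simp_rw [hrec]
      exact (hconv N).trans (mul_le_mul_of_nonneg_right (hHs N)
        (Finset.sum_nonneg fun n _ => hM0 n))
    have e3 : M 0 = 1 := by simp [hM, kill, hφ]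
    have e4 : ∑ n ∈ Finset.range (N + 1 + 1), M n
      = ∑ n ∈ Finset.range (N + 1), M n + M (N + 1) := Finset.sum_range_succ _ _
    have e5 := hM0 (N + 1)
    have e6 : d / r * ∑ n ∈ Finset.range (N + 1), M n ≤ 1 := by linarith
    have e7 : d⁻¹ * r = 1 / (d / r) := by rw [one_div, inv_div, div_eq_inv_mul]
    rw [e7, le_div_iff₀ (by positivity)]
    linarith
  have hu : ∀ n, (kill F D n).real (Icc (-r) r) ≤ Real.exp 1 * M n := by
    intro n
    rw [hM]; simp only
    rw [← integral_const_mul, ← integral_indicator_one measurableSet_Icc]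
    refine integral_mono_of_nonneg (ae_of_all _ fun y => indicator_nonneg (by simp) _)
      ((hint _ inferInstance).const_mul _) (ae_of_all _ fun y => ?_)
    simp only [hφ, ← Real.exp_add]
    by_cases hy : y ∈ Icc (-r) r
    · rw [indicator_of_mem hy]
      have : |y| / r ≤ 1 := by rw [div_le_one hr0]; exact abs_le.2 hy
      exact Real.one_le_exp (by rw [neg_div]; linarith)
    · rw [indicator_of_notMem hy]; positivity
  calc _ ≤ ∑ n ∈ Finset.range (N + 1), Real.exp 1 * M n := Finset.sum_le_sum fun n _ => hu n
    _ = Real.exp 1 * ∑ n ∈ Finset.range (N + 1), M n := by rw [Finset.mul_sum]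
    _ ≤ Real.exp 1 * (d⁻¹ * r) := by gcongr
    _ = _ := by ring

omit [IsProbabilityMeasure F] in
lemma real_Icc_le {m : Measure ℝ} [IsFiniteMeasure m] {B r : ℝ} (hr : 1 ≤ r)
    (h : ∀ c, |c| ≤ r + 1 → m.real (Ico c (c + 1)) ≤ B) : m.real (Icc (-r) r) ≤ 4 * r * B := by
  have hsub : Icc (-r) r ⊆ ⋃ k ∈ Finset.Icc ⌊-r⌋ ⌊r⌋, Ico (k : ℝ) (k + 1) := by
    intro x hx
    simp only [mem_iUnion, Finset.mem_Icc]
    exact ⟨⌊x⌋, ⟨Int.floor_mono hx.1, Int.floor_mono hx.2⟩, mem_Ico_floor x⟩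
  have hB : 0 ≤ B := measureReal_nonneg.trans (h 0 (by simp; linarith))
  refine (measureReal_mono hsub (measure_ne_top _ _)).trans
    ((measureReal_biUnion_finset_le _ _).trans ?_)
  have h1 : ∀ k ∈ Finset.Icc ⌊-r⌋ ⌊r⌋, m.real (Ico (k : ℝ) (k + 1)) ≤ B := by
    intro k hk
    rw [Finset.mem_Icc] at hk
    refine h _ (abs_le.2 ⟨?_, ?_⟩)
    · have : (⌊-r⌋ : ℝ) ≤ k := by exact_mod_cast hk.1
      linarith [Int.lt_floor_add_one (-r)]
    · have : (k : ℝ) ≤ ⌊r⌋ := by exact_mod_cast hk.2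
      linarith [Int.floor_le r]
  refine (Finset.sum_le_card_nsmul _ _ _ h1).trans ?_
  rw [nsmul_eq_mul]
  refine mul_le_mul_of_nonneg_right ?_ hB
  rw [Int.card_Icc]
  have h2 : ((⌊r⌋ + 1 - ⌊-r⌋).toNat : ℝ) = (⌊r⌋ + 1 - ⌊-r⌋ : ℝ) := by
    have : 0 ≤ ⌊r⌋ + 1 - ⌊-r⌋ := by
      have := Int.floor_mono (show -r ≤ r by linarith)
      omega
    exact_mod_cast congrArg (fun z : ℤ => (z : ℝ)) (Int.toNat_of_nonneg this)
  rw [h2]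
  linarith [Int.floor_le r, Int.lt_floor_add_one (-r)]

lemma StepLaw.exists_kill_Ico_le (hF : StepLaw F) (hD : HalfLine D) (p : ℕ) (hp : p ≤ 2) :
    ∃ C > 0, ∀ n c, (kill F D n).real (Ico c (c + 1)) ≤ C * (1 + |c|) ^ p * sq n ^ (p + 1) := by
  obtain ⟨C, hC, hCb⟩ := hF.exists_cpow_Ico_le
  obtain ⟨S, hS, hSb⟩ := hF.exists_sum_kill_le hD
  have hmass : ∀ (n : ℕ) (s : Set ℝ), (kill F D n).real s ≤ 1 := by
    have h1 : ∀ n, kill F D n univ ≤ 1 := by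
      intro n
      induction n with
      | zero => simp [kill]
      | succ n ih =>
        refine (Measure.restrict_apply_le _ _).trans ?_
        rw [conv_apply_eq _ _ MeasurableSet.univ]
        simpa using ih
    intro n s
    refine ENNReal.toReal_le_of_le_ofReal zero_le_one ?_
    rw [ENNReal.ofReal_one]
    exact (measure_mono (subset_univ s)).trans (h1 n)
  have hstep : ∀ (p : ℕ) (A : ℝ), 0 < A → (∀ (n : ℕ) (c : ℝ), ((n : ℝ) + 1) *
      (kill F D (n + 1)).real (Ico c (c + 1))
        ≤ A * (1 + |c|) ^ p * (sq n ^ (p + 1) * ((n : ℝ) + 1)))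
      → ∃ C > 0, ∀ n c, (kill F D n).real (Ico c (c + 1)) ≤ C * (1 + |c|) ^ p * sq n ^ (p + 1) := by
    intro p A hA h
    refine ⟨max 1 (A * 2 ^ (p + 1)), by positivity, fun n c => ?_⟩
    have hc : 1 ≤ (1 + |c|) ^ p := one_le_pow₀ (by linarith [abs_nonneg c])
    cases n with
    | zero =>
      have : sq 0 = 1 := by simp [sq]
      rw [this, one_pow, mul_one]
      exact (hmass 0 _).trans (by nlinarith [le_max_left 1 (A * 2 ^ (p + 1))])
    | succ n =>
      have h1 := h n c
      have h2 : (kill F D (n + 1)).real (Ico c (c + 1)) ≤ A * (1 + |c|) ^ p * sq n ^ (p + 1) := by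
        have h3 : (0 : ℝ) < (n : ℝ) + 1 := by positivity
        refine le_of_mul_le_mul_left (h1.trans (le_of_eq ?_)) h3
        ring
      have h4 : sq n ≤ 2 * sq (n + 1) := sq_le_two (by omega)
      calc _ ≤ A * (1 + |c|) ^ p * sq n ^ (p + 1) := h2
        _ ≤ A * (1 + |c|) ^ p * (2 * sq (n + 1)) ^ (p + 1) := by
          have := sq_pos n
          gcongr
        _ = (A * 2 ^ (p + 1)) * (1 + |c|) ^ p * sq (n + 1) ^ (p + 1) := by ring
        _ ≤ _ := by
          have := sq_pos (n + 1)
          gcongr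
          exact le_max_right _ _
  have hs2 : ∀ n : ℕ, sq n ^ 2 * ((n : ℝ) + 1) = 1 := fun n => by
    rw [sq_sq]; field_simp
  have hbase := kill_Ico_le_sum hD hC.le hCb
  induction p with
  | zero =>
    refine hstep 0 (2 * C) (by positivity) fun n c => ?_
    refine (hbase n c).trans ?_
    have h1 : ∑ k ∈ Finset.range (n + 1), sq k *
        (kill F D (n - k)).real (Icc (-(|c| + 1)) (|c| + 1)) ≤ 2 * (sq n)⁻¹ :=
      (Finset.sum_le_sum fun k _ => mul_le_of_le_one_right (sq_pos k).le (hmass _ _)).trans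
        (sum_sq_le n)
    have h2 : sq n ^ (0 + 1) * ((n : ℝ) + 1) = (sq n)⁻¹ := by
      have := hs2 n
      have h0 := sq_pos n
      refine eq_inv_of_mul_eq_one_left ?_
      exact (by ring : _ = sq n ^ 2 * ((n : ℝ) + 1)).trans this
    rw [h2]
    calc _ ≤ C * (2 * (sq n)⁻¹) := by gcongr
      _ = _ := by ring
  | succ p ih =>
    obtain ⟨B, hB, hBb⟩ := ih (by omega)
    have hu : ∀ r, 1 ≤ r → ∀ n, (kill F D n).real (Icc (-r) r)
        ≤ 4 * B * 3 ^ p * r ^ (p + 1) * sq n ^ (p + 1) := by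
      intro r hr n
      have h1 := real_Icc_le (m := kill F D n) hr (B := B * (3 * r) ^ p * sq n ^ (p + 1))
        fun c hc => (hBb n c).trans (by
          have := sq_pos n
          gcongr
          linarith)
      refine h1.trans (le_of_eq ?_)
      ring
    refine hstep (p + 1) (C * (2 ^ (p + 2) * (4 * B * 3 ^ p) + 2 * S)) (by positivity)
      fun n c => ?_
    refine (hbase n c).trans ?_
    set r := 1 + |c| with hr
    have hr1 : 1 ≤ r := by rw [hr]; linarith [abs_nonneg c]
    rw [add_comm |c| 1, ← hr]
    have h1 := conv_split (v := fun j => (kill F D j).real (Icc (-r) r))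
      (B := 4 * B * 3 ^ p * r ^ (p + 1)) (S := S * r) (p := p) (n := n)
      (fun j => measureReal_nonneg) (hu r hr1) (hSb r hr1 n)
    have h2 : sq n ^ (p + 1 + 1) * ((n : ℝ) + 1) = sq n ^ p := by
      rw [show p + 1 + 1 = p + 2 from rfl, pow_add, mul_assoc, hs2, mul_one]
    have h3 : sq n ≤ sq n ^ p := by
      have h4 : sq n ≤ 1 := by
        rw [sq]
        exact inv_le_one_of_one_le₀ (Real.one_le_sqrt.2 (by linarith [Nat.cast_nonneg (α := ℝ) n]))
      calc sq n = sq n ^ 1 := (pow_one _).symm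
        _ ≤ sq n ^ p := pow_le_pow_of_le_one (sq_pos n).le h4 (by omega)
    have h5 : r ≤ r ^ (p + 1) := le_self_pow₀ hr1 (by omega)
    rw [h2]
    calc _ ≤ C * (2 ^ (p + 2) * (4 * B * 3 ^ p * r ^ (p + 1)) * sq n ^ p + 2 * (S * r) * sq n) := by
          gcongr
      _ ≤ C * (2 ^ (p + 2) * (4 * B * 3 ^ p * r ^ (p + 1)) * sq n ^ p
          + 2 * (S * r ^ (p + 1)) * sq n ^ p) := by
          have := sq_pos n
          gcongr
      _ = _ := by ring

lemma StepLaw.exists_kill_bnd (hF : StepLaw F) (hD : HalfLine D) :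
    ∃ C > 0, ∀ n, Bnd (kill F D n) (C * ww n) := by
  obtain ⟨C, hC, h⟩ := hF.exists_kill_Ico_le hD 2 le_rfl
  refine ⟨C, hC, fun n c => (h n c).trans (le_of_eq ?_)⟩
  rw [wgt, ww]; ring

end HalfLineBound

lemma exists_tendsto_integral {α : Type*} [MeasurableSpace α] {m : Measure α} {Φ : ℕ → α → ℝ}
    {b : α → ℝ} (hΦ : ∀ n, AEStronglyMeasurable (Φ n) m) (hb : Integrable b m)
    (hbd : ∀ n, ∀ᵐ y ∂m, |Φ n y| ≤ b y)
    (hlim : ∀ᵐ y ∂m, ∃ l, Tendsto (fun n => Φ n y) atTop (𝓝 l)) :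
    ∃ l, Tendsto (fun n => ∫ y, Φ n y ∂m) atTop (𝓝 l) := by
  classical
  refine ⟨_, tendsto_integral_of_dominated_convergence (F := Φ)
    (f := fun y => limUnder atTop fun n => Φ n y) b hΦ hb hbd ?_⟩
  filter_upwards [hlim] with y hy
  exact tendsto_nhds_limUnder hy

lemma Cls.one_Ico (a b : ℝ) : Cls ((Set.Ico a b).indicator fun _ => (1 : ℝ)) := by
  set K := max |a| |b| with hK
  have hc : Continuous fun x : ℝ => max 0 (min 1 (K + 1 - |x|)) := by fun_prop
  have h : Cls fun x : ℝ => max 0 (min 1 (K + 1 - |x|)) := by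
    refine ⟨hc.measurable, ae_of_all _ fun x => hc.continuousAt,
      nrm_ne_top_of_decay (C := wgt (K + 1) ^ 2) fun y => ?_⟩
    have h0 := wgt_pos y
    have h1 : 0 ≤ K := (abs_nonneg a).trans (le_max_left _ _)
    rw [abs_of_nonneg (le_max_left _ _), le_div_iff₀ (by positivity)]
    rcases le_or_gt |y| (K + 1) with h | h
    · have h2 : wgt y ≤ wgt (K + 1) := by
        unfold wgt
        rw [abs_of_nonneg (by linarith : 0 ≤ K + 1)]
        gcongr
      have h3 : max 0 (min 1 (K + 1 - |y|)) ≤ 1 := max_le zero_le_one (min_le_left _ _)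
      calc _ ≤ 1 * wgt (K + 1) ^ 2 := by gcongr
        _ = _ := one_mul _
    · rw [max_eq_left (min_le_iff.2 (Or.inr (by linarith))), zero_mul]
      positivity
  convert h.Ico a b using 1
  refine (indicator_congr fun x hx => ?_)
  have h2 : |x| ≤ K := by
    rw [abs_le]
    constructor
    · linarith [neg_abs_le a, le_max_left |a| |b|, hx.1]
    · linarith [le_abs_self b, le_max_right |a| |b|, hx.2]
  rw [min_eq_left (by linarith), max_eq_right zero_le_one]

section HalfLineLimit

variable {F : Measure ℝ} [IsProbabilityMeasure F] {D : Set ℝ}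

lemma StepLaw.exists_cpow_bnd (hF : StepLaw F) : ∃ C > 0, ∀ n, Bnd (cpow F (n + 1)) (C * sq n) := by
  obtain ⟨C, hC, hCb⟩ := hF.exists_cpow_Ico_le
  refine ⟨C, hC, fun n c => (hCb (n + 1) (by omega) c).trans ?_⟩
  have h1 : C / √((n + 1 : ℕ) : ℝ) = C * sq n := by
    rw [sq]; push_cast; rw [div_eq_mul_inv]
  rw [h1]
  exact le_mul_of_one_le_right (mul_nonneg hC.le (sq_pos n).le) (one_le_wgt c)

lemma wgt_mono {x y : ℝ} (h : |x| ≤ |y|) : wgt x ≤ wgt y := by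
  unfold wgt; gcongr

lemma Bnd.real_Icc_le {m : Measure ℝ} [IsFiniteMeasure m] {A : ℝ} (h : Bnd m A) {r : ℝ}
    (hr : 1 ≤ r) : m.real (Icc (-r) r) ≤ 4 * r * (A * wgt (r + 1)) := by
  refine BPREpaper.real_Icc_le hr fun c hc => (h c).trans ?_
  refine mul_le_mul_of_nonneg_left (wgt_mono ?_) h.nonneg
  rwa [abs_of_nonneg (by linarith : 0 ≤ r + 1)]

lemma measurable_integral_add {ν : Measure ℝ} [SFinite ν] {g : ℝ → ℝ} (hg : Measurable g) :
    Measurable fun y => ∫ z, g (y + z) ∂ν := by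
  refine StronglyMeasurable.measurable ?_
  exact StronglyMeasurable.integral_prod_right (f := fun y z => g (y + z))
    (Measurable.stronglyMeasurable (by fun_prop))

lemma StepLaw.kill_limit (hF : StepLaw F) (hD : HalfLine D) {g : ℝ → ℝ} (h : Cls g) :
    ∃ l, Tendsto (fun n => (ww n)⁻¹ * ∫ x, g x ∂(kill F D n)) atTop (𝓝 l) := by
  obtain ⟨C, hC, hb⟩ := hF.exists_kill_bnd hD
  refine Cls.exists_tendsto (fun n => (inv_pos.2 (ww_pos n)).le) (C := C) (fun n c => ?_) ?_ h
  · rw [inv_mul_le_iff₀ (ww_pos n)]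
    exact (hb n c).trans (le_of_eq (by ring))
  clear h g
  rintro g h ⟨K', hK'⟩
  obtain ⟨K, hK1, hK⟩ : ∃ K : ℝ, 1 ≤ K ∧ ∀ x, K < |x| → g x = 0 :=
    ⟨max K' 1, le_max_right _ _, fun x hx => hK' x (lt_of_le_of_lt (le_max_left _ _) hx)⟩
  obtain ⟨A, hA, hAb⟩ := hF.exists_cpow_bnd
  set N := (nrm g).toReal with hN
  have hN0 : 0 ≤ N := ENNReal.toReal_nonneg
  set R : ℕ → Measure ℝ := fun k => (cpow F (k + 1)).restrict D with hR
  have hgi : ∀ m : Measure ℝ, IsFiniteMeasure m → Integrable g m := fun m _ =>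
    Integrable.of_bound h.meas.aestronglyMeasurable N (ae_of_all _ fun x => abs_le_nrm h.fin x)
  set a : ℕ → ℕ → ℝ := fun j k => ∫ x, g x ∂(kill F D j ∗ R k) with ha
  have hae : ∀ j k, a j k = ∫ y, ∫ z, g (y + z) ∂(R k) ∂(kill F D j) := fun j k =>
    integral_conv (hgi _ inferInstance)
  set I : ℝ → ℝ := (Icc (-K) K).indicator fun _ => A * wgt K * N with hI
  have hin : ∀ k y, (y ∈ D ∨ y = 0) → |∫ z, g (y + z) ∂(R k)| ≤ sq k * I y := by
    intro k y hy
    by_cases hyK : y ∈ Icc (-K) K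
    · rw [hI, indicator_of_mem hyK]
      have hs : Integrable (fun z => |g (z + y)|) (cpow F (k + 1)) := by
        refine Integrable.of_bound (h.shift y).meas.abs.aestronglyMeasurable N
          (ae_of_all _ fun x => ?_)
        simpa using abs_le_nrm h.fin (x + y)
      have h1 : |∫ z, g (y + z) ∂(R k)| ≤ ∫ z, |g (z + y)| ∂(cpow F (k + 1)) := by
        simp_rw [add_comm y]
        exact (abs_integral_le_integral_abs).trans
          (setIntegral_le_integral hs (ae_of_all _ fun z => abs_nonneg _))
      have h2 := (hAb k).integral_abs_shift_le h.meas h.fin y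
      have h3 : wgt y ≤ wgt K :=
        wgt_mono (by rw [abs_of_nonneg (by linarith : 0 ≤ K)]; exact abs_le.2 hyK)
      refine h1.trans (h2.trans ?_)
      have := sq_pos k
      calc A * sq k * wgt y * N ≤ A * sq k * wgt K * N := by gcongr
        _ = _ := by ring
    · rw [hI, indicator_of_notMem hyK, mul_zero]
      have h1 : ∫ z, g (y + z) ∂(R k) = ∫ z, 0 ∂(R k) := by
        refine integral_congr_ae ?_
        filter_upwards [ae_restrict_mem hD.meas] with z hz
        refine hK _ ?_
        rw [hD.abs_add hy (Or.inl hz)]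
        rw [mem_Icc, ← abs_le, not_le] at hyK
        linarith [abs_nonneg z]
      rw [h1]; simp
  have hIi : ∀ m : Measure ℝ, IsFiniteMeasure m → Integrable I m := fun m _ =>
    (integrable_const _).indicator measurableSet_Icc
  set C' := A * wgt K * N * (4 * K * (C * wgt (K + 1))) with hC'
  have hbd : ∀ j k, |a j k| ≤ C' * (ww j * sq k) := by
    intro j k
    rw [hae]
    have h1 : |∫ y, ∫ z, g (y + z) ∂(R k) ∂(kill F D j)| ≤ ∫ y, sq k * I y ∂(kill F D j) := by
      rw [← Real.norm_eq_abs]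
      refine norm_integral_le_of_norm_le ((hIi _ inferInstance).const_mul _) ?_
      filter_upwards [ae_kill_mem_or hD j] with y hy using hin k y hy
    refine h1.trans ?_
    rw [integral_const_mul, hI, integral_indicator_const _ measurableSet_Icc, smul_eq_mul]
    have h2 := (hb j).real_Icc_le hK1
    have h3 := sq_pos k
    have h4 := wgt_pos K
    calc _ ≤ sq k * (4 * K * (C * ww j * wgt (K + 1)) * (A * wgt K * N)) := by gcongr
      _ = _ := by rw [hC']; ring
  have hlim : ∀ j, ∃ r, Tendsto (fun k => a j k / sq k) atTop (𝓝 r) := by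
    intro j
    have e : (fun k => a j k / sq k)
        = fun k => ∫ y, (∫ z, g (y + z) ∂(R k)) / sq k ∂(kill F D j) := by
      ext k; rw [hae, integral_div]
    rw [e]
    refine exists_tendsto_integral (b := I) (fun k => ?_) (hIi _ inferInstance) (fun k => ?_)
      (ae_of_all _ fun y => ?_)
    · exact ((measurable_integral_add h.meas).div_const _).aestronglyMeasurable
    · filter_upwards [ae_kill_mem_or hD j] with y hy
      rw [abs_div, abs_of_pos (sq_pos k), div_le_iff₀ (sq_pos k), mul_comm]
      exact hin k y hy
    · obtain ⟨l, hl⟩ := hF.local_limit ((h.shift y).halfLine hD)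
      refine ⟨l, (hl.comp (tendsto_add_atTop_nat 1)).congr fun k => ?_⟩
      simp only [Function.comp_apply, hR]
      rw [integral_indicator hD.meas, sq, div_inv_eq_mul, mul_comm]
      push_cast
      simp_rw [add_comm y]
  obtain ⟨l, hl⟩ := conv_tannery_sq hbd hlim
  have hrat := (tendsto_ww_ratio 1).comp (tendsto_add_atTop_nat 1)
  refine ⟨l, ?_⟩
  rw [← tendsto_add_atTop_iff_nat 1]
  have := hl.mul hrat
  rw [mul_one] at this
  refine this.congr fun n => ?_
  simp only [Function.comp_apply, Nat.add_sub_cancel]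
  have e1 : ((n : ℝ) + 1) * ∫ x, g x ∂(kill F D (n + 1))
      = ∑ j ∈ Finset.range (n + 1), a j (n - j) := by
    have e := congrArg (fun m => ∫ x, g x ∂m) (kill_spitzer F hD n)
    rw [integral_finsetSum_measure (fun i _ => hgi _ inferInstance)] at e
    have e2 : ∫ x, g x ∂((n + 1) • kill F D (n + 1))
        = ((n : ℝ) + 1) * ∫ x, g x ∂(kill F D (n + 1)) := by
      rw [← Nat.cast_smul_eq_nsmul NNReal, integral_smul_nnreal_measure]
      simp [NNReal.smul_def]
    rw [← e2, e, ← Finset.sum_range_reflect]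
    refine Finset.sum_congr rfl fun k hk => ?_
    rw [Finset.mem_range] at hk
    rw [Measure.conv_comm]
    simp only [ha, hR]
    (congr 4; omega)
  rw [← e1]
  have h1 := sq_sq n
  have h2 := sq_pos n
  have h3 := ww_pos (n + 1)
  have h4 : (n : ℝ) + 1 = (sq n ^ 2)⁻¹ := by rw [h1, inv_inv]
  rw [h4, ww]
  field_simp

lemma StepLaw.kill_lower (hF : StepLaw F) :
    ∃ c > 0, ∀ᶠ n in atTop, c * ww n ≤ (kill F (Iio 0) n).real (Ico (-2) (-1)) := by
  have hD : HalfLine (Iio 0) := Or.inl rfl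
  have h1 : ∀ n : ℕ, (cpow F (n + 1)).real (Ico (-2) (-1))
      ≤ ((n : ℝ) + 1) * (kill F (Iio 0) (n + 1)).real (Ico (-2) (-1)) := by
    intro n
    have e := congrArg (fun m => m.real (Ico (-2) (-1))) (kill_spitzer F hD n)
    simp only [real_sum_measure] at e
    have e2 : ((n + 1) • kill F (Iio 0) (n + 1)).real (Ico (-2) (-1))
        = ((n : ℝ) + 1) * (kill F (Iio 0) (n + 1)).real (Ico (-2) (-1)) := by
      rw [Measure.real, Measure.smul_apply, nsmul_eq_mul, ENNReal.toReal_mul,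
        ENNReal.toReal_natCast, Nat.cast_add_one]
      rfl
    rw [← e2, e]
    refine le_trans (le_of_eq ?_) (Finset.single_le_sum (f := fun k =>
      ((cpow F (k + 1)).restrict (Iio 0) ∗ kill F (Iio 0) (n - k)).real (Ico (-2) (-1)))
      (fun k _ => measureReal_nonneg) (Finset.self_mem_range_succ n))
    simp only [Nat.sub_self, kill, Measure.conv_dirac_zero]
    rw [measureReal_restrict_apply measurableSet_Ico]
    congr 1
    refine (inter_eq_left.2 fun x hx => ?_).symm
    exact hx.2.trans (by norm_num)
  have hg := Cls.one_Ico (-2) (-1)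
  have h2 := hF.local_limit_bounded hg.meas (B := 1) (K := 2) (fun x => by
      by_cases hx : x ∈ Ico (-2 : ℝ) (-1) <;> simp [hx]) (fun x hx => by
      refine indicator_of_notMem (fun h => ?_) _
      rw [abs_of_neg (by linarith [h.2])] at hx
      linarith [h.1]) hg.cont
  simp_rw [integral_indicator_const (1 : ℝ) measurableSet_Ico] at h2
  have h3 := (h2.comp (tendsto_add_atTop_nat 1)).eventually_const_lt
    (u := hF.llc / 2) (by simp; linarith [hF.llc_pos])
  have hl := hF.llc_pos
  refine ⟨hF.llc / 2, by positivity, ?_⟩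
  obtain ⟨N, hN⟩ := eventually_atTop.1 h3
  refine eventually_atTop.2 ⟨N + 1, fun n hn => ?_⟩
  obtain ⟨n, rfl⟩ : ∃ m, n = m + 1 := ⟨n - 1, by omega⟩
  have h4 := hN n (by omega)
  simp only [Function.comp_apply, smul_eq_mul, mul_one] at h4
  have h5 := h1 n
  have h6 : √((n + 1 : ℕ) : ℝ) = (sq n)⁻¹ := by simp [sq]
  rw [h6] at h4
  have h7 := sq_pos n
  have h8 : (n : ℝ) + 1 = (sq n ^ 2)⁻¹ := by rw [sq_sq, inv_inv]
  rw [h8] at h5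
  set v := (kill F (Iio 0) (n + 1)).real (Ico (-2) (-1))
  have h9 : hF.llc / 2 * ww n ≤ v := by
    have : hF.llc / 2 * sq n ≤ (sq n ^ 2)⁻¹ * v := by
      refine le_trans ?_ h5
      rw [lt_inv_mul_iff₀ h7] at h4
      linarith
    rw [le_inv_mul_iff₀ (by positivity)] at this
    rw [ww]; linarith
  refine le_trans ?_ h9
  have : ww (n + 1) ≤ ww n := by
    unfold ww sq
    gcongr
    linarith
  gcongr

end HalfLineLimit

section Barrier

variable {F : Measure ℝ} [IsProbabilityMeasure F]

omit [IsProbabilityMeasure F] in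
lemma ae_kill_nonneg (n : ℕ) : ∀ᵐ y ∂(kill F (Ici 0) n), 0 ≤ y := by
  filter_upwards [ae_kill_mem_or (F := F) (Or.inr rfl : HalfLine (Ici 0)) n] with y hy
  rcases hy with h | h
  · exact h
  · exact h.ge

lemma StepLaw.exists_kill_Iio_le (hF : StepLaw F) : ∃ C > 0, ∀ a : ℝ, 0 < a → ∀ n,
    (kill F (Ici 0) n).real (Iio a) ≤ C * wgt a ^ 2 * ww n := by
  obtain ⟨C, hC, hb⟩ := hF.exists_kill_bnd (Or.inr rfl : HalfLine (Ici 0))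
  refine ⟨36 * C, by positivity, fun a ha n => ?_⟩
  have h1 : (kill F (Ici 0) n).real (Iio a)
      ≤ (kill F (Ici 0) n).real (Icc (-(a + 1)) (a + 1)) := by
    refine ENNReal.toReal_mono (by finiteness) (measure_mono_ae ?_)
    filter_upwards [ae_kill_nonneg (F := F) n] with y hy hya
    have hya' : y < a := hya
    exact ⟨by linarith, by linarith⟩
  have h2 := (hb n).real_Icc_le (r := a + 1) (by linarith)
  have h3 : wgt (a + 1 + 1) ≤ wgt a * 9 := by
    have := wgt_add_le a 2
    rw [show a + 1 + 1 = a + 2 by ring]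
    refine this.trans (le_of_eq ?_)
    norm_num [wgt]
  have h4 : a + 1 ≤ wgt a := by
    rw [wgt, abs_of_pos ha]; nlinarith
  have h5 := ww_pos n
  have h6 := wgt_pos a
  calc _ ≤ 4 * (a + 1) * (C * ww n * wgt (a + 1 + 1)) := h1.trans h2
    _ ≤ 4 * wgt a * (C * ww n * (wgt a * 9)) := by
      have := wgt_pos (a + 1 + 1)
      gcongr
    _ = _ := by ring

lemma StepLaw.exists_level_term_bnd (hF : StepLaw F) : ∃ C > 0, ∀ a : ℝ, 0 < a → ∀ k m,
    Bnd ((kill F (Ici 0) k).restrict (Iio a) ∗ kill F (Iio 0) m)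
      (C * wgt a ^ 3 * (ww k * ww m)) := by
  obtain ⟨C, hC, hb⟩ := hF.exists_kill_bnd (Or.inl rfl : HalfLine (Iio 0))
  obtain ⟨C', hC', hb'⟩ := hF.exists_kill_Iio_le
  refine ⟨C * C', by positivity, fun a ha k m c => ?_⟩
  have h1 := conv_real_le (m := (kill F (Ici 0) k).restrict (Iio a)) (R := kill F (Iio 0) m)
    (s := Ico c (c + 1)) (J := univ) (A := C * ww m * (wgt c * wgt a)) measurableSet_Ico
    MeasurableSet.univ (by have := ww_pos m; have := wgt_pos c; have := wgt_pos a; positivity) (by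
      filter_upwards [ae_restrict_of_ae (ae_kill_nonneg (F := F) k),
        ae_restrict_mem measurableSet_Iio] with y hy hya
      rw [indicator_of_mem (mem_univ _)]
      have e : (fun z => y + z) ⁻¹' Ico c (c + 1) = Ico (c - y) (c - y + 1) := by
        ext z; simp only [mem_preimage, mem_Ico]
        constructor <;> rintro ⟨h, h'⟩ <;> constructor <;> linarith
      rw [e]
      refine (hb m _).trans (mul_le_mul_of_nonneg_left ?_ (hb m).nonneg)
      rw [sub_eq_add_neg]
      refine (wgt_add_le _ _).trans ?_
      rw [wgt_neg]
      refine mul_le_mul_of_nonneg_left (wgt_mono ?_) (wgt_pos c).le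
      rw [abs_of_nonneg hy, abs_of_pos ha]
      exact le_of_lt hya)
  rw [measureReal_restrict_apply_univ] at h1
  have h2 := hb' a ha k
  have := ww_pos m
  have := wgt_pos c
  have := wgt_pos a
  calc _ ≤ C * ww m * (wgt c * wgt a) * (C' * wgt a ^ 2 * ww k) := h1.trans (by gcongr)
    _ = _ := by ring

lemma StepLaw.exists_barrier_bnd (hF : StepLaw F) : ∃ C > 0, ∀ a : ℝ, 0 < a → ∀ n,
    Bnd (kill F (Iio a) n) (C * wgt a ^ 3 * ww n) := by
  obtain ⟨C, hC, hb⟩ := hF.exists_level_term_bnd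
  obtain ⟨C', hC', hb'⟩ := sum_ww_conv_le
  refine ⟨C * C', by positivity, fun a ha n c => ?_⟩
  rw [kill_level F a ha n, real_sum_measure]
  refine (Finset.sum_le_sum fun k _ => hb a ha k (n - k) c).trans ?_
  rw [← Finset.sum_mul, ← Finset.mul_sum]
  have := wgt_pos c
  have := wgt_pos a
  calc _ ≤ C * wgt a ^ 3 * (C' * ww n) * wgt c := by gcongr; exact hb' n
    _ = _ := by ring

lemma StepLaw.barrier_limit (hF : StepLaw F) {g : ℝ → ℝ} (h : Cls g) {a : ℝ} (ha : 0 < a) :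
    ∃ l, Tendsto (fun n => (ww n)⁻¹ * ∫ x, g x ∂(kill F (Iio a) n)) atTop (𝓝 l) := by
  obtain ⟨C, hC, hb⟩ := hF.exists_level_term_bnd
  obtain ⟨C₁, hC₁, hb₁⟩ := hF.exists_kill_bnd (Or.inl rfl : HalfLine (Iio 0))
  obtain ⟨C₂, hC₂, hb₂⟩ := hF.exists_kill_Iio_le
  set N := (nrm g).toReal with hN
  have hN0 : 0 ≤ N := ENNReal.toReal_nonneg
  have hgi : ∀ m : Measure ℝ, IsFiniteMeasure m → Integrable g m := fun m _ =>
    Integrable.of_bound h.meas.aestronglyMeasurable N (ae_of_all _ fun x => abs_le_nrm h.fin x)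
  have h0 := wgt_pos a
  set P : ℕ → Measure ℝ := fun k => (kill F (Ici 0) k).restrict (Iio a) with hP
  suffices hs : ∃ l, Tendsto (fun n => (∑ k ∈ Finset.range (n + 1),
      ∫ x, g x ∂(P k ∗ kill F (Iio 0) (n - k))) / ww n) atTop (𝓝 l) by
    obtain ⟨l, hl⟩ := hs
    refine ⟨l, hl.congr fun n => ?_⟩
    rw [kill_level F a ha n, integral_finsetSum_measure (fun i _ => hgi _ inferInstance),
      div_eq_inv_mul]
  refine conv_tannery_ww (C := C * wgt a ^ 3 * N)
    (a := fun k m => ∫ x, g x ∂(P k ∗ kill F (Iio 0) m))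
    (fun k m => ((hb a ha k m).abs_integral_le h.meas h.fin).trans (le_of_eq (by ring)))
    (fun k => ?_) (fun m => ?_)
  · have e : (fun m => (∫ x, g x ∂(P k ∗ kill F (Iio 0) m)) / ww m)
        = fun m => ∫ w, (∫ y, g (w + y) ∂(kill F (Iio 0) m)) / ww m ∂(P k) := by
      ext m; rw [integral_conv (hgi _ inferInstance), integral_div]
    rw [e]
    refine exists_tendsto_integral (b := fun _ => C₁ * wgt a * N)
      (fun m => ((measurable_integral_add h.meas).div_const _).aestronglyMeasurable)
      (integrable_const _) (fun m => ?_) (ae_of_all _ fun w => ?_)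
    · filter_upwards [ae_restrict_of_ae (ae_kill_nonneg (F := F) k),
        ae_restrict_mem measurableSet_Iio] with w hw hwa
      have h1 := (hb₁ m).integral_abs_shift_le h.meas h.fin w
      have h2 := ww_pos m
      rw [abs_div, abs_of_pos h2, div_le_iff₀ h2]
      simp_rw [add_comm w]
      have h3 : wgt w ≤ wgt a := wgt_mono (by
        rw [abs_of_nonneg hw, abs_of_pos ha]; exact le_of_lt hwa)
      calc _ ≤ C₁ * ww m * wgt w * N := (abs_integral_le_integral_abs).trans h1
        _ ≤ C₁ * ww m * wgt a * N := by gcongr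
        _ = _ := by ring
    · obtain ⟨l, hl⟩ := hF.kill_limit (Or.inl rfl : HalfLine (Iio 0)) (h.shift w)
      refine ⟨l, hl.congr fun m => ?_⟩
      rw [div_eq_inv_mul]
      simp_rw [add_comm w]
  · have e : (fun k => (∫ x, g x ∂(P k ∗ kill F (Iio 0) m)) / ww k)
        = fun k => ∫ y, (∫ w, g (y + w) ∂(P k)) / ww k ∂(kill F (Iio 0) m) := by
      ext k; rw [Measure.conv_comm, integral_conv (hgi _ inferInstance), integral_div]
    rw [e]
    refine exists_tendsto_integral (b := fun _ => N * (C₂ * wgt a ^ 2))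
      (fun m => ((measurable_integral_add h.meas).div_const _).aestronglyMeasurable)
      (integrable_const _) (fun k => ae_of_all _ fun y => ?_) (ae_of_all _ fun y => ?_)
    · have h2 := ww_pos k
      rw [abs_div, abs_of_pos h2, div_le_iff₀ h2, ← Real.norm_eq_abs]
      have h3 := norm_integral_le_of_norm_le_const (μ := P k) (f := fun w => g (y + w)) (C := N)
        (ae_of_all _ fun w => abs_le_nrm h.fin _)
      rw [hP] at h3
      simp only [measureReal_restrict_apply_univ] at h3
      refine h3.trans ?_
      calc _ ≤ N * (C₂ * wgt a ^ 2 * ww k) := by gcongr; exact hb₂ a ha k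
        _ = _ := by ring
    · obtain ⟨l, hl⟩ := hF.kill_limit (Or.inr rfl : HalfLine (Ici 0)) ((h.shift y).Iio a)
      refine ⟨l, hl.congr fun k => ?_⟩
      rw [div_eq_inv_mul, integral_indicator measurableSet_Iio]
      simp_rw [add_comm y]
      rfl

lemma kill_mono {D E : Set ℝ} (h : D ⊆ E) (n : ℕ) : kill F D n ≤ kill F E n := by
  induction n with
  | zero => exact le_rfl
  | succ n ih =>
    refine Measure.restrict_mono h (Measure.le_iff.2 fun s hs => ?_)
    rw [conv_apply_eq _ _ hs, conv_apply_eq _ _ hs]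
    exact lintegral_mono' ih le_rfl

lemma StepLaw.barrier_lower (hF : StepLaw F) : ∃ c > 0, ∀ x : ℝ, 0 ≤ x →
    ∀ᶠ n in atTop, c * ww n ≤ (kill F (Iio x) n).real (Ico (-2) (-1)) := by
  obtain ⟨c, hc, h⟩ := hF.kill_lower
  refine ⟨c, hc, fun x hx => ?_⟩
  filter_upwards [h] with n hn
  exact hn.trans (ENNReal.toReal_mono (by finiteness) (kill_mono (Iio_subset_Iio hx) n _))

end Barrier

/-- One step, with law `ρ` of the pair `(X, η)`, of the chain `(s, b) ↦ (s + X, b + θ η e^{s + X})`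
whose first coordinate is killed at the barrier `x`. -/
def stp (ρ : Measure (ℝ × ℝ)) (x θ : ℝ) (g : ℝ → ℝ → ℝ) (s b : ℝ) : ℝ :=
  ∫ p, (if s + p.1 < x then g (s + p.1) (b + θ * (p.2 * Real.exp (s + p.1))) else 0) ∂ρ

/-- The restriction of `stp` to functions of the first coordinate. -/
def kop (ρ : Measure (ℝ × ℝ)) (x : ℝ) (φ : ℝ → ℝ) (s : ℝ) : ℝ :=
  ∫ p, (if s + p.1 < x then φ (s + p.1) else 0) ∂ρ

structure Adm (A : ℝ) (g : ℝ → ℝ → ℝ) : Prop where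
  meas : Measurable (Function.uncurry g)
  bdd : ∀ s b, |g s b| ≤ A

structure EnvLaw (ρ : Measure (ℝ × ℝ)) (κ χ M : ℝ) : Prop where
  pos : 0 < χ
  ae_mem : ∀ᵐ p ∂ρ, -κ ≤ p.1 ∧ χ ≤ p.2 ∧ p.2 ≤ M
  step : StepLaw (ρ.map Prod.fst)

section Operators

variable {ρ : Measure (ℝ × ℝ)} [IsProbabilityMeasure ρ] {x θ A : ℝ} {g g' : ℝ → ℝ → ℝ}
  {φ : ℝ → ℝ}

instance : IsProbabilityMeasure (ρ.map Prod.fst) :=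
  Measure.isProbabilityMeasure_map measurable_fst.aemeasurable

lemma stp_measurable_integrand (h : Measurable (Function.uncurry g)) :
    Measurable fun q : (ℝ × ℝ) × ℝ × ℝ => if q.1.1 + q.2.1 < x then
      g (q.1.1 + q.2.1) (q.1.2 + θ * (q.2.2 * Real.exp (q.1.1 + q.2.1))) else 0 := by
  refine Measurable.ite (measurableSet_lt (by fun_prop) (by fun_prop)) ?_ measurable_const
  exact h.comp (f := fun q : (ℝ × ℝ) × ℝ × ℝ =>
    (q.1.1 + q.2.1, q.1.2 + θ * (q.2.2 * Real.exp (q.1.1 + q.2.1)))) (by fun_prop)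

namespace Adm

omit [IsProbabilityMeasure ρ] in
lemma nonneg (h : Adm A g) : 0 ≤ A := (abs_nonneg _).trans (h.bdd 0 0)

lemma integrable (h : Adm A g) (s b : ℝ) : Integrable (fun p : ℝ × ℝ => if s + p.1 < x then
      g (s + p.1) (b + θ * (p.2 * Real.exp (s + p.1))) else 0) ρ := by
  refine Integrable.of_bound (Measurable.aestronglyMeasurable ?_) A (ae_of_all _ fun p => ?_)
  · exact (stp_measurable_integrand h.meas).comp (f := fun p : ℝ × ℝ => ((s, b), p)) (by fun_prop)
  · split_ifs
    · exact h.bdd _ _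
    · simpa using h.nonneg

lemma stp (h : Adm A g) : Adm A (stp ρ x θ g) where
  meas := by
    refine StronglyMeasurable.measurable ?_
    exact StronglyMeasurable.integral_prod_right
      (f := fun (q : ℝ × ℝ) (p : ℝ × ℝ) => if q.1 + p.1 < x then
        g (q.1 + p.1) (q.2 + θ * (p.2 * Real.exp (q.1 + p.1))) else 0)
      (stp_measurable_integrand h.meas).stronglyMeasurable
  bdd s b := by
    have := norm_integral_le_of_norm_le_const (μ := ρ) (C := A) (f := fun p : ℝ × ℝ =>
      if s + p.1 < x then g (s + p.1) (b + θ * (p.2 * Real.exp (s + p.1))) else 0)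
      (ae_of_all _ fun p => by
        split_ifs
        · exact h.bdd _ _
        · simpa using h.nonneg)
    rw [probReal_univ, mul_one] at this
    exact this

lemma iter (h : Adm A g) (n : ℕ) : Adm A ((BPREpaper.stp ρ x θ)^[n] g) := by
  induction n with
  | zero => exact h
  | succ n ih => rw [Function.iterate_succ_apply']; exact ih.stp

omit [IsProbabilityMeasure ρ] in
lemma of_fun (hφ : Measurable φ) (hb : ∀ s, |φ s| ≤ A) : Adm A (fun s _ => φ s) :=
  ⟨hφ.comp measurable_fst, fun s _ => hb s⟩

omit [IsProbabilityMeasure ρ] in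
lemma left (h : Adm A (fun s _ => φ s)) : Measurable φ :=
  h.meas.comp (f := fun s : ℝ => (s, (0 : ℝ))) (by fun_prop)

lemma kop (h : Adm A (fun s _ => φ s)) : Adm A (fun s _ => BPREpaper.kop ρ x φ s) := by
  exact h.stp (ρ := ρ) (x := x) (θ := 0)

lemma kop_iter (h : Adm A (fun s _ => φ s)) (n : ℕ) :
    Adm A (fun s _ => (BPREpaper.kop ρ x)^[n] φ s) := by
  induction n with
  | zero => exact h
  | succ n ih => rw [Function.iterate_succ_apply']; exact ih.kop

end Adm

omit [IsProbabilityMeasure ρ] in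
lemma stp_iter_fun (n : ℕ) :
    (stp ρ x θ)^[n] (fun s _ => φ s) = fun s _ => (kop ρ x)^[n] φ s := by
  induction n with
  | zero => rfl
  | succ n ih => rw [Function.iterate_succ_apply', ih, Function.iterate_succ_apply']; rfl

lemma stp_le_stp {A' x' θ' s b s' b' : ℝ} (h : Adm A g) (h' : Adm A' g')
    (hle : ∀ᵐ p ∂ρ, (if s + p.1 < x then g (s + p.1) (b + θ * (p.2 * Real.exp (s + p.1))) else 0)
      ≤ if s' + p.1 < x' then g' (s' + p.1) (b' + θ' * (p.2 * Real.exp (s' + p.1))) else 0) :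
    stp ρ x θ g s b ≤ stp ρ x' θ' g' s' b' :=
  integral_mono_ae (h.integrable s b) (h'.integrable s' b') hle

lemma stp_abs_le (h : Adm A (fun s _ => φ s)) (hle : ∀ s b, |g s b| ≤ φ s) (s b : ℝ) :
    |stp ρ x θ g s b| ≤ kop ρ x φ s := by
  rw [stp, ← Real.norm_eq_abs]
  refine norm_integral_le_of_norm_le (h.integrable (ρ := ρ) (x := x) (θ := 0) s b)
    (ae_of_all _ fun p => ?_)
  split_ifs
  · exact hle _ _
  · simp

lemma stp_iter_abs_le (h : Adm A (fun s _ => φ s)) (hle : ∀ s b, |g s b| ≤ φ s) (n : ℕ) (s b : ℝ) :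
    |(stp ρ x θ)^[n] g s b| ≤ (kop ρ x)^[n] φ s := by
  induction n generalizing s b with
  | zero => exact hle s b
  | succ n ih =>
    rw [Function.iterate_succ_apply', Function.iterate_succ_apply']
    exact stp_abs_le (h.kop_iter n) ih s b

lemma stp_sub (h : Adm A g) {A' : ℝ} (h' : Adm A' g') (s b : ℝ) :
    stp ρ x θ (fun s b => g s b - g' s b) s b = stp ρ x θ g s b - stp ρ x θ g' s b := by
  rw [stp, stp, stp, ← integral_sub (h.integrable s b) (h'.integrable s b)]
  refine integral_congr_ae (ae_of_all _ fun p => ?_)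
  simp only
  split_ifs <;> simp

lemma stp_iter_sub (h : Adm A g) {A' : ℝ} (h' : Adm A' g') (n : ℕ) :
    (stp ρ x θ)^[n] (fun s b => g s b - g' s b)
      = fun s b => (stp ρ x θ)^[n] g s b - (stp ρ x θ)^[n] g' s b := by
  induction n with
  | zero => rfl
  | succ n ih =>
    simp only [Function.iterate_succ_apply', ih]
    ext s b
    exact stp_sub (h.iter n) (h'.iter n) s b

omit [IsProbabilityMeasure ρ] in
lemma kop_const_mul (c : ℝ) : kop ρ x (fun s => c * φ s) = fun s => c * kop ρ x φ s := by
  ext s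
  rw [kop, kop, ← integral_const_mul]
  congr 1; ext p
  split_ifs <;> simp

omit [IsProbabilityMeasure ρ] in
lemma kop_iter_const_mul (c : ℝ) (n : ℕ) :
    (kop ρ x)^[n] (fun s => c * φ s) = fun s => c * (kop ρ x)^[n] φ s := by
  induction n with
  | zero => rfl
  | succ n ih => rw [Function.iterate_succ_apply', ih, kop_const_mul, Function.iterate_succ_apply']

/-- `L`-Lipschitz continuity in the second variable with a weight depending on the first. -/
def LipW (L : ℝ) (φ : ℝ → ℝ) (g : ℝ → ℝ → ℝ) : Prop :=
  ∀ s b b', |g s b - g s b'| ≤ L * |b - b'| * φ s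

lemma LipW.stp {L : ℝ} (hL : LipW L φ g) (h : Adm A g) {A' : ℝ} (hφ : Adm A' (fun s _ => φ s)) :
    LipW L (kop ρ x φ) (stp ρ x θ g) := by
  intro s b b'
  rw [BPREpaper.stp, BPREpaper.stp, ← integral_sub (h.integrable s b) (h.integrable s b'), kop,
    ← integral_const_mul]
  rw [← Real.norm_eq_abs]
  refine norm_integral_le_of_norm_le ((hφ.integrable (ρ := ρ) (x := x) (θ := 0) s b).const_mul _)
    (ae_of_all _ fun p => ?_)
  split_ifs
  · rw [Real.norm_eq_abs]
    refine (hL _ _ _).trans (le_of_eq ?_)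
    congr 3; ring
  · simp

lemma LipW.iter {L : ℝ} (hL : LipW L φ g) (h : Adm A g) {A' : ℝ} (hφ : Adm A' (fun s _ => φ s))
    (n : ℕ) : LipW L ((kop ρ x)^[n] φ) ((BPREpaper.stp ρ x θ)^[n] g) := by
  induction n with
  | zero => exact hL
  | succ n ih =>
    rw [Function.iterate_succ_apply', Function.iterate_succ_apply']
    exact ih.stp (h.iter n) (hφ.kop_iter n)

/-- `e^s` cut off at the barrier. -/
def ex (x s : ℝ) : ℝ := if s < x then Real.exp s else 0

lemma ex_nonneg (x s : ℝ) : 0 ≤ ex x s := by unfold ex; split_ifs <;> positivity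

lemma measurable_ex (x : ℝ) : Measurable (ex x) :=
  Measurable.ite measurableSet_Iio (by fun_prop) measurable_const

lemma ex_le (x s : ℝ) : ex x s ≤ Real.exp x := by
  unfold ex; split_ifs with h
  · exact Real.exp_le_exp.2 h.le
  · positivity

lemma adm_ex (x : ℝ) : Adm (Real.exp x) (fun s _ => ex x s) :=
  Adm.of_fun (measurable_ex x) fun s => by rw [abs_of_nonneg (ex_nonneg x s)]; exact ex_le x s

omit [IsProbabilityMeasure ρ] in
lemma kop_nonneg (h : ∀ s, 0 ≤ φ s) (s : ℝ) : 0 ≤ kop ρ x φ s :=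
  integral_nonneg fun p => by simp only [Pi.zero_apply]; split_ifs <;> simp [h]

omit [IsProbabilityMeasure ρ] in
lemma kop_iter_nonneg (h : ∀ s, 0 ≤ φ s) (n : ℕ) (s : ℝ) : 0 ≤ (kop ρ x)^[n] φ s := by
  induction n generalizing s with
  | zero => exact h s
  | succ n ih => rw [Function.iterate_succ_apply']; exact kop_nonneg ih s

lemma EnvLaw.stp_sub_stp_le {κ χ M L : ℝ} (hρ : EnvLaw ρ κ χ M) (hg : Adm A g)
    (hL : LipW L φ g) (hL0 : 0 ≤ L) (hφ0 : ∀ s, 0 ≤ φ s) {A' : ℝ} (hφ : Adm A' (fun s _ => φ s))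
    (s b : ℝ) :
    |stp ρ x 0 g s b - stp ρ x 1 g s b| ≤ L * M * kop ρ x (fun s => ex x s * φ s) s := by
  have hA : Adm (Real.exp x * A') (fun s _ => ex x s * φ s) :=
    Adm.of_fun ((measurable_ex x).mul hφ.left) fun s => by
      rw [abs_mul, abs_of_nonneg (ex_nonneg x s)]
      exact mul_le_mul (ex_le x s) (hφ.bdd s 0) (abs_nonneg _) (by positivity)
  rw [stp, stp, ← integral_sub (hg.integrable s b) (hg.integrable s b), kop, ← integral_const_mul]
  rw [← Real.norm_eq_abs]
  refine norm_integral_le_of_norm_le ((hA.integrable (ρ := ρ) (x := x) (θ := 0) s b).const_mul _) ?_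
  filter_upwards [hρ.ae_mem] with p hp
  split_ifs with h
  · rw [Real.norm_eq_abs]
    refine (hL _ _ _).trans ?_
    rw [ex, if_pos h]
    have h1 := hφ0 (s + p.1)
    have h2 : |b + 0 * (p.2 * Real.exp (s + p.1)) - (b + 1 * (p.2 * Real.exp (s + p.1)))|
        ≤ M * Real.exp (s + p.1) := by
      rw [show b + 0 * (p.2 * Real.exp (s + p.1)) - (b + 1 * (p.2 * Real.exp (s + p.1)))
        = -(p.2 * Real.exp (s + p.1)) by ring, abs_neg,
        abs_of_nonneg (mul_nonneg (hρ.pos.le.trans hp.2.1) (Real.exp_nonneg _))]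
      exact mul_le_mul_of_nonneg_right hp.2.2 (Real.exp_nonneg _)
    calc _ ≤ L * (M * Real.exp (s + p.1)) * φ (s + p.1) := by gcongr
      _ = _ := by ring
  · simp

/-- Freezing the second coordinate during `m` steps. -/
lemma EnvLaw.freeze_le {κ χ M L : ℝ} (hρ : EnvLaw ρ κ χ M) (hg : Adm A g)
    (hL : LipW L (ex x) g) (hL0 : 0 ≤ L) (m i j : ℕ) (s b : ℝ) :
    |(stp ρ x 1)^[i] ((stp ρ x 0)^[m] ((stp ρ x 1)^[j] g)) s b
      - (stp ρ x 1)^[i + m + j] g s b|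
      ≤ L * M * ∑ l ∈ Finset.range m,
        (kop ρ x)^[i + l + 1] (fun s => ex x s * (kop ρ x)^[m - 1 - l + j] (ex x) s) s := by
  induction m generalizing i with
  | zero => simp [Function.iterate_add_apply]
  | succ m ih =>
    set G := (stp ρ x 0)^[m] ((stp ρ x 1)^[j] g) with hG
    have hGA : Adm A G := (hg.iter j).iter m
    have hGL : LipW L ((kop ρ x)^[m + j] (ex x)) G := by
      rw [Function.iterate_add_apply]
      exact (hL.iter hg (adm_ex x) j).iter (hg.iter j) ((adm_ex x).kop_iter j) m
    have hφA := (adm_ex x).kop_iter (ρ := ρ) (x := x) (m + j)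
    have hφ0 := kop_iter_nonneg (ρ := ρ) (x := x) (ex_nonneg x) (m + j)
    set φ := (kop ρ x)^[m + j] (ex x) with hφ
    have h1 : |(stp ρ x 1)^[i] (stp ρ x 0 G) s b - (stp ρ x 1)^[i + 1] G s b|
        ≤ L * M * (kop ρ x)^[i + 1] (fun s => ex x s * φ s) s := by
      have e := congrFun (congrFun (stp_iter_sub (ρ := ρ) (x := x) (θ := 1)
        (hGA.stp (ρ := ρ) (x := x) (θ := 0)) (hGA.stp (ρ := ρ) (x := x) (θ := 1)) i) s) b
      rw [Function.iterate_succ_apply, ← e]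
      have hA : Adm (Real.exp x * Real.exp x) (fun s _ => ex x s * φ s) :=
        Adm.of_fun ((measurable_ex x).mul hφA.left) fun s => by
          rw [abs_mul, abs_of_nonneg (ex_nonneg x s)]
          exact mul_le_mul (ex_le x s) (hφA.bdd s 0) (abs_nonneg _) (by positivity)
      have hA2 : Adm (|L * M| * (Real.exp x * Real.exp x))
          (fun s _ => L * M * kop ρ x (fun s => ex x s * φ s) s) :=
        Adm.of_fun (hA.kop.left.const_mul _) fun s => by
          rw [abs_mul]
          exact mul_le_mul_of_nonneg_left (hA.kop.bdd s 0) (abs_nonneg _)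
      refine (stp_iter_abs_le hA2
        (fun s b => hρ.stp_sub_stp_le hGA hGL hL0 hφ0 hφA s b) i s b).trans
        (le_of_eq ?_)
      rw [kop_iter_const_mul, Function.iterate_succ_apply]
    have h2 := ih (i + 1)
    rw [Function.iterate_succ_apply']
    rw [show i + 1 + m + j = i + (m + 1) + j by ring] at h2
    refine (abs_sub_le _ _ _).trans ((add_le_add h1 h2).trans (le_of_eq ?_))
    rw [Finset.sum_range_succ', mul_add, add_comm]
    congr 2
    refine Finset.sum_congr rfl fun l _ => ?_
    rw [show i + (l + 1) + 1 = i + 1 + l + 1 by ring, show m + 1 - 1 - (l + 1) = m - 1 - l by omega]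

end Operators

section Killed

variable {ρ : Measure (ℝ × ℝ)} [IsProbabilityMeasure ρ] {x A : ℝ} {g : ℝ → ℝ → ℝ} {φ : ℝ → ℝ}

omit [IsProbabilityMeasure ρ] in
lemma stp_zero_eq (h : Adm A g) (s b : ℝ) :
    stp ρ x 0 g s b = ∫ z, (if s + z < x then g (s + z) b else 0) ∂(ρ.map Prod.fst) := by
  have h1 : Measurable fun z : ℝ => if s + z < x then g (s + z) b else 0 :=
    Measurable.ite (measurableSet_lt (by fun_prop) (by fun_prop))
      (h.meas.comp (f := fun z : ℝ => (s + z, b)) (by fun_prop)) measurable_const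
  rw [integral_map (by fun_prop) h1.aestronglyMeasurable, stp]
  simp

lemma stp_zero_iter_eq (h : Adm A g) (n : ℕ) (s b : ℝ) :
    (stp ρ x 0)^[n] g s b = ∫ y, g (s + y) b ∂(kill (ρ.map Prod.fst) (Iio (x - s)) n) := by
  induction n generalizing g with
  | zero => simp [kill]
  | succ n ih =>
    rw [Function.iterate_succ_apply, ih h.stp, kill, ← integral_indicator measurableSet_Iio]
    have hm : Measurable ((Iio (x - s)).indicator fun z => g (s + z) b) :=
      Measurable.indicator (h.meas.comp (f := fun z : ℝ => (s + z, b)) (by fun_prop))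
        measurableSet_Iio
    rw [integral_conv]
    · refine integral_congr_ae (ae_of_all _ fun y => ?_)
      simp only
      rw [stp_zero_eq h]
      refine integral_congr_ae (ae_of_all _ fun z => ?_)
      simp only [indicator_apply, mem_Iio, lt_sub_iff_add_lt', add_assoc]
    · refine Integrable.of_bound hm.aestronglyMeasurable A (ae_of_all _ fun y => ?_)
      refine (norm_indicator_le_norm_self _ _).trans (h.bdd _ _)

lemma kop_iter_eq (h : Adm A (fun s _ => φ s)) (n : ℕ) (s : ℝ) :
    (kop ρ x)^[n] φ s = ∫ y, φ (s + y) ∂(kill (ρ.map Prod.fst) (Iio (x - s)) n) := by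
  have := stp_zero_iter_eq (ρ := ρ) (x := x) h n s 0
  rwa [stp_iter_fun] at this

lemma exp_mul_pow_le (k : ℕ) {s x : ℝ} (h : s ≤ x) :
    Real.exp s * (1 + |s|) ^ k ≤ k.factorial * Real.exp (1 + 2 * |x|) := by
  have h1 := Real.pow_div_factorial_le_exp (1 + |s|) (by positivity) k
  rw [div_le_iff₀ (by positivity)] at h1
  have h2 : s + |s| ≤ 2 * |x| := by
    rcases le_total 0 s with h0 | h0
    · rw [abs_of_nonneg h0, abs_of_nonneg (h0.trans h)]; linarith
    · rw [abs_of_nonpos h0]; have := abs_nonneg x; linarith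
  calc _ ≤ Real.exp s * (Real.exp (1 + |s|) * k.factorial) := by gcongr
    _ = k.factorial * Real.exp (1 + (s + |s|)) := by
      rw [show 1 + (s + |s|) = s + (1 + |s|) by ring, Real.exp_add s]; ring
    _ ≤ _ := by gcongr

lemma ex_mul_wgt_pow_le (k : ℕ) (x : ℝ) : ∃ C, ∀ y, |ex x y * wgt y ^ k| ≤ C / wgt y ^ 2 := by
  refine ⟨(2 * (k + 2)).factorial * Real.exp (1 + 2 * |x|), fun y => ?_⟩
  have h0 := wgt_pos y
  rw [abs_of_nonneg (mul_nonneg (ex_nonneg x y) (by positivity)), le_div_iff₀ (by positivity)]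
  unfold ex
  split_ifs with h
  · refine le_trans (le_of_eq ?_) (exp_mul_pow_le (2 * (k + 2)) h.le)
    rw [wgt, mul_assoc, ← pow_add, ← pow_mul]
  · simp only [zero_mul]; positivity

lemma nrm_ex_mul_wgt_pow (k : ℕ) (x : ℝ) : nrm (fun y => ex x y * wgt y ^ k) ≠ ⊤ := by
  obtain ⟨C, hC⟩ := ex_mul_wgt_pow_le k x
  exact nrm_ne_top_of_decay hC

lemma ex_add (x y c : ℝ) : ex x (c + y) = Real.exp x * ex 0 (y + (c - x)) := by
  unfold ex
  have : (c + y < x) ↔ y + (c - x) < 0 := by constructor <;> intro <;> linarith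
  simp only [this]
  split_ifs
  · rw [← Real.exp_add]; congr 1; ring
  · simp

/-- Exponential functionals of the killed walk, uniformly in the barrier. -/
lemma StepLaw.exists_integral_ex_le {F : Measure ℝ} [IsProbabilityMeasure F] (hF : StepLaw F)
    (k : ℕ) : ∃ C > 0, ∀ x s : ℝ, s < x → ∀ n,
    ∫ y, ex x (s + y) * wgt (s + y - x) ^ k ∂(kill F (Iio (x - s)) n)
      ≤ C * Real.exp x * wgt (x - s) ^ 4 * ww n := by
  obtain ⟨C, hC, hb⟩ := hF.exists_barrier_bnd
  set N := (nrm fun y => ex 0 y * wgt y ^ k).toReal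
  have hN : 0 ≤ N := ENNReal.toReal_nonneg
  refine ⟨C * (N + 1), by positivity, fun x s hs n => ?_⟩
  have hm : Measurable fun y => ex 0 y * wgt y ^ k :=
    (measurable_ex 0).mul (measurable_wgt.pow_const k)
  have h1 := (hb (x - s) (by linarith) n).integral_abs_shift_le hm (nrm_ex_mul_wgt_pow k 0) (s - x)
  have h2 : ∫ y, ex x (s + y) * wgt (s + y - x) ^ k ∂(kill F (Iio (x - s)) n)
      = Real.exp x * ∫ y, |ex 0 (y + (s - x)) * wgt (y + (s - x)) ^ k|
        ∂(kill F (Iio (x - s)) n) := by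
    rw [← integral_const_mul]
    refine integral_congr_ae (ae_of_all _ fun y => ?_)
    simp only
    have := wgt_pos (y + (s - x))
    rw [abs_of_nonneg (mul_nonneg (ex_nonneg _ _) (by positivity)), ex_add, mul_assoc]
    congr 4; ring
  rw [h2]
  have h3 : wgt (s - x) = wgt (x - s) := by rw [← wgt_neg, neg_sub]
  have h4 := wgt_pos (x - s)
  have h5 := ww_pos n
  rw [h3] at h1
  calc _ ≤ Real.exp x * (C * wgt (x - s) ^ 3 * ww n * wgt (x - s) * (N + 1)) := by
        gcongr
        refine h1.trans ?_
        gcongr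
        linarith
    _ = _ := by ring

lemma StepLaw.exists_kop_ex_le (hF : StepLaw (ρ.map Prod.fst)) : ∃ C > 0, ∀ x s : ℝ, s < x →
    ∀ n, (kop ρ x)^[n] (ex x) s ≤ C * Real.exp x * wgt (x - s) ^ 4 * ww n := by
  obtain ⟨C, hC, h⟩ := hF.exists_integral_ex_le 0
  refine ⟨C, hC, fun x s hs n => ?_⟩
  rw [kop_iter_eq (adm_ex x)]
  simpa using h x s hs n

lemma adm_ex_mul_kop (x : ℝ) (r : ℕ) :
    Adm (Real.exp x * Real.exp x) (fun s _ => ex x s * (kop ρ x)^[r] (ex x) s) := by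
  have h := (adm_ex x).kop_iter (ρ := ρ) (x := x) r
  refine Adm.of_fun ((measurable_ex x).mul h.left) fun s => ?_
  rw [abs_mul, abs_of_nonneg (ex_nonneg x s)]
  exact mul_le_mul (ex_le x s) (h.bdd s 0) (abs_nonneg _) (by positivity)

lemma StepLaw.exists_kop_ex_mul_le (hF : StepLaw (ρ.map Prod.fst)) : ∃ C > 0, ∀ x : ℝ, 0 < x →
    ∀ l r, (kop ρ x)^[l] (fun s => ex x s * (kop ρ x)^[r] (ex x) s) 0
      ≤ C * Real.exp x ^ 2 * wgt x ^ 4 * (ww l * ww r) := by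
  obtain ⟨C, hC, h⟩ := hF.exists_integral_ex_le 4
  obtain ⟨C', hC', h'⟩ := hF.exists_kop_ex_le
  refine ⟨C * C', by positivity, fun x hx l r => ?_⟩
  rw [kop_iter_eq (adm_ex_mul_kop x r)]
  have h0 := ww_pos r
  obtain ⟨K, hK⟩ := ex_mul_wgt_pow_le 4 0
  have hint : Integrable (fun y => ex x (0 + y) * wgt (0 + y - x) ^ 4)
      (kill (ρ.map Prod.fst) (Iio (x - 0)) l) := by
    refine Integrable.of_bound (Measurable.aestronglyMeasurable ?_) (Real.exp x * K)
      (ae_of_all _ fun y => ?_)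
    · exact ((measurable_ex x).comp (by fun_prop)).mul
        ((measurable_wgt.comp (by fun_prop)).pow_const 4)
    · have e := ex_add x y 0
      have h1 := wgt_pos (y + (0 - x))
      have h2 := one_le_wgt (y + (0 - x))
      have h3 := hK (y + (0 - x))
      rw [show 0 + y - x = y + (0 - x) by ring, e, mul_assoc, norm_mul, Real.norm_eq_abs,
        abs_of_pos (Real.exp_pos x)]
      gcongr
      refine h3.trans (div_le_self ?_ (one_le_pow₀ h2))
      have := (abs_nonneg _).trans h3
      rcases le_or_gt 0 K with hk | hk
      · exact hk
      · exact absurd this (not_le.2 (div_neg_of_neg_of_pos hk (by positivity)))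
  calc _ ≤ ∫ y, C' * Real.exp x * ww r * (ex x (0 + y) * wgt (0 + y - x) ^ 4)
        ∂(kill (ρ.map Prod.fst) (Iio (x - 0)) l) := by
        refine integral_mono_of_nonneg (ae_of_all _ fun y => ?_) (hint.const_mul _)
          (ae_of_all _ fun y => ?_)
        · exact mul_nonneg (ex_nonneg _ _) (kop_iter_nonneg (ex_nonneg x) _ _)
        · simp only
          by_cases hy : 0 + y < x
          · have := h' x (0 + y) hy r
            rw [← wgt_neg, neg_sub] at this
            have h3 := ex_nonneg x (0 + y)
            calc _ ≤ ex x (0 + y) * (C' * Real.exp x * wgt (0 + y - x) ^ 4 * ww r) := by gcongr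
              _ = _ := by ring
          · have : ex x (0 + y) = 0 := if_neg hy
            simp only [this, zero_mul, mul_zero, le_refl]
    _ ≤ C' * Real.exp x * ww r * (C * Real.exp x * wgt (x - 0) ^ 4 * ww l) := by
        rw [integral_const_mul]
        have := h x 0 hx l
        gcongr
    _ = _ := by rw [sub_zero]; ring

end Killed

lemma sum_ww_middle_le (J m : ℕ) :
    ∑ l ∈ Finset.range m, ww (J + l + 1) * ww (m - 1 - l + J)
      ≤ 16 * (∑' k, ww (k + J)) * ww (J + m + J) := by
  have hs : Summable fun k => ww (k + J) := (summable_nat_add_iff J).2 summable_ww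
  have hs' : Summable fun k => ww (k + 1 + J) :=
    (summable_nat_add_iff (f := fun k => ww (k + J)) 1).2 hs
  have h0 := ww_pos (J + m + J)
  have h1 : ∀ l ∈ Finset.range m, ww (J + l + 1) * ww (m - 1 - l + J)
      ≤ 8 * ww (J + m + J) * (ww (l + 1 + J) + ww (m - 1 - l + J)) := by
    intro l hl
    rw [Finset.mem_range] at hl
    have ha := ww_pos (J + l + 1)
    have hb := ww_pos (m - 1 - l + J)
    rw [show l + 1 + J = J + l + 1 by ring]
    rcases le_total (J + l + 1) (m - 1 - l + J) with h | h
    · have := ww_le_eight (n := J + m + J) (j := m - 1 - l + J) (by omega)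
      calc _ ≤ ww (J + l + 1) * (8 * ww (J + m + J)) := by gcongr
        _ = 8 * ww (J + m + J) * (ww (J + l + 1) + 0) := by ring
        _ ≤ _ := by gcongr
    · have := ww_le_eight (n := J + m + J) (j := J + l + 1) (by omega)
      calc _ ≤ (8 * ww (J + m + J)) * ww (m - 1 - l + J) := by gcongr
        _ = 8 * ww (J + m + J) * (0 + ww (m - 1 - l + J)) := by ring
        _ ≤ _ := by gcongr
  refine (Finset.sum_le_sum h1).trans ?_
  rw [← Finset.mul_sum, Finset.sum_add_distrib, Finset.sum_range_reflect (fun k => ww (k + J))]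
  have h2 : ∑ l ∈ Finset.range m, ww (l + J) ≤ ∑' k, ww (k + J) :=
    hs.sum_le_tsum _ fun k _ => (ww_pos _).le
  have h3 : ∑ l ∈ Finset.range m, ww (l + 1 + J) ≤ ∑' k, ww (k + J) := by
    refine (hs'.sum_le_tsum _ fun k _ => (ww_pos _).le).trans ?_
    rw [hs.tsum_eq_zero_add]
    linarith [ww_pos (0 + J)]
  calc _ ≤ 8 * ww (J + m + J) * (∑' k, ww (k + J) + ∑' k, ww (k + J)) := by gcongr
    _ = _ := by ring

lemma tendsto_tsum_ww : Tendsto (fun J => ∑' k, ww (k + J)) atTop (𝓝 0) :=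
  tendsto_sum_nat_add ww

section Freeze

variable {ρ : Measure (ℝ × ℝ)} [IsProbabilityMeasure ρ] {x A κ χ M L : ℝ} {g : ℝ → ℝ → ℝ}

lemma EnvLaw.exists_freeze_le (hρ : EnvLaw ρ κ χ M) (hM : 0 ≤ M) (hx : 0 < x) :
    ∃ C > 0, ∀ {g : ℝ → ℝ → ℝ} {A L : ℝ}, Adm A g → LipW L (ex x) g → 0 ≤ L → ∀ J m,
    |(stp ρ x 1)^[J] ((stp ρ x 0)^[m] ((stp ρ x 1)^[J] g)) 0 0 - (stp ρ x 1)^[J + m + J] g 0 0|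
      ≤ L * C * (∑' k, ww (k + J)) * ww (J + m + J) := by
  obtain ⟨C, hC, h⟩ := hρ.step.exists_kop_ex_mul_le
  have h0 := wgt_pos x
  refine ⟨M * (C * Real.exp x ^ 2 * wgt x ^ 4 * 16) + 1, by positivity, fun hg hL hL0 J m => ?_⟩
  have h2 : 0 ≤ ∑' k, ww (k + J) := tsum_nonneg fun k => (ww_pos _).le
  have h3 := ww_pos (J + m + J)
  refine (hρ.freeze_le hg hL hL0 m J J 0 0).trans ?_
  refine (mul_le_mul_of_nonneg_left ((Finset.sum_le_sum fun l _ => h x hx _ _).trans_eq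
    (Finset.mul_sum _ _ _).symm) (by positivity)).trans ?_
  calc _ ≤ _ * M * (C * Real.exp x ^ 2 * wgt x ^ 4
        * (16 * (∑' k, ww (k + J)) * ww (J + m + J))) := by
        gcongr; exact sum_ww_middle_le J m
    _ = _ * (M * (C * Real.exp x ^ 2 * wgt x ^ 4 * 16)) * (∑' k, ww (k + J)) * ww (J + m + J) := by
        ring
    _ ≤ _ := by gcongr; linarith

end Freeze

lemma ww_anti {j n : ℕ} (h : j ≤ n) : ww n ≤ ww j := by
  unfold ww sq; gcongr

/-- Bounded Lipschitz functions on the line decaying at least as fast as `b ^ (-2)`. -/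
structure Profile (L : ℝ) (h : ℝ → ℝ) : Prop where
  nonneg : ∀ b, 0 ≤ h b
  le_one : ∀ b, h b ≤ 1
  lip_nonneg : 0 ≤ L
  lip : ∀ b b', |h b - h b'| ≤ L * |b - b'|
  decay : ∀ b, 0 < b → h b * b ^ 2 ≤ 1

/-- The function `e ^ s * h b` cut off at the barrier `x`. -/
def prof (x : ℝ) (h : ℝ → ℝ) (s b : ℝ) : ℝ := ex x s * h b

namespace Profile

variable {L : ℝ} {h : ℝ → ℝ} (hh : Profile L h)
include hh

lemma continuous : Continuous h :=
  (LipschitzWith.of_dist_le_mul (K := L.toNNReal) fun b b' => by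
    simpa [Real.dist_eq, Real.coe_toNNReal _ hh.lip_nonneg] using hh.lip b b').continuous

lemma prof_nonneg (x s b : ℝ) : 0 ≤ prof x h s b := mul_nonneg (ex_nonneg x s) (hh.nonneg b)

lemma prof_abs_le (x s b : ℝ) : |prof x h s b| ≤ ex x s := by
  rw [abs_of_nonneg (hh.prof_nonneg x s b)]
  exact mul_le_of_le_one_right (ex_nonneg x s) (hh.le_one b)

lemma adm_prof (x : ℝ) : Adm (Real.exp x) (prof x h) where
  meas := ((measurable_ex x).comp measurable_fst).mul (hh.continuous.measurable.comp measurable_snd)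
  bdd s b := (hh.prof_abs_le x s b).trans (ex_le x s)

lemma lipW_prof (x : ℝ) : LipW L (ex x) (prof x h) := fun s b b' => by
  unfold prof
  rw [← mul_sub, abs_mul, abs_of_nonneg (ex_nonneg x s), mul_comm]
  exact mul_le_mul_of_nonneg_right (hh.lip b b') (ex_nonneg x s)

lemma cls (a x c b r : ℝ) :
    Cls fun y => if y < a then prof x h (y + c) (b + r * Real.exp y) else 0 := by
  have hc := hh.continuous
  have h1 : nrm (fun u => Real.exp x * Real.exp (-|u|)) ≠ ⊤ := by
    refine nrm_ne_top_of_decay (C := Real.exp x * ((4 : ℕ).factorial * Real.exp (1 + 2 * |0|)))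
      fun y => ?_
    have h0 := wgt_pos y
    have := exp_mul_pow_le 4 (neg_nonpos.2 (abs_nonneg y))
    rw [abs_neg, abs_abs] at this
    rw [abs_of_pos (by positivity), le_div_iff₀ (by positivity), wgt, ← pow_mul, mul_assoc]
    gcongr
  have h2 : Cls fun y => Real.exp x * Real.exp (-|y + (c - x)|) * h (b + r * Real.exp y) := by
    refine ⟨by fun_prop, ae_of_all _ fun y => by fun_prop,
      ne_top_of_le_ne_top (nrm_shift_ne_top h1 (c - x)) (nrm_mono fun y => ?_)⟩
    rw [abs_mul]
    refine mul_le_of_le_one_right (abs_nonneg _) ?_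
    rw [abs_of_nonneg (hh.nonneg _)]
    exact hh.le_one _
  have h3 := (h2.Iio (x - c)).Iio a
  convert h3 using 2 with y
  simp only [indicator_apply, mem_Iio, lt_sub_iff_add_lt, prof, ex, ite_mul, zero_mul]
  split_ifs with h4 h5
  · rw [abs_of_neg (by linarith), ← Real.exp_add]
    congr 2; ring
  · rfl
  · rfl

end Profile

/-- Functions whose rescaled integrals against the measures `m n` converge, robustly under the
operations performed by `stp`. -/
structure Inn (m : ℕ → Measure ℝ) (f : ℝ → ℝ → ℝ) (φ : ℝ → ℝ) : Prop where
  adm : ∃ A, Adm A f ∧ Adm A (fun s _ => φ s)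
  le : ∀ s b, |f s b| ≤ φ s
  bnd : ∃ K, 0 ≤ K ∧ ∀ n c, ∫ y, φ (y + c) ∂(m n) ≤ K * wgt c * ww n
  lim : ∀ a c b r, ∃ l, Tendsto (fun n => (ww n)⁻¹ *
    ∫ y, (if y < a then f (y + c) (b + r * Real.exp y) else 0) ∂(m n)) atTop (𝓝 l)

section Inner

variable {ρ : Measure (ℝ × ℝ)} [IsProbabilityMeasure ρ] {x : ℝ} {m : ℕ → Measure ℝ}
  [∀ n, IsFiniteMeasure (m n)] {f : ℝ → ℝ → ℝ} {φ : ℝ → ℝ}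

lemma StepLaw.integrable_wgt (hF : StepLaw (ρ.map Prod.fst)) (c : ℝ) :
    Integrable (fun p : ℝ × ℝ => wgt (c + p.1)) ρ := by
  have h1 : Integrable (fun y : ℝ => wgt (c + y)) (ρ.map Prod.fst) := by
    have h2 : Integrable (fun y : ℝ => wgt c * (2 + 2 * y ^ 2)) (ρ.map Prod.fst) :=
      ((integrable_const _).add (hF.int2.const_mul 2)).const_mul _
    refine h2.mono' (measurable_wgt.comp (by fun_prop)).aestronglyMeasurable
      (ae_of_all _ fun y => ?_)
    have h0 := wgt_pos c
    rw [Real.norm_of_nonneg (wgt_pos _).le]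
    refine (wgt_add_le c y).trans ?_
    gcongr
    unfold wgt
    nlinarith [sq_nonneg (1 - |y|), sq_abs y]
  exact (integrable_map_measure h1.aestronglyMeasurable measurable_fst.aemeasurable).1 h1

lemma Inn.stp (hF : StepLaw (ρ.map Prod.fst)) (h : Inn m f φ) :
    Inn m (stp ρ x 1 f) (kop ρ x φ) := by
  obtain ⟨A, hf, hφ⟩ := h.adm
  obtain ⟨K, hK, hKb⟩ := h.bnd
  have hφ0 : ∀ s, 0 ≤ φ s := fun s => (abs_nonneg _).trans (h.le s 0)
  have hφi : ∀ n c, Integrable (fun y => φ (y + c)) (m n) := fun n c =>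
    Integrable.of_bound (hφ.left.comp (by fun_prop)).aestronglyMeasurable A
      (ae_of_all _ fun y => hφ.bdd _ 0)
  refine ⟨⟨A, hf.stp, hφ.kop⟩, stp_abs_le hφ h.le, ?_, fun a c b r => ?_⟩
  · refine ⟨K * ∫ p, wgt (0 + p.1) ∂ρ, by
      have := integral_nonneg (μ := ρ) (f := fun p => wgt (0 + p.1)) fun p => (wgt_pos _).le
      positivity, fun n c => ?_⟩
    have hsw : ∫ y, kop ρ x φ (y + c) ∂(m n)
        = ∫ p, ∫ y, (if y + c + p.1 < x then φ (y + c + p.1) else 0) ∂(m n) ∂ρ := by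
      unfold kop
      refine integral_integral_swap ?_
      refine Integrable.of_bound (Measurable.aestronglyMeasurable ?_) A (ae_of_all _ fun q => ?_)
      · exact Measurable.ite (measurableSet_lt (by fun_prop) (by fun_prop))
          (hφ.left.comp (by fun_prop)) measurable_const
      · simp only [Function.uncurry]
        split_ifs
        · exact hφ.bdd _ 0
        · simpa using hφ.nonneg
    rw [hsw]
    have h0 := ww_pos n
    have h1 := wgt_pos c
    calc _ ≤ ∫ p, K * (wgt c * wgt (0 + p.1)) * ww n ∂ρ := by
          refine integral_mono_of_nonneg (ae_of_all _ fun p => ?_)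
            (((hF.integrable_wgt 0).const_mul _).const_mul _ |>.mul_const _)
            (ae_of_all _ fun p => ?_)
          · exact integral_nonneg fun y => by
              simp only [Pi.zero_apply]; split_ifs <;> simp [hφ0]
          · simp only
            calc _ ≤ ∫ y, φ (y + (c + p.1)) ∂(m n) := by
                  refine integral_mono_of_nonneg (ae_of_all _ fun y => ?_) (hφi n _)
                    (ae_of_all _ fun y => ?_)
                  · simp only [Pi.zero_apply]; split_ifs <;> simp [hφ0]
                  · simp only [add_assoc]; split_ifs <;> simp [hφ0]
              _ ≤ K * wgt (c + p.1) * ww n := hKb n _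
              _ ≤ _ := by
                  rw [zero_add]
                  gcongr
                  exact wgt_add_le _ _
      _ = _ := by rw [integral_mul_const, integral_const_mul, integral_const_mul]; ring
  · set Φ : ℕ → ℝ × ℝ → ℝ := fun n p => (ww n)⁻¹ * ∫ y, (if y < a ∧ y + c + p.1 < x then
      f (y + c + p.1) (b + r * Real.exp y + 1 * (p.2 * Real.exp (y + c + p.1))) else 0) ∂(m n)
      with hΦ
    have hmeas : Measurable fun q : ℝ × ℝ × ℝ => if q.1 < a ∧ q.1 + c + q.2.1 < x then
      f (q.1 + c + q.2.1) (b + r * Real.exp q.1 + 1 * (q.2.2 * Real.exp (q.1 + c + q.2.1)))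
        else 0 := by
      have hs : MeasurableSet {q : ℝ × ℝ × ℝ | q.1 < a ∧ q.1 + c + q.2.1 < x} :=
        MeasurableSet.inter (measurableSet_lt measurable_fst measurable_const)
          (measurableSet_lt (f := fun q : ℝ × ℝ × ℝ => q.1 + c + q.2.1) (by fun_prop)
            measurable_const)
      refine Measurable.ite hs ?_ measurable_const
      exact hf.meas.comp (f := fun q : ℝ × ℝ × ℝ => (q.1 + c + q.2.1,
        b + r * Real.exp q.1 + 1 * (q.2.2 * Real.exp (q.1 + c + q.2.1)))) (by fun_prop)
    suffices hs : ∃ l, Tendsto (fun n => ∫ p, Φ n p ∂ρ) atTop (𝓝 l) by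
      obtain ⟨l, hl⟩ := hs
      refine ⟨l, hl.congr fun n => ?_⟩
      simp only [hΦ]
      rw [integral_const_mul]
      congr 1
      have := integral_integral_swap (μ := m n) (ν := ρ) (f := fun (y : ℝ) (p : ℝ × ℝ) =>
        if y < a ∧ y + c + p.1 < x then
          f (y + c + p.1) (b + r * Real.exp y + 1 * (p.2 * Real.exp (y + c + p.1))) else 0) (by
          refine Integrable.of_bound hmeas.aestronglyMeasurable A (ae_of_all _ fun q => ?_)
          simp only [Function.uncurry]
          split_ifs
          · exact hf.bdd _ _
          · simpa using hf.nonneg)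
      rw [← this]
      refine integral_congr_ae (ae_of_all _ fun y => ?_)
      simp only [BPREpaper.stp]
      by_cases hy : y < a <;> simp [hy]
    refine exists_tendsto_integral (b := fun p => K * wgt (c + p.1)) (fun n => ?_)
      ((hF.integrable_wgt c).const_mul K) (fun n => ae_of_all _ fun p => ?_)
      (ae_of_all _ fun p => ?_)
    · refine (StronglyMeasurable.aestronglyMeasurable ?_).const_mul _
      exact StronglyMeasurable.integral_prod_left (f := fun (y : ℝ) (p : ℝ × ℝ) =>
        if y < a ∧ y + c + p.1 < x then
          f (y + c + p.1) (b + r * Real.exp y + 1 * (p.2 * Real.exp (y + c + p.1)))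
        else 0) hmeas.stronglyMeasurable
    · have h0 := ww_pos n
      simp only [hΦ]
      rw [abs_mul, abs_of_pos (inv_pos.2 h0), inv_mul_le_iff₀ h0, mul_comm]
      refine le_trans ?_ (hKb n (c + p.1))
      rw [← Real.norm_eq_abs]
      refine norm_integral_le_of_norm_le (hφi n _) (ae_of_all _ fun y => ?_)
      split_ifs
      · rw [← add_assoc]; exact h.le _ _
      · rw [norm_zero]; exact hφ0 _
    · obtain ⟨l, hl⟩ := h.lim (min a (x - (c + p.1))) (c + p.1) b (r + p.2 * Real.exp (c + p.1))
      refine ⟨l, hl.congr fun n => ?_⟩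
      simp only [hΦ]
      congr 1
      refine integral_congr_ae (ae_of_all _ fun y => ?_)
      simp only [lt_min_iff, lt_sub_iff_add_lt, ← add_assoc]
      congr 2
      rw [add_assoc y, Real.exp_add y]; ring

lemma Inn.stp_iter (hF : StepLaw (ρ.map Prod.fst)) (h : Inn m f φ) (J : ℕ) :
    Inn m ((BPREpaper.stp ρ x 1)^[J] f) ((kop ρ x)^[J] φ) := by
  induction J with
  | zero => exact h
  | succ J ih =>
    rw [Function.iterate_succ_apply', Function.iterate_succ_apply']
    exact ih.stp hF

end Inner

lemma Profile.inn {F : Measure ℝ} [IsProbabilityMeasure F] (hF : StepLaw F) {L : ℝ} {h : ℝ → ℝ}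
    (hh : Profile L h) {a : ℝ} (ha : 0 < a) (x : ℝ) :
    Inn (fun n => kill F (Iio a) n) (prof x h) (ex x) := by
  refine ⟨⟨_, hh.adm_prof x, adm_ex x⟩, hh.prof_abs_le x, ?_,
    fun a' c b r => hF.barrier_limit (hh.cls a' x c b r) ha⟩
  obtain ⟨C, hC, hb⟩ := hF.exists_barrier_bnd
  have h1 : nrm (ex x) ≠ ⊤ := by simpa using nrm_ex_mul_wgt_pow 0 x
  have h0 := wgt_pos a
  refine ⟨C * wgt a ^ 3 * (nrm (ex x)).toReal, by positivity, fun n c => ?_⟩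
  have := (hb a ha n).integral_abs_shift_le (measurable_ex x) h1 c
  simp only [abs_of_nonneg (ex_nonneg x _)] at this
  exact this.trans (le_of_eq (by ring))

/-- Sequences of functions of order `ww m` that converge after rescaling. -/
structure Outer (x : ℝ) (G : ℕ → ℝ → ℝ → ℝ) : Prop where
  adm : ∃ A, ∀ m, Adm A (G m)
  bnd : ∀ K, ∃ C, 0 ≤ C ∧ ∀ m s b, -K ≤ s → s < x → |G m s b| ≤ C * ww m
  lim : ∀ s b, s < x → ∃ l, Tendsto (fun m => (ww m)⁻¹ * G m s b) atTop (𝓝 l)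

section

variable {ρ : Measure (ℝ × ℝ)} [IsProbabilityMeasure ρ] {x κ χ M L : ℝ} {G : ℕ → ℝ → ℝ → ℝ}
  {h : ℝ → ℝ}

lemma Outer.stp (hρ : EnvLaw ρ κ χ M) (hG : Outer x G) : Outer x fun m => stp ρ x 1 (G m) := by
  obtain ⟨A, hA⟩ := hG.adm
  refine ⟨⟨A, fun m => (hA m).stp⟩, fun K => ?_, fun s b hs => ?_⟩
  · obtain ⟨C, hC, hb⟩ := hG.bnd (K + κ)
    refine ⟨C, hC, fun m s b hs hsx => ?_⟩
    have := norm_integral_le_of_norm_le_const (μ := ρ) (C := C * ww m) (f := fun p : ℝ × ℝ =>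
      if s + p.1 < x then G m (s + p.1) (b + 1 * (p.2 * Real.exp (s + p.1))) else 0) (by
        filter_upwards [hρ.ae_mem] with p hp
        split_ifs with hlt
        · exact hb m _ _ (by linarith [hp.1]) hlt
        · rw [norm_zero]; have := ww_pos m; positivity)
    rw [probReal_univ, mul_one] at this
    exact this
  · obtain ⟨C, hC, hb⟩ := hG.bnd (-s + κ)
    have := exists_tendsto_integral (m := ρ) (b := fun _ => C) (Φ := fun m p => (ww m)⁻¹ *
      (if s + p.1 < x then G m (s + p.1) (b + 1 * (p.2 * Real.exp (s + p.1))) else 0))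
      (fun m => ((hA m).integrable s b).aestronglyMeasurable.const_mul _) (integrable_const _)
      (fun m => by
        filter_upwards [hρ.ae_mem] with p hp
        have h0 := ww_pos m
        rw [abs_mul, abs_of_pos (inv_pos.2 h0), inv_mul_le_iff₀ h0, mul_comm (ww m)]
        split_ifs with hlt
        · exact hb m _ _ (by linarith [hp.1]) hlt
        · rw [abs_zero]; positivity)
      (ae_of_all _ fun p => by
        by_cases hlt : s + p.1 < x
        · simpa only [if_pos hlt] using hG.lim _ _ hlt
        · exact ⟨0, by simp [if_neg hlt]⟩)
    simp only [integral_const_mul] at this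
    exact this

lemma Outer.stp_iter (hρ : EnvLaw ρ κ χ M) (hG : Outer x G) (J : ℕ) :
    Outer x fun m => (BPREpaper.stp ρ x 1)^[J] (G m) := by
  induction J with
  | zero => exact hG
  | succ J ih => simp only [Function.iterate_succ_apply']; exact ih.stp hρ

lemma Profile.outer (hF : StepLaw (ρ.map Prod.fst)) (hh : Profile L h) (x : ℝ) (J : ℕ) :
    Outer x fun m => (BPREpaper.stp ρ x 0)^[m] ((BPREpaper.stp ρ x 1)^[J] (prof x h)) := by
  refine ⟨⟨Real.exp x, fun m => ((hh.adm_prof x).iter J).iter m⟩, fun K => ?_, fun s b hs => ?_⟩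
  · obtain ⟨C, hC, hb⟩ := hF.exists_kop_ex_le
    refine ⟨C * Real.exp x * wgt (x + K) ^ 4, by have := wgt_pos (x + K); positivity,
      fun m s b hs hsx => ?_⟩
    have h1 := stp_iter_abs_le (ρ := ρ) (x := x) (θ := 0) ((adm_ex x).kop_iter (ρ := ρ) (x := x) J)
      (fun s b => stp_iter_abs_le (ρ := ρ) (x := x) (θ := 1) (adm_ex x) (hh.prof_abs_le x) J s b)
      m s b
    rw [← Function.iterate_add_apply] at h1
    refine h1.trans ((hb x s hsx _).trans ?_)
    have h2 := wgt_pos (x - s)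
    have h3 : wgt (x - s) ≤ wgt (x + K) := wgt_mono (by
      rw [abs_of_pos (by linarith), abs_of_pos (by linarith)]; linarith)
    have h4 := ww_anti (Nat.le_add_right m J)
    have h5 := ww_pos (m + J)
    gcongr
  · have ha : 0 < x - s := by linarith
    obtain ⟨l, hl⟩ := ((hh.inn hF ha x).stp_iter (ρ := ρ) (x := x) hF J).lim (x - s) s b 0
    refine ⟨l, hl.congr' ?_⟩
    filter_upwards [eventually_ge_atTop 1] with m hm
    obtain ⟨m, rfl⟩ := Nat.exists_eq_add_of_le' hm
    rw [stp_zero_iter_eq ((hh.adm_prof x).iter J)]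
    congr 1
    refine integral_congr_ae ?_
    simp only [kill]
    filter_upwards [ae_restrict_mem measurableSet_Iio] with y hy
    rw [if_pos (mem_Iio.1 hy), zero_mul, add_zero, add_comm]

/-- Convergence of the rescaled functionals of the chain killed at a fixed barrier. -/
lemma EnvLaw.barrier_tendsto (hρ : EnvLaw ρ κ χ M) (hM : 0 ≤ M) (hh : Profile L h) (hx : 0 < x) :
    ∃ l, Tendsto (fun n => (ww n)⁻¹ * (stp ρ x 1)^[n] (prof x h) 0 0) atTop (𝓝 l) := by
  obtain ⟨C, hC, hfr⟩ := hρ.exists_freeze_le hM hx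
  have hL0 := hh.lip_nonneg
  refine exists_tendsto_of_approx fun ε hε => ?_
  obtain ⟨J, hJ⟩ : ∃ J, L * C * ∑' k, ww (k + J) ≤ ε := by
    have := (tendsto_tsum_ww.const_mul (L * C)).eventually (gt_mem_nhds (by simpa using hε))
    obtain ⟨J, hJ⟩ := this.exists
    exact ⟨J, hJ.le⟩
  refine ⟨fun n => (ww n)⁻¹ *
    (stp ρ x 1)^[J] ((stp ρ x 0)^[n - 2 * J] ((stp ρ x 1)^[J] (prof x h))) 0 0, ?_, ?_⟩
  · obtain ⟨l, hl⟩ := ((hh.outer hρ.step x J).stp_iter hρ J).lim 0 0 hx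
    have h1 := (hl.comp (tendsto_sub_atTop_nat (2 * J))).mul (tendsto_ww_ratio (2 * J))
    refine ⟨_, h1.congr fun n => ?_⟩
    have := (ww_pos n).ne'
    have := (ww_pos (n - 2 * J)).ne'
    simp only [Function.comp]
    field_simp
  · filter_upwards [eventually_ge_atTop (2 * J)] with n hn
    have h0 := ww_pos n
    have h1 := hfr (hh.adm_prof x) (hh.lipW_prof x) hL0 J (n - 2 * J)
    rw [show J + (n - 2 * J) + J = n by omega] at h1
    rw [← mul_sub, abs_mul, abs_of_pos (inv_pos.2 h0), inv_mul_le_iff₀ h0, abs_sub_comm]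
    refine h1.trans ?_
    rw [mul_comm (ww n)]
    gcongr

end

section Barrier

variable {ρ : Measure (ℝ × ℝ)} [IsProbabilityMeasure ρ] {x y κ χ M L : ℝ} {h : ℝ → ℝ}

omit [IsProbabilityMeasure ρ] in
lemma Profile.iter_nonneg (hh : Profile L h) (x θ : ℝ) (n : ℕ) (s b : ℝ) :
    0 ≤ (stp ρ x θ)^[n] (prof x h) s b := by
  induction n generalizing s b with
  | zero => exact hh.prof_nonneg x s b
  | succ n ih =>
    rw [Function.iterate_succ_apply']
    exact integral_nonneg fun p => by simp only [Pi.zero_apply]; split_ifs <;> simp [ih]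

lemma ex_mono (hxy : x ≤ y) (s : ℝ) : ex x s ≤ ex y s := by
  unfold ex
  by_cases h : s < x
  · rw [if_pos h, if_pos (h.trans_le hxy)]
  · rw [if_neg h]; split_ifs <;> positivity

lemma Profile.iter_mono (hh : Profile L h) (hxy : x ≤ y) (n : ℕ) (s b : ℝ) :
    (stp ρ x 1)^[n] (prof x h) s b ≤ (stp ρ y 1)^[n] (prof y h) s b := by
  induction n generalizing s b with
  | zero => exact mul_le_mul_of_nonneg_right (ex_mono hxy s) (hh.nonneg b)
  | succ n ih =>
    rw [Function.iterate_succ_apply', Function.iterate_succ_apply']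
    refine stp_le_stp ((hh.adm_prof x).iter n) ((hh.adm_prof y).iter n) (ae_of_all _ fun p => ?_)
    by_cases hp : s + p.1 < x
    · rw [if_pos hp, if_pos (hp.trans_le hxy)]; exact ih _ _
    · rw [if_neg hp]
      split_ifs
      · exact hh.iter_nonneg _ _ _ _ _
      · exact le_rfl

lemma Profile.iter_le_of_le (hρ : EnvLaw ρ κ χ M) (hh : Profile L h) {β : ℝ} (hβ : 0 < β) (n : ℕ)
    (s b : ℝ) (hb : β ≤ b) :
    (stp ρ y 1)^[n] (prof y h) s b ≤ (β ^ 2)⁻¹ * (kop ρ y)^[n] (ex y) s := by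
  induction n generalizing s b with
  | zero =>
    have h1 := hh.decay b (hβ.trans_le hb)
    have h2 : h b ≤ (β ^ 2)⁻¹ := by
      rw [← one_div, le_div_iff₀ (by positivity)]
      exact (mul_le_mul_of_nonneg_left (by gcongr) (hh.nonneg b)).trans h1
    simp only [Function.iterate_zero, id_eq, prof]
    rw [mul_comm]
    exact mul_le_mul_of_nonneg_right h2 (ex_nonneg y s)
  | succ n ih =>
    rw [Function.iterate_succ_apply', Function.iterate_succ_apply', stp, kop, ← integral_const_mul]
    refine integral_mono_ae (((hh.adm_prof y).iter n).integrable s b)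
      ((((adm_ex y).kop_iter n).integrable (θ := 0) s b).const_mul _) ?_
    filter_upwards [hρ.ae_mem] with p hp
    split_ifs
    · refine ih _ _ (hb.trans ?_)
      have := hρ.pos.le.trans hp.2.1
      have : 0 ≤ 1 * (p.2 * Real.exp (s + p.1)) := by positivity
      linarith
    · simp

lemma Profile.iter_le_add (hρ : EnvLaw ρ κ χ M) (hh : Profile L h) (hxy : x ≤ y) (n : ℕ)
    (s b : ℝ) (hs : s < x) (hb : 0 ≤ b) :
    (stp ρ y 1)^[n] (prof y h) s b ≤ (stp ρ x 1)^[n] (prof x h) s b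
      + ((χ * Real.exp x) ^ 2)⁻¹ * (kop ρ y)^[n] (ex y) s := by
  have hχ := hρ.pos
  induction n generalizing s b with
  | zero =>
    have h0 := ex_nonneg y s
    have : prof y h s b = prof x h s b := by
      rw [prof, prof, ex, ex, if_pos hs, if_pos (hs.trans_le hxy)]
    simp only [Function.iterate_zero, id_eq, this]
    have : 0 ≤ ((χ * Real.exp x) ^ 2)⁻¹ * ex y s := by positivity
    linarith
  | succ n ih =>
    simp only [Function.iterate_succ_apply']
    have i1 := ((hh.adm_prof y).iter (ρ := ρ) (x := y) (θ := 1) n).integrable (ρ := ρ) (x := y)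
      (θ := 1) s b
    have i2 := ((hh.adm_prof x).iter (ρ := ρ) (x := x) (θ := 1) n).integrable (ρ := ρ) (x := x)
      (θ := 1) s b
    have i3 := (((adm_ex y).kop_iter (ρ := ρ) (x := y) n).integrable (ρ := ρ) (x := y)
      (θ := 0) s b).const_mul (((χ * Real.exp x) ^ 2)⁻¹)
    rw [stp, stp, kop, ← integral_const_mul, ← integral_add i2 i3]
    refine integral_mono_ae i1 (i2.add i3) ?_
    filter_upwards [hρ.ae_mem] with p hp
    have hp2 := hχ.le.trans hp.2.1
    have hb' : 0 ≤ b + 1 * (p.2 * Real.exp (s + p.1)) := by positivity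
    by_cases h1 : s + p.1 < x
    · simp only [if_pos h1, if_pos (h1.trans_le hxy)]
      exact ih _ _ h1 hb'
    · by_cases h2 : s + p.1 < y
      · simp only [if_neg h1, if_pos h2, zero_add]
        refine hh.iter_le_of_le hρ (by positivity) n _ _ ?_
        have h3 := Real.exp_le_exp.2 (not_lt.1 h1)
        have : χ * Real.exp x ≤ p.2 * Real.exp (s + p.1) := by
          gcongr; exact hp.2.1
        linarith
      · simp [if_neg h1, if_neg h2]

/-- Raising the barrier changes the functionals by a uniformly small multiple of `ww n`. -/
lemma EnvLaw.exists_iter_le_add (hρ : EnvLaw ρ κ χ M) : ∃ δ : ℕ → ℝ, Summable δ ∧ (∀ j, 0 ≤ δ j) ∧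
    ∀ {h : ℝ → ℝ} {L : ℝ}, Profile L h → ∀ J k n,
    (stp ρ ((J + k : ℕ) + 1) 1)^[n] (prof ((J + k : ℕ) + 1) h) 0 0
      ≤ (stp ρ (J + 1) 1)^[n] (prof (J + 1) h) 0 0 + (∑' j, δ (j + J)) * ww n := by
  obtain ⟨C, hC, hb⟩ := hρ.step.exists_kop_ex_le
  have hχ := hρ.pos
  set δ : ℕ → ℝ := fun j => ((χ * Real.exp (j + 1)) ^ 2)⁻¹ *
    (C * Real.exp ((j + 1 : ℕ) + 1) * wgt ((j + 1 : ℕ) + 1) ^ 4) with hδ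
  have hδ0 : ∀ j, 0 ≤ δ j := fun j => by
    have := wgt_pos ((j + 1 : ℕ) + 1); simp only [hδ]; positivity
  have hδs : Summable δ := by
    have h1 : Summable fun n : ℕ => (n : ℝ) ^ 8 * Real.exp (-1) ^ n :=
      summable_pow_mul_geometric_of_norm_lt_one 8 (by
        rw [Real.norm_of_nonneg (Real.exp_nonneg _)]; exact Real.exp_lt_one_iff.2 (by norm_num))
    have h2 := ((summable_nat_add_iff 3).2 h1).mul_left ((χ ^ 2)⁻¹ * C * Real.exp 3)
    refine h2.congr fun j => ?_
    simp only [hδ, wgt]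
    have e1 : Real.exp (-1) ^ (j + 3) = Real.exp (-((j : ℝ) + 3)) := by
      rw [← Real.exp_nat_mul]; push_cast; congr 1; ring
    have e2 : (Real.exp ((j : ℝ) + 1) ^ 2)⁻¹ = Real.exp (-(2 * ((j : ℝ) + 1))) := by
      rw [← Real.exp_nat_mul, ← Real.exp_neg]; push_cast; rfl
    rw [e1, mul_pow, mul_inv, e2, abs_of_nonneg (by positivity), ← pow_mul]
    push_cast
    have e3 : Real.exp (-(2 * ((j : ℝ) + 1))) * Real.exp ((j : ℝ) + 1 + 1)
        = Real.exp 3 * Real.exp (-((j : ℝ) + 3)) := by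
      rw [← Real.exp_add, ← Real.exp_add]; congr 1; ring
    calc _ = (χ ^ 2)⁻¹ * C * ((j : ℝ) + 3) ^ 8 * (Real.exp 3 * Real.exp (-((j : ℝ) + 3))) := by ring
      _ = _ := by rw [← e3]; ring
  refine ⟨δ, hδs, hδ0, fun {h L} hh J k n => ?_⟩
  have hstep : ∀ j : ℕ, (stp ρ ((j + 1 : ℕ) + 1) 1)^[n] (prof ((j + 1 : ℕ) + 1) h) 0 0
      ≤ (stp ρ (j + 1) 1)^[n] (prof (j + 1) h) 0 0 + δ j * ww n := by
    intro j
    refine (hh.iter_le_add hρ (x := (j : ℝ) + 1) (by push_cast; linarith) n 0 0 (by positivity)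
      le_rfl).trans ?_
    have := hb ((j + 1 : ℕ) + 1) 0 (by positivity) n
    rw [sub_zero] at this
    simp only [hδ]
    rw [mul_assoc]
    gcongr
  have hw := ww_pos n
  have hfin : (stp ρ ((J + k : ℕ) + 1) 1)^[n] (prof ((J + k : ℕ) + 1) h) 0 0
      ≤ (stp ρ (J + 1) 1)^[n] (prof (J + 1) h) 0 0 + (∑ j ∈ Finset.range k, δ (j + J)) * ww n := by
    induction k with
    | zero => simp
    | succ k ih =>
      have := hstep (J + k)
      rw [Finset.sum_range_succ, add_mul, ← add_assoc, add_comm k J]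
      rw [← add_assoc]
      linarith
  refine hfin.trans ?_
  have := ((summable_nat_add_iff J).2 hδs).sum_le_tsum (Finset.range k) fun j _ => hδ0 (j + J)
  gcongr

/-- The function `K⁻² (1 - b / K)⁺`, cut off above. -/
def tri (K b : ℝ) : ℝ := (K ^ 2)⁻¹ * max 0 (min 1 (1 - b / K))

lemma profile_tri {K : ℝ} (hK : 1 ≤ K) : Profile ((K ^ 3)⁻¹) (tri K) where
  nonneg b := by unfold tri; positivity
  le_one b := by
    unfold tri
    refine mul_le_one₀ (inv_le_one_of_one_le₀ (one_le_pow₀ hK)) (by positivity) ?_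
    exact max_le zero_le_one (min_le_left _ _)
  lip_nonneg := by positivity
  lip b b' := by
    unfold tri
    have h1 : |max 0 (min 1 (1 - b / K)) - max 0 (min 1 (1 - b' / K))| ≤ |b - b'| / K := by
      have h2 := abs_max_sub_max_le_max (0 : ℝ) (min 1 (1 - b / K)) 0 (min 1 (1 - b' / K))
      have h3 := abs_min_sub_min_le_max (1 : ℝ) (1 - b / K) 1 (1 - b' / K)
      have h4 : |1 - b / K - (1 - b' / K)| = |b - b'| / K := by
        rw [show 1 - b / K - (1 - b' / K) = -((b - b') / K) by ring, abs_neg, abs_div,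
          abs_of_pos (by linarith : 0 < K)]
      have h5 : 0 ≤ |b - b'| / K := by positivity
      rw [sub_self, abs_zero] at h2
      rw [sub_self, abs_zero, h4, max_eq_right h5] at h3
      exact h2.trans (max_le h5 h3)
    rw [← mul_sub, abs_mul, abs_of_pos (by positivity : 0 < (K ^ 2)⁻¹)]
    calc _ ≤ (K ^ 2)⁻¹ * (|b - b'| / K) := by gcongr
      _ = _ := by field_simp
  decay b hb := by
    unfold tri
    rcases le_or_gt b K with h | h
    · have h1 : max 0 (min 1 (1 - b / K)) ≤ 1 := max_le zero_le_one (min_le_left _ _)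
      calc _ ≤ (K ^ 2)⁻¹ * 1 * K ^ 2 := by gcongr
        _ = 1 := by field_simp
    · have : max 0 (min 1 (1 - b / K)) = 0 := by
        refine max_eq_left ((min_le_right _ _).trans ?_)
        rw [sub_nonpos, one_le_div (by linarith)]; exact h.le
      rw [this]; simp

lemma EnvLaw.exists_tri_lower (hρ : EnvLaw ρ κ χ M) (hM : 0 ≤ M) : ∃ K ≥ 1, ∃ c > 0,
    ∀ᶠ n in atTop, c * ww n ≤ (stp ρ 1 1)^[n] (prof 1 (tri K)) 0 0 := by
  obtain ⟨C, hC, hfr⟩ := hρ.exists_freeze_le hM one_pos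
  obtain ⟨c, hc, hlow⟩ := hρ.step.barrier_lower
  set t := ∑' k, ww (k + 0) with ht
  have ht0 : 0 ≤ t := tsum_nonneg fun k => (ww_pos _).le
  obtain ⟨e, he⟩ : ∃ e, e = c * Real.exp (-2) := ⟨_, rfl⟩
  have he0 : 0 < e := by rw [he]; positivity
  set K := 1 + 2 * (C * t) / e with hK
  have hK1 : 1 ≤ K := by rw [hK]; have : 0 ≤ 2 * (C * t) / e := by positivity
                         linarith
  refine ⟨K, hK1, (K ^ 2)⁻¹ * e / 2, by positivity, ?_⟩
  filter_upwards [hlow 1 zero_le_one] with n hn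
  have hw := ww_pos n
  have hp := profile_tri hK1
  have h1 := hfr (hp.adm_prof 1) (hp.lipW_prof 1) hp.lip_nonneg 0 n
  rw [← ht] at h1
  simp only [Function.iterate_zero, id_eq, zero_add, add_zero] at h1
  have h2 : (K ^ 2)⁻¹ * e * ww n ≤ (stp ρ 1 0)^[n] (prof 1 (tri K)) 0 0 := by
    rw [stp_zero_iter_eq (hp.adm_prof 1)]
    have h3 : ∫ y, (Ico (-2 : ℝ) (-1)).indicator (fun _ => (K ^ 2)⁻¹ * Real.exp (-2)) y
        ∂(kill (ρ.map Prod.fst) (Iio (1 - 0)) n)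
        ≤ ∫ y, prof 1 (tri K) (0 + y) 0 ∂(kill (ρ.map Prod.fst) (Iio (1 - 0)) n) := by
      refine integral_mono_of_nonneg (ae_of_all _ fun y => indicator_nonneg
        (fun _ _ => by positivity) _) ?_ (ae_of_all _ fun y => ?_)
      · refine Integrable.of_bound (C := Real.exp 1) ?_
          (ae_of_all _ fun y => (hp.adm_prof 1).bdd _ _)
        exact ((hp.adm_prof 1).meas.comp (f := fun y : ℝ => (0 + y, (0 : ℝ)))
          (by fun_prop)).aestronglyMeasurable
      · refine indicator_le' (fun y hy => ?_) (fun y _ => hp.prof_nonneg _ _ _) y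
        have hy1 : y < 1 := hy.2.trans (by norm_num)
        have : tri K 0 = (K ^ 2)⁻¹ := by simp [tri]
        rw [prof, ex, zero_add, if_pos hy1, this, mul_comm]
        gcongr
        exact hy.1
    rw [integral_indicator_const _ measurableSet_Ico, smul_eq_mul, sub_zero] at h3
    rw [sub_zero]
    refine le_trans ?_ h3
    calc _ = c * ww n * ((K ^ 2)⁻¹ * Real.exp (-2)) := by rw [he]; ring
      _ ≤ _ := by gcongr
  have h4 : (K ^ 3)⁻¹ * C * t * ww n ≤ (K ^ 2)⁻¹ * e / 2 * ww n := by
    have h5 : C * t ≤ K * (e / 2) := by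
      have : 2 * (C * t) / e * (e / 2) = C * t := by field_simp
      rw [hK, add_mul, this]
      have : 0 ≤ 1 * (e / 2) := by positivity
      linarith
    have h6 : (K ^ 3)⁻¹ * C * t ≤ (K ^ 2)⁻¹ * e / 2 := by
      calc (K ^ 3)⁻¹ * C * t = (K ^ 3)⁻¹ * (C * t) := by ring
        _ ≤ (K ^ 3)⁻¹ * (K * (e / 2)) := by gcongr
        _ = _ := by field_simp
    gcongr
  have := (abs_le.1 h1).2
  nlinarith [this, h2, h4]

lemma Profile.exists_lower (hρ : EnvLaw ρ κ χ M) (hM : 0 ≤ M) (hh : Profile L h)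
    (hpos : ∀ b, 0 < b → 0 < h b) :
    ∃ c > 0, ∀ᶠ n in atTop, c * ww n ≤ (stp ρ 1 1)^[n] (prof 1 h) 0 0 := by
  obtain ⟨K, hK, c, hc, hlow⟩ := hρ.exists_tri_lower hM
  have hp := profile_tri hK
  have hχ := hρ.pos
  set β := χ * Real.exp (-κ) with hβ
  have hβ0 : 0 < β := by positivity
  obtain ⟨c', hc', hcmp⟩ : ∃ c' > 0, ∀ b, β ≤ b → c' * tri K b ≤ h b := by
    rcases le_or_gt β K with hbK | hbK
    · obtain ⟨z, hz, hmin⟩ := isCompact_Icc.exists_isMinOn (nonempty_Icc.2 hbK)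
        hh.continuous.continuousOn
      refine ⟨h z, hpos z (hβ0.trans_le hz.1), fun b hb => ?_⟩
      rcases le_or_gt b K with h1 | h1
      · exact (mul_le_of_le_one_right (hh.nonneg z) (hp.le_one b)).trans (hmin ⟨hb, h1⟩)
      · have : max 0 (min 1 (1 - b / K)) = 0 := by
          refine max_eq_left ((min_le_right _ _).trans ?_)
          rw [sub_nonpos, one_le_div (by linarith)]; exact h1.le
        rw [tri, this]; simpa using hh.nonneg b
    · refine ⟨1, one_pos, fun b hb => ?_⟩
      have : max 0 (min 1 (1 - b / K)) = 0 := by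
        refine max_eq_left ((min_le_right _ _).trans ?_)
        rw [sub_nonpos, one_le_div (by linarith)]; linarith
      rw [tri, this]; simpa using hh.nonneg b
  have hadm : ∀ n, Adm (|c'| * Real.exp 1)
      (fun s b => c' * (stp ρ 1 1)^[n] (prof 1 (tri K)) s b) := fun n =>
    ⟨((hp.adm_prof 1).iter n).meas.const_mul c', fun s b => by
      rw [abs_mul]
      exact mul_le_mul_of_nonneg_left (((hp.adm_prof 1).iter n).bdd s b) (abs_nonneg _)⟩
  have hstp : ∀ n s b, c' * (stp ρ 1 1)^[n + 1] (prof 1 (tri K)) s b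
      = stp ρ 1 1 (fun s b => c' * (stp ρ 1 1)^[n] (prof 1 (tri K)) s b) s b := by
    intro n s b
    rw [Function.iterate_succ_apply', stp, stp, ← integral_const_mul]
    congr 1; ext p; split_ifs <;> simp
  have hiter : ∀ n s b, β ≤ b → c' * (stp ρ 1 1)^[n] (prof 1 (tri K)) s b
      ≤ (stp ρ 1 1)^[n] (prof 1 h) s b := by
    intro n
    induction n with
    | zero =>
      intro s b hb
      simp only [Function.iterate_zero, id_eq, prof]
      have := hcmp b hb
      have := ex_nonneg 1 s
      calc _ = ex 1 s * (c' * tri K b) := by ring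
        _ ≤ _ := by gcongr
    | succ n ih =>
      intro s b hb
      rw [hstp, Function.iterate_succ_apply']
      refine stp_le_stp (hadm n) ((hh.adm_prof 1).iter n) ?_
      filter_upwards [hρ.ae_mem] with p hp
      split_ifs
      · refine ih _ _ (hb.trans ?_)
        have := hχ.le.trans hp.2.1
        have : 0 ≤ 1 * (p.2 * Real.exp (s + p.1)) := by positivity
        linarith
      · exact le_rfl
  refine ⟨c' * c, by positivity, ?_⟩
  filter_upwards [hlow, eventually_ge_atTop 1] with n hn hn1
  obtain ⟨n, rfl⟩ := Nat.exists_eq_add_of_le' hn1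
  rw [mul_assoc]
  refine (mul_le_mul_of_nonneg_left hn hc'.le).trans ?_
  rw [hstp, Function.iterate_succ_apply']
  refine stp_le_stp (hadm n) ((hh.adm_prof 1).iter n) ?_
  filter_upwards [hρ.ae_mem] with p hp
  split_ifs
  · refine hiter n _ _ ?_
    rw [hβ, zero_add, zero_add, one_mul]
    have := hχ.le.trans hp.2.1
    gcongr
    · exact hp.2.1
    · exact hp.1
  · exact le_rfl

end Barrier

section Unbarriered

open scoped ENNReal

/-- One step, with law `ρ` of the pair `(X, η)`, of the chain `(s, b) ↦ (s + X, b + η e^{s + X})`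
without barrier, acting on nonnegative functions. -/
def tinf (ρ : Measure (ℝ × ℝ)) (g : ℝ → ℝ → ℝ≥0∞) (s b : ℝ) : ℝ≥0∞ :=
  ∫⁻ p, g (s + p.1) (b + p.2 * Real.exp (s + p.1)) ∂ρ

/-- The function `e^s h(b)` as an extended nonnegative real. -/
def eprof (h : ℝ → ℝ) (s b : ℝ) : ℝ≥0∞ := ENNReal.ofReal (Real.exp s * h b)

variable {ρ : Measure (ℝ × ℝ)} [IsProbabilityMeasure ρ] {κ χ M L : ℝ} {h : ℝ → ℝ}

lemma Profile.iSup_ite (hh : Profile L h) (n : ℕ) (s b : ℝ) :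
    ⨆ N : ℕ, ENNReal.ofReal (if s < (N : ℝ) + 1 then
      (stp ρ (N + 1) 1)^[n] (prof (N + 1) h) s b else 0)
      = ⨆ N : ℕ, ENNReal.ofReal ((stp ρ (N + 1) 1)^[n] (prof (N + 1) h) s b) := by
  refine le_antisymm (iSup_mono fun N => ENNReal.ofReal_le_ofReal ?_) (iSup_le fun N => ?_)
  · split_ifs
    · exact le_rfl
    · exact hh.iter_nonneg _ _ _ _ _
  · obtain ⟨K, hK⟩ := exists_nat_gt s
    refine le_iSup_of_le (max N K) (ENNReal.ofReal_le_ofReal ?_)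
    have h1 : (N : ℝ) ≤ (max N K : ℕ) := by exact_mod_cast le_max_left N K
    have h2 : (K : ℝ) ≤ (max N K : ℕ) := by exact_mod_cast le_max_right N K
    rw [if_pos (by linarith)]
    exact hh.iter_mono (by linarith) n s b

lemma Profile.tinf_iter (hh : Profile L h) (n : ℕ) (s b : ℝ) :
    (tinf ρ)^[n] (eprof h) s b
      = ⨆ N : ℕ, ENNReal.ofReal ((stp ρ (N + 1) 1)^[n] (prof (N + 1) h) s b) := by
  induction n generalizing s b with
  | zero =>
    refine le_antisymm ?_ (iSup_le fun N => ENNReal.ofReal_le_ofReal ?_)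
    · obtain ⟨K, hK⟩ := exists_nat_gt s
      refine le_iSup_of_le K (le_of_eq ?_)
      simp [eprof, prof, ex, show s < (K : ℝ) + 1 by linarith]
    · refine mul_le_mul_of_nonneg_right ?_ (hh.nonneg b)
      unfold ex; split_ifs
      · exact le_rfl
      · positivity
  | succ n ih =>
    simp_rw [Function.iterate_succ_apply']
    have hm (N : ℕ) := ((hh.adm_prof ((N : ℝ) + 1)).iter (ρ := ρ) (x := (N : ℝ) + 1) (θ := 1) n)
    calc tinf ρ ((tinf ρ)^[n] (eprof h)) s b
        = ∫⁻ p, ⨆ N : ℕ, ENNReal.ofReal (if s + p.1 < (N : ℝ) + 1 then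
            (stp ρ (N + 1) 1)^[n] (prof (N + 1) h) (s + p.1)
              (b + 1 * (p.2 * Real.exp (s + p.1))) else 0) ∂ρ := by
          unfold tinf
          refine lintegral_congr fun p => ?_
          rw [hh.iSup_ite, one_mul]
          exact ih _ _
      _ = ⨆ N : ℕ, ∫⁻ p, ENNReal.ofReal (if s + p.1 < (N : ℝ) + 1 then
            (stp ρ (N + 1) 1)^[n] (prof (N + 1) h) (s + p.1)
              (b + 1 * (p.2 * Real.exp (s + p.1))) else 0) ∂ρ := by
          refine lintegral_iSup (fun N => ?_) fun N K hNK p => ENNReal.ofReal_le_ofReal ?_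
          · exact ENNReal.measurable_ofReal.comp ((stp_measurable_integrand (hm N).meas).comp
              (f := fun p : ℝ × ℝ => ((s, b), p)) (by fun_prop))
          · have h1 : (N : ℝ) ≤ K := by exact_mod_cast hNK
            by_cases hp : s + p.1 < (N : ℝ) + 1
            · rw [if_pos hp, if_pos (by linarith)]
              exact hh.iter_mono (by linarith) _ _ _
            · rw [if_neg hp]
              split_ifs
              · exact hh.iter_nonneg _ _ _ _ _
              · exact le_rfl
      _ = _ := by
          refine iSup_congr fun N => ?_
          rw [← ofReal_integral_eq_lintegral_ofReal ((hm N).integrable s b)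
            (ae_of_all _ fun p => ?_)]
          · rfl
          · simp only [Pi.zero_apply]
            split_ifs
            · exact hh.iter_nonneg _ _ _ _ _
            · exact le_rfl

lemma EnvLaw.exists_tinf_le (hρ : EnvLaw ρ κ χ M) :
    ∃ τ : ℕ → ℝ, Tendsto τ atTop (𝓝 0) ∧ (∀ J, 0 ≤ τ J) ∧
      ∀ {h : ℝ → ℝ} {L : ℝ}, Profile L h → ∀ J n : ℕ, (tinf ρ)^[n] (eprof h) 0 0 ≤
      ENNReal.ofReal ((stp ρ (J + 1) 1)^[n] (prof (J + 1) h) 0 0 + τ J * ww n) := by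
  obtain ⟨δ, hδ, hδ0, hle⟩ := hρ.exists_iter_le_add
  refine ⟨fun J => ∑' j, δ (j + J), tendsto_sum_nat_add δ, fun J => tsum_nonneg fun j => hδ0 _,
    fun {h L} hh J n => ?_⟩
  rw [hh.tinf_iter]
  refine iSup_le fun N => ENNReal.ofReal_le_ofReal ?_
  have h0 : 0 ≤ (∑' j, δ (j + J)) * ww n := mul_nonneg (tsum_nonneg fun j => hδ0 _) (ww_pos n).le
  rcases le_total N J with hN | hN
  · have h1 : (N : ℝ) + 1 ≤ J + 1 := by
      have : (N : ℝ) ≤ J := by exact_mod_cast hN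
      linarith
    have := hh.iter_mono (ρ := ρ) h1 n 0 0
    linarith
  · obtain ⟨k, rfl⟩ := Nat.exists_eq_add_of_le hN
    exact hle hh J k n

lemma Profile.ofReal_le_tinf (hh : Profile L h) (J n : ℕ) :
    ENNReal.ofReal ((stp ρ (J + 1) 1)^[n] (prof (J + 1) h) 0 0) ≤ (tinf ρ)^[n] (eprof h) 0 0 := by
  rw [hh.tinf_iter]
  exact le_iSup (fun N : ℕ => ENNReal.ofReal ((stp ρ (N + 1) 1)^[n] (prof (N + 1) h) 0 0)) J

lemma EnvLaw.tinf_ne_top (hρ : EnvLaw ρ κ χ M) (hh : Profile L h) (n : ℕ) :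
    (tinf ρ)^[n] (eprof h) 0 0 ≠ ∞ := by
  obtain ⟨τ, -, -, hle⟩ := hρ.exists_tinf_le
  exact ne_top_of_le_ne_top ENNReal.ofReal_ne_top (hle hh 0 n)

lemma EnvLaw.tinf_tendsto (hρ : EnvLaw ρ κ χ M) (hM : 0 ≤ M) (hh : Profile L h) :
    ∃ l, Tendsto (fun n => (ww n)⁻¹ * ((tinf ρ)^[n] (eprof h) 0 0).toReal) atTop (𝓝 l) := by
  obtain ⟨τ, hτ, hτ0, hle⟩ := hρ.exists_tinf_le
  refine exists_tendsto_of_approx fun ε hε => ?_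
  obtain ⟨J, hJ⟩ := (hτ.eventually (gt_mem_nhds hε)).exists
  refine ⟨_, hρ.barrier_tendsto hM hh (x := (J : ℝ) + 1) (by positivity), Eventually.of_forall
    fun n => ?_⟩
  have hw := ww_pos n
  have h0 := hh.iter_nonneg (ρ := ρ) ((J : ℝ) + 1) 1 n 0 0
  have hfin := hρ.tinf_ne_top hh n
  have h1 := (ENNReal.ofReal_le_iff_le_toReal hfin).1 (hh.ofReal_le_tinf (ρ := ρ) J n)
  have h2 : ((tinf ρ)^[n] (eprof h) 0 0).toReal ≤
      (stp ρ (J + 1) 1)^[n] (prof (J + 1) h) 0 0 + τ J * ww n :=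
    ENNReal.toReal_le_of_le_ofReal (add_nonneg h0 (mul_nonneg (hτ0 J) hw.le)) (hle hh J n)
  rw [← mul_sub, abs_mul, abs_of_pos (inv_pos.2 hw), abs_of_nonneg (by linarith),
    inv_mul_le_iff₀ hw]
  nlinarith

lemma EnvLaw.exists_tinf_le_ww (hρ : EnvLaw ρ κ χ M) : ∃ C, 0 ≤ C ∧
    ∀ {h : ℝ → ℝ} {L : ℝ}, Profile L h → ∀ n : ℕ,
      ((tinf ρ)^[n] (eprof h) 0 0).toReal ≤ C * ww n := by
  obtain ⟨τ, -, hτ0, hle⟩ := hρ.exists_tinf_le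
  obtain ⟨C, hC, hb⟩ := hρ.step.exists_kop_ex_le
  have hτ := hτ0 0
  refine ⟨C * Real.exp 1 * wgt 1 ^ 4 + τ 0, by have := wgt_pos 1; positivity,
    fun {h L} hh n => ?_⟩
  have hw := ww_pos n
  have h1 : (stp ρ 1 1)^[n] (prof 1 h) 0 0 ≤ C * Real.exp 1 * wgt 1 ^ 4 * ww n := by
    have := hb 1 0 one_pos n
    rw [sub_zero] at this
    exact (le_abs_self _).trans
      ((stp_iter_abs_le (adm_ex 1) (hh.prof_abs_le 1) n 0 0).trans this)
  refine ENNReal.toReal_le_of_le_ofReal (by have := wgt_pos 1; positivity) ((hle hh 0 n).trans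
    (ENNReal.ofReal_le_ofReal ?_))
  simp only [Nat.cast_zero, zero_add]
  linarith

lemma EnvLaw.tinf_lower (hρ : EnvLaw ρ κ χ M) (hM : 0 ≤ M) (hh : Profile L h)
    (hpos : ∀ b, 0 < b → 0 < h b) {l : ℝ}
    (hl : Tendsto (fun n => (ww n)⁻¹ * ((tinf ρ)^[n] (eprof h) 0 0).toReal) atTop (𝓝 l)) :
    0 < l := by
  obtain ⟨c, hc, hlow⟩ := hh.exists_lower hρ hM hpos
  refine hc.trans_le (ge_of_tendsto hl ?_)
  filter_upwards [hlow] with n hn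
  have hw := ww_pos n
  have h1 := (ENNReal.ofReal_le_iff_le_toReal (hρ.tinf_ne_top hh n)).1
    (hh.ofReal_le_tinf (ρ := ρ) 0 n)
  simp only [Nat.cast_zero, zero_add] at h1
  rw [le_inv_mul_iff₀ hw]
  linarith

end Unbarriered

/-- The function `b^k / (1 + b)^(k + 2)`, extended to negative `b` by its value at `0`. -/
def geo (k : ℕ) (b : ℝ) : ℝ := (1 - (1 + max b 0)⁻¹) ^ k * (1 + max b 0)⁻¹ ^ 2

lemma inv_one_add_max_mem (b : ℝ) : 0 < (1 + max b 0)⁻¹ ∧ (1 + max b 0)⁻¹ ≤ 1 := by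
  have h : 0 ≤ max b 0 := le_max_right _ _
  exact ⟨by positivity, inv_le_one_of_one_le₀ (by linarith)⟩

lemma abs_inv_one_add_max_sub_le (b b' : ℝ) :
    |(1 + max b 0)⁻¹ - (1 + max b' 0)⁻¹| ≤ |b - b'| := by
  have h : 0 ≤ max b 0 := le_max_right _ _
  have h' : 0 ≤ max b' 0 := le_max_right _ _
  rw [inv_sub_inv (by positivity) (by positivity), abs_div,
    abs_of_pos (by positivity : 0 < (1 + max b 0) * (1 + max b' 0))]
  refine (div_le_self (abs_nonneg _) (by nlinarith)).trans ?_
  have := abs_max_sub_max_le_abs b' b 0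
  rw [show 1 + max b' 0 - (1 + max b 0) = max b' 0 - max b 0 by ring, abs_sub_comm b]
  exact this

lemma abs_pow_sub_pow_le_of_mem {x y : ℝ} (hx : 0 ≤ x) (hx1 : x ≤ 1) (hy : 0 ≤ y) (hy1 : y ≤ 1)
    (k : ℕ) : |x ^ k - y ^ k| ≤ k * |x - y| := by
  induction k with
  | zero => simp
  | succ k ih =>
    have h1 : x ^ (k + 1) - y ^ (k + 1) = x * (x ^ k - y ^ k) + (x - y) * y ^ k := by ring
    rw [h1]
    refine (abs_add_le _ _).trans ?_
    rw [abs_mul, abs_mul, abs_of_nonneg hx, abs_of_nonneg (pow_nonneg hy k)]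
    have h2 : x * |x ^ k - y ^ k| ≤ 1 * (k * |x - y|) := by gcongr
    have h3 : |x - y| * y ^ k ≤ |x - y| * 1 := by gcongr; exact pow_le_one₀ hy hy1
    push_cast
    linarith

lemma profile_geo (k : ℕ) : Profile (k + 2) (geo k) where
  nonneg b := by
    obtain ⟨h0, h1⟩ := inv_one_add_max_mem b
    have : 0 ≤ 1 - (1 + max b 0)⁻¹ := by linarith
    unfold geo; positivity
  le_one b := by
    obtain ⟨h0, h1⟩ := inv_one_add_max_mem b
    exact mul_le_one₀ (pow_le_one₀ (by linarith) (by linarith)) (by positivity)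
      (pow_le_one₀ h0.le h1)
  lip_nonneg := by positivity
  lip b b' := by
    unfold geo
    obtain ⟨h0, h1⟩ := inv_one_add_max_mem b
    obtain ⟨h0', h1'⟩ := inv_one_add_max_mem b'
    have h2 := abs_inv_one_add_max_sub_le b b'
    generalize (1 + max b 0)⁻¹ = u at *
    generalize (1 + max b' 0)⁻¹ = v at *
    have e : (1 - u) ^ k * u ^ 2 - (1 - v) ^ k * v ^ 2
        = (1 - u) ^ k * (u ^ 2 - v ^ 2) + ((1 - u) ^ k - (1 - v) ^ k) * v ^ 2 := by ring
    have h3 := abs_pow_sub_pow_le_of_mem h0.le h1 h0'.le h1' 2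
    have h4 := abs_pow_sub_pow_le_of_mem (x := 1 - u) (y := 1 - v) (by linarith) (by linarith)
      (by linarith) (by linarith) k
    rw [show 1 - u - (1 - v) = -(u - v) by ring, abs_neg] at h4
    rw [e]
    refine (abs_add_le _ _).trans ?_
    have h5 : 0 ≤ (1 - u) ^ k := pow_nonneg (by linarith) k
    rw [abs_mul, abs_mul, abs_of_nonneg h5, abs_of_nonneg (sq_nonneg v)]
    have h6 : (1 - u) ^ k ≤ 1 := pow_le_one₀ (by linarith) (by linarith)
    have h7 : v ^ 2 ≤ 1 := pow_le_one₀ h0'.le h1'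
    calc _ ≤ 1 * (2 * |b - b'|) + (k * |b - b'|) * 1 := by
          gcongr
          · exact h3.trans (by push_cast; gcongr)
          · exact h4.trans (by gcongr)
      _ = _ := by ring
  decay b hb := by
    unfold geo
    obtain ⟨h0, h1⟩ := inv_one_add_max_mem b
    have h2 : (1 + max b 0)⁻¹ * b ≤ 1 := by
      rw [max_eq_left hb.le, inv_mul_le_iff₀ (by positivity)]; linarith
    generalize (1 + max b 0)⁻¹ = u at *
    have h6 : (1 - u) ^ k ≤ 1 := pow_le_one₀ (by linarith) (by linarith)
    have h7 : (u * b) ^ 2 ≤ 1 := pow_le_one₀ (by positivity) h2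
    calc _ = (1 - u) ^ k * (u * b) ^ 2 := by ring
      _ ≤ 1 := mul_le_one₀ h6 (by positivity) h7

lemma geo_pos (k : ℕ) (b : ℝ) (hb : 0 < b) : 0 < geo k b := by
  unfold geo
  rw [max_eq_left hb.le]
  have h : (1 + b)⁻¹ < 1 := inv_lt_one_of_one_lt₀ (by linarith)
  have h' : 0 < 1 - (1 + b)⁻¹ := by linarith
  positivity

lemma hasSum_geo {b s : ℝ} (hb : 0 ≤ b) (hs : 0 ≤ s) (hs1 : s < 1) :
    HasSum (fun k => geo k b * s ^ (k + 1)) ((1 + b)⁻¹ - (1 - s) / (1 + b * (1 - s))) := by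
  have h1 : (1 - (1 + b)⁻¹) * s < 1 := by
    have h3 : (0 : ℝ) < (1 + b)⁻¹ := by positivity
    nlinarith
  have h2 : 0 ≤ (1 - (1 + b)⁻¹) * s := by
    have h3 : (1 + b)⁻¹ ≤ 1 := inv_le_one_of_one_le₀ (by linarith)
    exact mul_nonneg (by linarith) hs
  have h3 := (hasSum_geometric_of_lt_one h2 h1).mul_left ((1 + b)⁻¹ ^ 2 * s)
  have e1 : ∀ k, geo k b * s ^ (k + 1) = (1 + b)⁻¹ ^ 2 * s * ((1 - (1 + b)⁻¹) * s) ^ k :=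
    fun k => by rw [geo, max_eq_left hb, mul_pow]; ring
  have e2 : (1 + b)⁻¹ - (1 - s) / (1 + b * (1 - s))
      = (1 + b)⁻¹ ^ 2 * s * (1 - (1 - (1 + b)⁻¹) * s)⁻¹ := by
    have h4 : 0 < 1 + b * (1 - s) := by nlinarith [mul_nonneg hb (sub_nonneg.2 hs1.le)]
    have h5 : 1 - (1 - (1 + b)⁻¹) * s = (1 + b * (1 - s)) / (1 + b) := by field_simp; ring
    rw [h5]
    field_simp
    ring
  simp_rw [e1, e2]
  exact h3

/-- A power series with bounded coefficients vanishing on `(0, 1)` is zero. -/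
lemma coeff_eq_zero_of_tsum_eq_zero {a : ℕ → ℝ} {C : ℝ} (hC : ∀ k, |a k| ≤ C)
    (h : ∀ s, 0 < s → s < 1 → ∑' k, a k * s ^ k = 0) (k : ℕ) : a k = 0 := by
  have hsum (a : ℕ → ℝ) (hC : ∀ k, |a k| ≤ C) (s : ℝ) (hs : 0 < s) (hs1 : s < 1) :
      Summable (fun k => a k * s ^ k) ∧ |∑' k, a k * s ^ k| ≤ C * (1 - s)⁻¹ := by
    have h1 := (hasSum_geometric_of_lt_one hs.le hs1).mul_left C
    have h2 : ∀ k, ‖a k * s ^ k‖ ≤ C * s ^ k := fun k => by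
      rw [norm_mul, Real.norm_eq_abs, norm_pow, Real.norm_of_nonneg hs.le]
      gcongr; exact hC k
    exact ⟨Summable.of_norm_bounded h1.summable h2, tsum_of_norm_bounded h1 h2⟩
  have hstep (a : ℕ → ℝ) (hC : ∀ k, |a k| ≤ C)
      (h : ∀ s, 0 < s → s < 1 → ∑' k, a k * s ^ k = 0) :
      a 0 = 0 ∧ ∀ s, 0 < s → s < 1 → ∑' k, a (k + 1) * s ^ k = 0 := by
    have h1 : ∀ s, 0 < s → s < 1 → a 0 + s * ∑' k, a (k + 1) * s ^ k = 0 := fun s hs hs1 => by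
      rw [← h s hs hs1, (hsum a hC s hs hs1).1.tsum_eq_zero_add, ← tsum_mul_left]
      simp only [pow_zero, mul_one, add_right_inj]
      exact tsum_congr fun k => by ring
    have h0 : a 0 = 0 := by
      have h2 : ∀ᶠ s : ℝ in 𝓝[>] 0, |a 0| ≤ s * (C * (1 - s)⁻¹) := by
        filter_upwards [Ioo_mem_nhdsGT (one_pos : (0 : ℝ) < 1)] with s hs
        have h3 := (hsum (fun k => a (k + 1)) (fun k => hC _) s hs.1 hs.2).2
        rw [eq_neg_of_add_eq_zero_left (h1 s hs.1 hs.2), abs_neg, abs_mul, abs_of_pos hs.1]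
        exact mul_le_mul_of_nonneg_left h3 hs.1.le
      have h4 : Tendsto (fun s : ℝ => s * (C * (1 - s)⁻¹)) (𝓝[>] 0) (𝓝 (0 * (C * (1 - 0)⁻¹))) := by
        refine Tendsto.mono_left (ContinuousAt.tendsto ?_) nhdsWithin_le_nhds
        exact continuousAt_id.mul (continuousAt_const.mul
          ((continuousAt_const.sub continuousAt_id).inv₀ (by norm_num)))
      rw [zero_mul] at h4
      exact abs_nonpos_iff.1 (ge_of_tendsto h4 h2)
    refine ⟨h0, fun s hs hs1 => ?_⟩
    have := h1 s hs hs1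
    rw [h0, zero_add] at this
    exact (mul_eq_zero.1 this).resolve_left hs.ne'
  induction k generalizing a with
  | zero => exact (hstep a hC h).1
  | succ k ih => exact ih (a := fun k => a (k + 1)) (fun k => hC _) (hstep a hC h).2

section Environment

open scoped ENNReal

variable {Ω : Type*} {Q : ℕ → Ω → Measure ℕ}

/-- The generating function of a measure on `ℕ`, in a form that is measurable in the measure. -/
def egen (s : ℝ) (ν : Measure ℕ) : ℝ := (∑' i : ℕ, ν {i} * ENNReal.ofReal (s ^ i)).toReal

lemma measurable_egen (s : ℝ) : Measurable (egen s) := by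
  refine ENNReal.measurable_toReal.comp (Measurable.tsum fun i => ?_)
  exact (Measure.measurable_coe (measurableSet_singleton i)).mul_const _

lemma egen_eq_pgf (hQ : ∀ n ω, IsProbabilityMeasure (Q n ω)) (n : ℕ) (ω : Ω) {s : ℝ}
    (hs : 0 ≤ s) : egen s (Q n ω) = pgf Q n ω s := by
  have := hQ n ω
  unfold egen pgf
  rw [ENNReal.tsum_toReal_eq fun i => ENNReal.mul_ne_top (measure_ne_top _ _)
    ENNReal.ofReal_ne_top]
  exact tsum_congr fun i => by rw [ENNReal.toReal_mul, ENNReal.toReal_ofReal (by positivity)]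

/-- The triple `(X, η, f(0))` as a function of a fractional-linear offspring law. -/
def envPar (ν : Measure ℕ) : ℝ × ℝ × ℝ :=
  (-Real.log ((1 - egen (1 / 2) ν)⁻¹ - (1 - egen 0 ν)⁻¹),
    2 * (1 - egen 0 ν)⁻¹ - (1 - egen (1 / 2) ν)⁻¹, egen 0 ν)

lemma measurable_envPar : Measurable envPar := by
  have h0 := measurable_egen 0
  have h1 := measurable_egen (1 / 2)
  refine Measurable.prodMk ?_ (Measurable.prodMk ?_ h0)
  · exact (Real.measurable_log.comp (((h1.const_sub 1).inv).sub ((h0.const_sub 1).inv))).neg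
  · exact ((h0.const_sub 1).inv.const_mul 2).sub (h1.const_sub 1).inv

lemma envPar_eq (hQ : ∀ n ω, IsProbabilityMeasure (Q n ω)) (hf : FracLinear Q) {n : ℕ}
    (hn : 1 ≤ n) (ω : Ω) : envPar (Q n ω) = (Xenv Q n ω, etaEnv Q n ω, pgf Q n ω 0) := by
  have h0 := hf n hn ω 0 le_rfl one_pos
  have h1 := hf n hn ω (1 / 2) (by norm_num) (by norm_num)
  unfold envPar
  rw [egen_eq_pgf hQ n ω le_rfl, egen_eq_pgf hQ n ω (by norm_num), h0, h1]
  refine Prod.ext ?_ (Prod.ext ?_ rfl)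
  · simp only
    rw [show Real.exp (-Xenv Q n ω) / (1 - 1 / 2) + etaEnv Q n ω
      - (Real.exp (-Xenv Q n ω) / (1 - 0) + etaEnv Q n ω) = Real.exp (-Xenv Q n ω) by ring,
      Real.log_exp, neg_neg]
  · simp only
    ring

lemma etaEnv_nonneg (Q : ℕ → Ω → Measure ℕ) (n : ℕ) (ω : Ω) : 0 ≤ etaEnv Q n ω := by
  refine div_nonneg (tsum_nonneg fun i => mul_nonneg ?_ ENNReal.toReal_nonneg) (by positivity)
  rcases Nat.eq_zero_or_pos i with rfl | hi
  · simp
  · have : (1 : ℝ) ≤ i := by exact_mod_cast hi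
    exact mul_nonneg (by linarith) (by linarith)

lemma pgf_nonneg (Q : ℕ → Ω → Measure ℕ) (n : ℕ) (ω : Ω) {s : ℝ} (hs : 0 ≤ s) :
    0 ≤ pgf Q n ω s :=
  tsum_nonneg fun i => mul_nonneg ENNReal.toReal_nonneg (pow_nonneg hs i)

lemma FracLinear.pgf_lt_one (hf : FracLinear Q) {n : ℕ} (hn : 1 ≤ n) (ω : Ω) {s : ℝ} (hs : 0 ≤ s)
    (hs1 : s < 1) : pgf Q n ω s < 1 := by
  have h1 := hf n hn ω s hs hs1
  have h2 := etaEnv_nonneg Q n ω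
  have h3 : 0 < Real.exp (-Xenv Q n ω) / (1 - s) := div_pos (Real.exp_pos _) (by linarith)
  have h4 : 0 < 1 - pgf Q n ω s := inv_pos.1 (by rw [h1]; linarith)
  linarith

/-- The pair `(S_n, e^{S_n} b_n)`. -/
def revPair (Q : ℕ → Ω → Measure ℕ) : ℕ → Ω → ℝ × ℝ
  | 0, _ => (0, 0)
  | n + 1, ω => ((revPair Q n ω).1 + Xenv Q (n + 1) ω,
      Real.exp (Xenv Q (n + 1) ω) * ((revPair Q n ω).2 + etaEnv Q (n + 1) ω))

lemma revPair_nonneg (Q : ℕ → Ω → Measure ℕ) (n : ℕ) (ω : Ω) : 0 ≤ (revPair Q n ω).2 := by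
  induction n with
  | zero => exact le_rfl
  | succ n ih => exact mul_nonneg (Real.exp_nonneg _) (add_nonneg ih (etaEnv_nonneg Q _ ω))

lemma FracLinear.inv_pgfComp (hf : FracLinear Q) (n : ℕ) (ω : Ω) {s : ℝ} (hs : 0 ≤ s)
    (hs1 : s < 1) : (1 - pgfComp Q 0 n ω s)⁻¹
      = Real.exp (-(revPair Q n ω).1) * ((1 - s)⁻¹ + (revPair Q n ω).2) ∧
      0 ≤ pgfComp Q 0 n ω s := by
  induction n generalizing s with
  | zero => simp [pgfComp, revPair, hs]
  | succ n ih =>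
    have h1 : pgfComp Q 0 (n + 1) ω s = pgfComp Q 0 n ω (pgf Q (n + 1) ω s) := by
      simp [pgfComp]
    have h2 := ih (pgf_nonneg Q (n + 1) ω hs) (hf.pgf_lt_one (by omega) ω hs hs1)
    rw [h1]
    refine ⟨?_, h2.2⟩
    rw [h2.1, hf (n + 1) (by omega) ω s hs hs1]
    simp only [revPair]
    rw [neg_add, Real.exp_add, Real.exp_neg (Xenv Q (n + 1) ω)]
    have := Real.exp_pos (Xenv Q (n + 1) ω)
    field_simp
    ring

/-- The conditional probability, given the environment, of the event `Z_n = k`. -/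
def lawCoeff (Q : ℕ → Ω → Measure ℕ) (n : ℕ) : ℕ → Ω → ℝ
  | 0, ω => 1 - Real.exp (revPair Q n ω).1 * (1 + (revPair Q n ω).2)⁻¹
  | k + 1, ω => Real.exp (revPair Q n ω).1 * geo k (revPair Q n ω).2

lemma FracLinear.pgfComp_eq (hf : FracLinear Q) (n : ℕ) (ω : Ω) {s : ℝ} (hs : 0 ≤ s)
    (hs1 : s < 1) : pgfComp Q 0 n ω s = 1 - Real.exp (revPair Q n ω).1 *
      ((1 - s) / (1 + (revPair Q n ω).2 * (1 - s))) := by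
  have h1 := (hf.inv_pgfComp n ω hs hs1).1
  have h2 := revPair_nonneg Q n ω
  have h3 : 0 < 1 - s := by linarith
  have h5 : 0 < 1 + (revPair Q n ω).2 * (1 - s) := by positivity
  have h4 := Real.exp_pos (revPair Q n ω).1
  rw [inv_eq_iff_eq_inv, Real.exp_neg] at h1
  have h6 : Real.exp (revPair Q n ω).1 * ((1 - s) / (1 + (revPair Q n ω).2 * (1 - s)))
      = ((Real.exp (revPair Q n ω).1)⁻¹ * ((1 - s)⁻¹ + (revPair Q n ω).2))⁻¹ := by
    field_simp
  linarith

lemma FracLinear.hasSum_lawCoeff (hf : FracLinear Q) (n : ℕ) (ω : Ω) {s : ℝ} (hs : 0 ≤ s)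
    (hs1 : s < 1) : HasSum (fun k => lawCoeff Q n k ω * s ^ k) (pgfComp Q 0 n ω s) := by
  have h1 := (hasSum_geo (revPair_nonneg Q n ω) hs hs1).mul_left (Real.exp (revPair Q n ω).1)
  refine (hasSum_nat_add_iff' 1).1 ?_
  rw [hf.pgfComp_eq n ω hs hs1]
  simp only [lawCoeff, Finset.range_one, Finset.sum_singleton, pow_zero, mul_one]
  have e1 : 1 - Real.exp (revPair Q n ω).1 * ((1 - s) / (1 + (revPair Q n ω).2 * (1 - s)))
      - (1 - Real.exp (revPair Q n ω).1 * (1 + (revPair Q n ω).2)⁻¹)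
      = Real.exp (revPair Q n ω).1 * ((1 + (revPair Q n ω).2)⁻¹
        - (1 - s) / (1 + (revPair Q n ω).2 * (1 - s))) := by ring
  rw [e1]
  simp_rw [mul_assoc]
  exact h1

lemma FracLinear.lawCoeff_mem (hf : FracLinear Q) (n k : ℕ) (ω : Ω) :
    0 ≤ lawCoeff Q n k ω ∧ lawCoeff Q n k ω ≤ 1 := by
  have h2 := revPair_nonneg Q n ω
  have h3 : 0 ≤ 1 - Real.exp (revPair Q n ω).1 * (1 + (revPair Q n ω).2)⁻¹ := by
    have h4 := (hf.inv_pgfComp n ω le_rfl one_pos).2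
    rw [hf.pgfComp_eq n ω le_rfl one_pos] at h4
    simpa using h4
  have h5 := Real.exp_pos (revPair Q n ω).1
  cases k with
  | zero =>
    refine ⟨h3, ?_⟩
    simp only [lawCoeff]
    linarith [show 0 ≤ Real.exp (revPair Q n ω).1 * (1 + (revPair Q n ω).2)⁻¹ by positivity]
  | succ k =>
    simp only [lawCoeff]
    refine ⟨mul_nonneg h5.le ((profile_geo k).nonneg _), ?_⟩
    unfold geo
    rw [max_eq_left h2]
    obtain ⟨hu, hu1⟩ := inv_one_add_max_mem (revPair Q n ω).2
    rw [max_eq_left h2] at hu hu1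
    generalize (1 + (revPair Q n ω).2)⁻¹ = u at *
    calc _ = ((1 - u) ^ k * u) * (Real.exp (revPair Q n ω).1 * u) := by ring
      _ ≤ 1 := mul_le_one₀ (mul_le_one₀ (pow_le_one₀ (by linarith) (by linarith)) hu.le hu1)
          (by positivity) (by linarith)

lemma measurable_Q_envFiltration (Q : ℕ → Ω → Measure ℕ) {i n : ℕ} (hi : 1 ≤ i) (hn : i ≤ n) :
    Measurable[envFiltration Q n] (Q i) :=
  (comap_measurable (Q i)).mono
    (le_iSup₂ (f := fun j (_ : j ∈ Finset.Icc 1 n) => MeasurableSpace.comap (Q j) inferInstance)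
      i (Finset.mem_Icc.2 ⟨hi, hn⟩)) le_rfl

lemma envFiltration_mono (Q : ℕ → Ω → Measure ℕ) {m n : ℕ} (h : m ≤ n) :
    envFiltration Q m ≤ envFiltration Q n :=
  biSup_mono fun i hi => by rw [Finset.mem_Icc] at *; omega

lemma measurable_revPair (hQ : ∀ n ω, IsProbabilityMeasure (Q n ω)) (hf : FracLinear Q) (n : ℕ) :
    Measurable[envFiltration Q n] (revPair Q n) := by
  induction n with
  | zero => exact measurable_const
  | succ n ih =>
    have h1 := ih.mono (envFiltration_mono Q n.le_succ) le_rfl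
    have h2 := measurable_envPar.comp (measurable_Q_envFiltration Q (Nat.le_add_left 1 n) le_rfl)
    have h3 : revPair Q (n + 1) = fun ω => ((revPair Q n ω).1 + (envPar (Q (n + 1) ω)).1,
      Real.exp (envPar (Q (n + 1) ω)).1 * ((revPair Q n ω).2 + (envPar (Q (n + 1) ω)).2.1)) := by
      funext ω
      rw [envPar_eq hQ hf (by omega)]
      rfl
    rw [h3]
    have h4 : Measurable fun q : (ℝ × ℝ) × ℝ × ℝ × ℝ =>
      (q.1.1 + q.2.1, Real.exp q.2.1 * (q.1.2 + q.2.2.1)) := by fun_prop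
    exact h4.comp (h1.prodMk h2)

variable [MeasurableSpace Ω] {μ : Measure Ω}

lemma IIDseq.envFiltration_le (h : IIDseq μ Q) (n : ℕ) : envFiltration Q n ≤ ‹MeasurableSpace Ω› :=
  iSup₂_le fun i _ => (h.1 i).comap_le

lemma IIDseq.indepFun (h : IIDseq μ Q) {E : Type*} [MeasurableSpace E] {n : ℕ} {V : Ω → E}
    (hV : Measurable[envFiltration Q n] V) : IndepFun V (Q (n + 1)) μ := by
  have h1 : Indep (⨆ i ∈ (Finset.Icc 1 n : Set ℕ), MeasurableSpace.comap (Q i) inferInstance)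
      (⨆ i ∈ ({n + 1} : Set ℕ), MeasurableSpace.comap (Q i) inferInstance) μ :=
    indep_iSup_of_disjoint (fun i => (h.1 i).comap_le) h.2.1 (by
      rw [Set.disjoint_singleton_right]; simp)
  rw [IndepFun_iff_Indep]
  refine indep_of_indep_of_le_left (indep_of_indep_of_le_right h1 ?_) ?_
  · simp
  · refine hV.comap_le.trans ?_
    simp [envFiltration]

/-- The joint law of the step and the parameter `η` of the environment. -/
def stepLaw (μ : Measure Ω) (Q : ℕ → Ω → Measure ℕ) : Measure (ℝ × ℝ) :=
  μ.map fun ω => (Xenv Q 1 ω, etaEnv Q 1 ω)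

lemma IIDseq.map_envPar (h : IIDseq μ Q) (n : ℕ) :
    μ.map (fun ω => envPar (Q n ω)) = μ.map (fun ω => envPar (Q 1 ω)) :=
  ((h.2.2 n).comp measurable_envPar).map_eq

lemma measurable_tinf_iter {ρ : Measure (ℝ × ℝ)} [SFinite ρ] {f : ℝ → ℝ → ℝ≥0∞}
    (hf : Measurable (Function.uncurry f)) (n : ℕ) :
    Measurable (Function.uncurry ((tinf ρ)^[n] f)) := by
  induction n with
  | zero => exact hf
  | succ n ih =>
    rw [Function.iterate_succ_apply']
    exact Measurable.lintegral_prod_right' (f := fun q : (ℝ × ℝ) × ℝ × ℝ =>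
      (tinf ρ)^[n] f (q.1.1 + q.2.1) (q.1.2 + q.2.2 * Real.exp (q.1.1 + q.2.1)))
      (ih.comp (f := fun q : (ℝ × ℝ) × ℝ × ℝ =>
        (q.1.1 + q.2.1, q.1.2 + q.2.2 * Real.exp (q.1.1 + q.2.1))) (by fun_prop))

variable [IsProbabilityMeasure μ]

lemma lintegral_revPair (hQ : ∀ n ω, IsProbabilityMeasure (Q n ω)) (hf : FracLinear Q)
    (h : IIDseq μ Q) {f : ℝ → ℝ → ℝ≥0∞} (hfm : Measurable (Function.uncurry f)) (n : ℕ) (s b : ℝ) :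
    ∫⁻ ω, f (s + (revPair Q n ω).1) (b + Real.exp s * (revPair Q n ω).2) ∂μ
      = (tinf (stepLaw μ Q))^[n] f s b := by
  induction n generalizing s b with
  | zero => simp [revPair]
  | succ n ih =>
    have hV := measurable_revPair hQ hf n
    have hV' := hV.mono (h.envFiltration_le n) le_rfl
    have hξ : Measurable fun ω => envPar (Q (n + 1) ω) := measurable_envPar.comp (h.1 (n + 1))
    have hind : IndepFun (revPair Q n) (fun ω => envPar (Q (n + 1) ω)) μ :=
      (h.indepFun hV).comp measurable_id measurable_envPar
    have hprod := (indepFun_iff_map_prod_eq_prod_map_map hV'.aemeasurable hξ.aemeasurable).1 hind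
    have hstep : stepLaw μ Q = (μ.map fun ω => envPar (Q (n + 1) ω)).map fun q => (q.1, q.2.1) := by
      rw [h.map_envPar, Measure.map_map (by fun_prop)
        (show Measurable fun ω => envPar (Q 1 ω) from measurable_envPar.comp (h.1 1)), stepLaw]
      congr 1
      funext ω
      simp only [Function.comp, envPar_eq hQ hf le_rfl ω]
    have hF : Measurable fun q : (ℝ × ℝ) × ℝ × ℝ × ℝ => f (s + (q.1.1 + q.2.1))
        (b + Real.exp s * (Real.exp q.2.1 * (q.1.2 + q.2.2.1))) :=
      hfm.comp (f := fun q : (ℝ × ℝ) × ℝ × ℝ × ℝ => (s + (q.1.1 + q.2.1),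
        b + Real.exp s * (Real.exp q.2.1 * (q.1.2 + q.2.2.1)))) (by fun_prop)
    have : IsProbabilityMeasure (μ.map (revPair Q n)) :=
      Measure.isProbabilityMeasure_map hV'.aemeasurable
    have : IsProbabilityMeasure (μ.map fun ω => envPar (Q (n + 1) ω)) :=
      Measure.isProbabilityMeasure_map hξ.aemeasurable
    have hG : Measurable fun p : ℝ × ℝ => (tinf (stepLaw μ Q))^[n] f (s + p.1)
        (b + p.2 * Real.exp (s + p.1)) := by
      have : SFinite (stepLaw μ Q) := by unfold stepLaw; infer_instance
      exact (measurable_tinf_iter hfm n).comp (f := fun p : ℝ × ℝ =>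
        (s + p.1, b + p.2 * Real.exp (s + p.1))) (by fun_prop)
    calc _ = ∫⁻ ω, (fun q : (ℝ × ℝ) × ℝ × ℝ × ℝ => f (s + (q.1.1 + q.2.1))
          (b + Real.exp s * (Real.exp q.2.1 * (q.1.2 + q.2.2.1))))
          (revPair Q n ω, envPar (Q (n + 1) ω)) ∂μ := by
          refine lintegral_congr fun ω => ?_
          simp only [envPar_eq hQ hf (Nat.le_add_left 1 n), revPair]
      _ = ∫⁻ q, ∫⁻ v, f (s + (v.1 + q.1)) (b + Real.exp s * (Real.exp q.1 * (v.2 + q.2.1)))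
            ∂(μ.map (revPair Q n)) ∂(μ.map fun ω => envPar (Q (n + 1) ω)) := by
          refine (lintegral_map hF (hV'.prodMk hξ)).symm.trans ?_
          rw [hprod, lintegral_prod_symm' _ hF]
      _ = ∫⁻ q, (tinf (stepLaw μ Q))^[n] f (s + q.1) (b + q.2.1 * Real.exp (s + q.1))
            ∂(μ.map fun ω => envPar (Q (n + 1) ω)) := by
          refine lintegral_congr fun q => ?_
          rw [← ih]
          refine (lintegral_map (hF.comp (f := fun v : ℝ × ℝ => (v, q)) (by fun_prop)) hV').trans ?_
          refine lintegral_congr fun ω => ?_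
          simp only [Function.comp]
          rw [Real.exp_add]
          congr 1 <;> ring
      _ = _ := by
          rw [Function.iterate_succ_apply', tinf]
          have h1 : ∀ G : ℝ × ℝ → ℝ≥0∞, Measurable G → ∫⁻ p, G p ∂(stepLaw μ Q)
              = ∫⁻ q, G (q.1, q.2.1) ∂(μ.map fun ω => envPar (Q (n + 1) ω)) := fun G hG => by
            rw [hstep, lintegral_map hG (by fun_prop)]
          exact (h1 _ hG).symm

end Environment

section Link

open scoped ENNReal

variable {Ω : Type*} {Q : ℕ → Ω → Measure ℕ}

lemma measurable_lawCoeff (hQ : ∀ n ω, IsProbabilityMeasure (Q n ω)) (hf : FracLinear Q)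
    (n k : ℕ) : Measurable[envFiltration Q n] (lawCoeff Q n k) := by
  have h1 := measurable_revPair hQ hf n
  cases k with
  | zero =>
    have h2 : Measurable fun q : ℝ × ℝ => 1 - Real.exp q.1 * (1 + q.2)⁻¹ := by fun_prop
    exact h2.comp h1
  | succ k =>
    have h2 : Measurable fun q : ℝ × ℝ => Real.exp q.1 * geo k q.2 :=
      (by fun_prop : Measurable fun q : ℝ × ℝ => Real.exp q.1).mul
        ((profile_geo k).continuous.measurable.comp measurable_snd)
    exact h2.comp h1

lemma pgfComp_self (Q : ℕ → Ω → Measure ℕ) (n : ℕ) (ω : Ω) (s : ℝ) : pgfComp Q n n ω s = s := by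
  cases n <;> simp [pgfComp]

lemma extinctTime_eq_succ_iff {Z : ℕ → Ω → ℕ} (hZ : ∀ n ω, Z n ω = 0 → Z (n + 1) ω = 0) (n : ℕ)
    (ω : Ω) : extinctTime Z ω = n + 1 ↔ Z (n + 1) ω = 0 ∧ Z n ω ≠ 0 := by
  refine Nat.sInf_upward_closed_eq_succ_iff (fun i j hij hi => ?_) n
  induction hij with
  | refl => exact hi
  | step _ ih => exact hZ _ ω ih

variable [MeasurableSpace Ω] {μ : Measure Ω}

lemma measurable_env (hQ : ∀ n ω, IsProbabilityMeasure (Q n ω)) (hf : FracLinear Q)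
    (h : IIDseq μ Q) {n : ℕ} (hn : 1 ≤ n) :
    Measurable (Xenv Q n) ∧ Measurable (etaEnv Q n) ∧ Measurable fun ω => pgf Q n ω 0 := by
  have h1 : Measurable fun ω => envPar (Q n ω) := measurable_envPar.comp (h.1 n)
  simp_rw [envPar_eq hQ hf hn] at h1
  exact ⟨h1.fst, h1.snd.fst, h1.snd.snd⟩

lemma envLaw_stepLaw (hQ : ∀ n ω, IsProbabilityMeasure (Q n ω)) (hf : FracLinear Q)
    (h : IIDseq μ Q) {χ : ℝ} (hA1 : AssumptionA1With μ Q χ) (hA2 : AssumptionA2 μ Q) :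
    EnvLaw (stepLaw μ Q) (-Real.log χ) χ χ⁻¹ := by
  obtain ⟨hχ, hχ2, hA⟩ := hA1
  obtain ⟨hX, hη, -⟩ := measurable_env hQ hf h le_rfl
  have hfst : (stepLaw μ Q).map Prod.fst = μ.map (Xenv Q 1) :=
    Measure.map_map measurable_fst (hX.prodMk hη)
  refine ⟨hχ, ?_, ?_⟩
  · refine (ae_map_iff (hX.prodMk hη).aemeasurable ?_).2 ?_
    · exact (measurableSet_le measurable_const measurable_fst).inter
        ((measurableSet_le measurable_const measurable_snd).inter
          (measurableSet_le measurable_snd measurable_const))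
    · filter_upwards [hA 1 le_rfl] with ω ⟨h0, h1, h2⟩
      have h3 := hf 1 le_rfl ω 0 le_rfl one_pos
      have h4 : (1 - pgf Q 1 ω 0)⁻¹ ≤ χ⁻¹ := inv_anti₀ hχ (by linarith)
      rw [h3, sub_zero, div_one] at h4
      have h5 := Real.exp_pos (-Xenv Q 1 ω)
      refine ⟨?_, h2, by linarith⟩
      have h6 := (Real.le_log_iff_exp_le (inv_pos.2 hχ)).2
        (show Real.exp (-Xenv Q 1 ω) ≤ χ⁻¹ by linarith)
      rw [Real.log_inv] at h6
      rw [neg_neg]; linarith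
  · obtain ⟨h1, h2, h3, h4, h5⟩ := hA2
    rw [hfst]
    refine ⟨?_, ?_, ?_, h5⟩
    · rw [integral_map hX.aemeasurable (by fun_prop)]; exact h2
    · exact (integrable_map_measure (by fun_prop) hX.aemeasurable).2 h3
    · rw [integral_map hX.aemeasurable (by fun_prop)]; exact h4

variable [IsProbabilityMeasure μ]

lemma integral_lawCoeff (hQ : ∀ n ω, IsProbabilityMeasure (Q n ω)) (hf : FracLinear Q)
    (h : IIDseq μ Q) (n k : ℕ) : ∫ ω, lawCoeff Q n (k + 1) ω ∂μ
      = ((tinf (stepLaw μ Q))^[n] (eprof (geo k)) 0 0).toReal := by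
  have hm := (measurable_lawCoeff hQ hf n (k + 1)).mono (h.envFiltration_le n) le_rfl
  rw [integral_eq_lintegral_of_nonneg_ae (ae_of_all _ fun ω => (hf.lawCoeff_mem n (k + 1) ω).1)
    hm.aestronglyMeasurable, ← lintegral_revPair hQ hf h]
  · simp [eprof, lawCoeff]
  · exact ENNReal.measurable_ofReal.comp
      ((by fun_prop : Measurable fun q : ℝ × ℝ => Real.exp q.1).mul
        ((profile_geo k).continuous.measurable.comp measurable_snd))

lemma hasSum_integral_coeff {c : ℕ → Ω → ℝ} {Y G : Ω → ℝ} (hc : ∀ k, Measurable (c k))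
    (hc0 : ∀ k ω, 0 ≤ c k ω ∧ c k ω ≤ 1) (hY : Measurable Y) (hY0 : ∀ ω, 0 ≤ Y ω ∧ Y ω ≤ 1) {s : ℝ}
    (hs : 0 ≤ s) (hs1 : s < 1) (hG : ∀ ω, HasSum (fun k => c k ω * s ^ k) (G ω)) :
    HasSum (fun k => (∫ ω, c k ω * Y ω ∂μ) * s ^ k) (∫ ω, G ω * Y ω ∂μ) := by
  have hb : ∀ k ω, ‖c k ω * s ^ k * Y ω‖ ≤ s ^ k := fun k ω => by
    have h1 : 0 ≤ s ^ k := pow_nonneg hs k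
    rw [Real.norm_of_nonneg (mul_nonneg (mul_nonneg (hc0 k ω).1 h1) (hY0 ω).1)]
    calc _ ≤ 1 * s ^ k * 1 := by
          have := (hc0 k ω).1
          have := (hY0 ω).1
          gcongr
          · exact (hc0 k ω).2
          · exact (hY0 ω).2
      _ = _ := by ring
  have hi : ∀ k, Integrable (fun ω => c k ω * s ^ k * Y ω) μ := fun k =>
    Integrable.of_bound (((hc k).mul_const _).mul hY).aestronglyMeasurable (s ^ k)
      (ae_of_all _ (hb k))
  have h1 := hasSum_integral_of_summable_integral_norm hi
    (Summable.of_nonneg_of_le (fun k => integral_nonneg fun ω => norm_nonneg _)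
      (fun k => (integral_mono (hi k).norm (integrable_const _) (hb k)).trans (by simp))
      (summable_geometric_of_lt_one hs hs1))
  have h2 : ∀ ω, ∑' k, c k ω * s ^ k * Y ω = G ω * Y ω := fun ω =>
    ((hG ω).mul_right (Y ω)).tsum_eq
  simp_rw [h2] at h1
  refine h1.congr_fun fun k => ?_
  rw [← integral_mul_const]
  exact integral_congr_ae (ae_of_all _ fun ω => by ring)

/-- Measurable functions of the environment see the law of `Z_n` only through `lawCoeff`. -/
lemma integral_indicator_mul (hQ : ∀ n ω, IsProbabilityMeasure (Q n ω)) (hf : FracLinear Q)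
    (h : IIDseq μ Q) {Z : ℕ → Ω → ℕ} (hZ : BranchingProperty μ Q Z) {Y : Ω → ℝ}
    (hY : Measurable[envSigma Q] Y) (hY0 : ∀ ω, 0 ≤ Y ω ∧ Y ω ≤ 1) (n k : ℕ) :
    ∫ ω, (if Z n ω = k then 1 else 0) * Y ω ∂μ = ∫ ω, lawCoeff Q n k ω * Y ω ∂μ := by
  obtain ⟨hZ0, hZm, -, hZc⟩ := hZ
  have hle : envSigma Q ≤ ‹MeasurableSpace Ω› := iSup_le fun i => (h.1 (i + 1)).comap_le
  have hY' := hY.mono hle le_rfl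
  have hmle : envSigma Q ⊔ MeasurableSpace.comap (Z 0) inferInstance ≤ ‹MeasurableSpace Ω› :=
    sup_le hle (hZm 0).comap_le
  have hc1 : ∀ k, Measurable fun ω => if Z n ω = k then (1 : ℝ) else 0 := fun k =>
    Measurable.ite (hZm n (measurableSet_singleton k)) measurable_const measurable_const
  have hc2 := fun k => (measurable_lawCoeff hQ hf n k).mono (h.envFiltration_le n) le_rfl
  have hb1 : ∀ k ω, 0 ≤ (if Z n ω = k then (1 : ℝ) else 0) ∧
      (if Z n ω = k then (1 : ℝ) else 0) ≤ 1 := fun k ω => by split_ifs <;> simp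
  have hb2 := fun k ω => hf.lawCoeff_mem n k ω
  have hone : ∀ (c : ℕ → Ω → ℝ), (∀ k ω, 0 ≤ c k ω ∧ c k ω ≤ 1) → ∀ k,
      |∫ ω, c k ω * Y ω ∂μ| ≤ 1 := fun c hc k => by
    have := norm_integral_le_of_norm_le_const (μ := μ) (C := 1) (f := fun ω => c k ω * Y ω)
      (ae_of_all _ fun ω => by
        rw [Real.norm_of_nonneg (mul_nonneg (hc k ω).1 (hY0 ω).1)]
        exact mul_le_one₀ (hc k ω).2 (hY0 ω).1 (hY0 ω).2)
    simpa using this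
  refine sub_eq_zero.1 (coeff_eq_zero_of_tsum_eq_zero (C := 2)
    (a := fun k => ∫ ω, (if Z n ω = k then 1 else 0) * Y ω ∂μ - ∫ ω, lawCoeff Q n k ω * Y ω ∂μ)
    (fun k => ?_) (fun s hs hs1 => ?_) k)
  · refine (abs_sub _ _).trans ?_
    linarith [hone _ hb1 k, hone _ hb2 k]
  · have h1 := hasSum_integral_coeff (μ := μ) (G := fun ω => s ^ Z n ω) hc1 hb1 hY' hY0 hs.le hs1
      (fun ω => by
        have := hasSum_ite_eq (Z n ω) (s ^ Z n ω)
        refine this.congr_fun fun k => ?_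
        by_cases hk : Z n ω = k
        · simp [hk]
        · simp [hk, Ne.symm hk])
    have h2 := hasSum_integral_coeff (μ := μ) hc2 hb2 hY' hY0 hs.le hs1
      (fun ω => hf.hasSum_lawCoeff n ω hs.le hs1)
    have h3 : ∫ ω, s ^ Z n ω * Y ω ∂μ = ∫ ω, pgfComp Q 0 n ω s * Y ω ∂μ := by
      have hsm : Measurable fun ω => s ^ Z n ω := (measurable_of_countable (s ^ ·)).comp (hZm n)
      have hsb : ∀ ω, 0 ≤ s ^ Z n ω ∧ s ^ Z n ω ≤ 1 := fun ω =>
        ⟨pow_nonneg hs.le _, pow_le_one₀ hs.le hs1.le⟩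
      have hi1 : Integrable (fun ω => s ^ Z n ω) μ :=
        Integrable.of_bound hsm.aestronglyMeasurable 1 (ae_of_all _ fun ω => by
          rw [Real.norm_of_nonneg (hsb ω).1]; exact (hsb ω).2)
      have hi2 : Integrable ((fun ω => s ^ Z n ω) * Y) μ :=
        Integrable.of_bound (hsm.mul hY').aestronglyMeasurable 1 (ae_of_all _ fun ω => by
          rw [Pi.mul_apply, Real.norm_of_nonneg (mul_nonneg (hsb ω).1 (hY0 ω).1)]
          exact mul_le_one₀ (hsb ω).2 (hY0 ω).1 (hY0 ω).2)
      have h4 := condExp_mul_of_stronglyMeasurable_right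
        (m := envSigma Q ⊔ MeasurableSpace.comap (Z 0) inferInstance)
        ((hY.mono (le_sup_left (b := MeasurableSpace.comap (Z 0) inferInstance))
          le_rfl).stronglyMeasurable) hi2 hi1
      have h5 := hZc 0 n (Nat.zero_le n) s hs.le hs1.le
      calc _ = ∫ ω, (μ[(fun ω => s ^ Z n ω) * Y |
            envSigma Q ⊔ MeasurableSpace.comap (Z 0) inferInstance]) ω ∂μ :=
          (integral_condExp hmle).symm
        _ = _ := by
          refine integral_congr_ae ?_
          filter_upwards [h4, h5] with ω h4 h5
          rw [h4, Pi.mul_apply, h5, hZ0, pow_one]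
    have h6 := h1.sub h2
    rw [h3, sub_self] at h6
    simp_rw [sub_mul]
    exact h6.tsum_eq

lemma measureReal_inter_extinct (h : IIDseq μ Q) {Z : ℕ → Ω → ℕ}
    (hZ : BranchingProperty μ Q Z) (n k : ℕ) :
    μ.real {ω | Z n ω = k ∧ Z (n + 1) ω = 0}
      = ∫ ω, (if Z n ω = k then 1 else 0) * pgf Q (n + 1) ω 0 ^ k ∂μ := by
  obtain ⟨hZ0, hZm, -, hZc⟩ := hZ
  have hle : envSigma Q ≤ ‹MeasurableSpace Ω› := iSup_le fun i => (h.1 (i + 1)).comap_le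
  have hmle : envSigma Q ⊔ MeasurableSpace.comap (Z n) inferInstance ≤ ‹MeasurableSpace Ω› :=
    sup_le hle (hZm n).comap_le
  have hs : MeasurableSet {ω | Z n ω = k} := hZm n (measurableSet_singleton k)
  have hs' : MeasurableSet[envSigma Q ⊔ MeasurableSpace.comap (Z n) inferInstance]
      {ω | Z n ω = k} :=
    (le_sup_right (a := envSigma Q)) _ ⟨{k}, measurableSet_singleton k, rfl⟩
  have ht : MeasurableSet {ω | Z (n + 1) ω = 0} := hZm (n + 1) (measurableSet_singleton 0)
  have hpow : ∀ ω, (0 : ℝ) ^ Z (n + 1) ω = {ω | Z (n + 1) ω = 0}.indicator 1 ω := fun ω => by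
    by_cases hω : Z (n + 1) ω = 0 <;> simp [hω]
  have hi : Integrable (fun ω => (0 : ℝ) ^ Z (n + 1) ω) μ := by
    simp_rw [hpow]
    exact (integrable_const (1 : ℝ)).indicator ht
  have h1 := setIntegral_condExp hmle hi hs'
  have h2 := hZc n (n + 1) n.le_succ 0 le_rfl zero_le_one
  have h3 : ∀ ω, pgfComp Q n (n + 1) ω 0 = pgf Q (n + 1) ω 0 := fun ω => by
    simp [pgfComp, pgfComp_self]
  calc μ.real {ω | Z n ω = k ∧ Z (n + 1) ω = 0}
      = ∫ ω in {ω | Z n ω = k}, (0 : ℝ) ^ Z (n + 1) ω ∂μ := by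
        simp_rw [hpow]
        rw [integral_indicator_one ht, measureReal_restrict_apply ht, inter_comm]
        rfl
    _ = ∫ ω in {ω | Z n ω = k}, pgf Q (n + 1) ω 0 ^ k ∂μ := by
        rw [← h1]
        refine setIntegral_congr_ae hs ?_
        filter_upwards [h2] with ω hω hk
        rw [hω, h3, show Z n ω = k from hk]
    _ = _ := by
        rw [← integral_indicator hs]
        refine integral_congr_ae (ae_of_all _ fun ω => ?_)
        by_cases hk : Z n ω = k <;> simp [hk]

lemma measureReal_inter_extinct_succ (hQ : ∀ n ω, IsProbabilityMeasure (Q n ω))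
    (hf : FracLinear Q) (h : IIDseq μ Q) {Z : ℕ → Ω → ℕ} (hZ : BranchingProperty μ Q Z) (n k : ℕ) :
    μ.real {ω | Z n ω = k + 1 ∧ Z (n + 1) ω = 0}
      = ((tinf (stepLaw μ Q))^[n] (eprof (geo k)) 0 0).toReal
        * ∫ ω, pgf Q 1 ω 0 ^ (k + 1) ∂μ := by
  have hq : ∀ j, 1 ≤ j → (fun ω => pgf Q j ω 0) = fun ω => (envPar (Q j ω)).2.2 := fun j hj => by
    funext ω; rw [envPar_eq hQ hf hj]
  have hqm : Measurable fun ν : Measure ℕ => (envPar ν).2.2 ^ (k + 1) :=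
    measurable_envPar.snd.snd.pow_const _
  have hqe : ∀ j, 1 ≤ j → (fun ω => pgf Q j ω 0 ^ (k + 1))
      = (fun ν : Measure ℕ => (envPar ν).2.2 ^ (k + 1)) ∘ Q j := fun j hj => by
    funext ω; exact congrArg (· ^ (k + 1)) (congrFun (hq j hj) ω)
  have hQm : Measurable[envSigma Q] (Q (n + 1)) :=
    (comap_measurable (Q (n + 1))).mono
      (le_iSup (fun i => MeasurableSpace.comap (Q (i + 1)) inferInstance) n) le_rfl
  have hn1 : 1 ≤ n + 1 := by omega
  rw [measureReal_inter_extinct h hZ,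
    integral_indicator_mul hQ hf h hZ (Y := fun ω => pgf Q (n + 1) ω 0 ^ (k + 1))
    (by rw [hqe _ hn1]; exact hqm.comp hQm)
    (fun ω => ⟨pow_nonneg (pgf_nonneg Q _ ω le_rfl) _, pow_le_one₀ (pgf_nonneg Q _ ω le_rfl)
      (hf.pgf_lt_one hn1 ω le_rfl one_pos).le⟩),
    ← integral_lawCoeff hQ hf h]
  have hcm := measurable_lawCoeff hQ hf n (k + 1)
  have hind : IndepFun (lawCoeff Q n (k + 1)) (fun ω => pgf Q (n + 1) ω 0 ^ (k + 1)) μ := by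
    rw [hqe _ hn1]
    exact (h.indepFun hcm).comp measurable_id hqm
  rw [hind.integral_fun_mul_eq_mul_integral
    (hcm.mono (h.envFiltration_le n) le_rfl).aestronglyMeasurable
    (by rw [hqe _ hn1]; exact (hqm.comp (h.1 _)).aestronglyMeasurable)]
  congr 1
  rw [hqe _ hn1, hqe _ le_rfl]
  exact ((h.2.2 (n + 1)).comp hqm).integral_eq

end Link

section Limit

lemma exists_tendsto_div_tsum {a : ℕ → ℕ → ℝ} {w L r : ℕ → ℝ} (hr : Summable r)
    (ha : ∀ n k, 0 ≤ a n k) (hw : ∀ n, 0 < w n) (har : ∀ n k, (w n)⁻¹ * a n k ≤ r k)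
    (hL : ∀ k, 0 < L k) (h : ∀ k, Tendsto (fun n => (w n)⁻¹ * a n k) atTop (𝓝 (L k))) :
    ∃ p : ℕ → ℝ, (∀ k, 0 ≤ p k) ∧ ∑' k, p k = 1 ∧ (¬ ∃ k, p k = 1) ∧ p 0 = 0 ∧
      ∀ k, Tendsto (fun n => a n k / ∑' j, a n j) atTop (𝓝 (p (k + 1))) := by
  have hLr : ∀ k, L k ≤ r k := fun k => le_of_tendsto' (h k) fun n => har n k
  have hLs : Summable L := hr.of_nonneg_of_le (fun k => (hL k).le) hLr
  have hD : 0 < ∑' k, L k := hLs.tsum_pos (fun k => (hL k).le) 0 (hL 0)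
  have hsum : Tendsto (fun n => (w n)⁻¹ * ∑' j, a n j) atTop (𝓝 (∑' k, L k)) := by
    simp_rw [← tsum_mul_left]
    refine tendsto_tsum_of_dominated_convergence hr h (Eventually.of_forall fun n k => ?_)
    rw [Real.norm_of_nonneg (mul_nonneg (inv_pos.2 (hw n)).le (ha n k))]
    exact har n k
  let p : ℕ → ℝ := fun k => Nat.casesOn k 0 fun j => L j / ∑' i, L i
  have hp : ∀ k, p (k + 1) = L k / ∑' i, L i := fun k => rfl
  have hpos : ∀ k, 0 < p (k + 1) := fun k => div_pos (hL k) hD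
  have hp0 : ∀ k, 0 ≤ p k := fun k => by
    cases k with
    | zero => exact le_rfl
    | succ k => exact (hpos k).le
  have hps : Summable p := (summable_nat_add_iff 1).1 (hLs.div_const _)
  have hp1 : ∑' k, p k = 1 := by
    rw [hps.tsum_eq_zero_add]
    simp_rw [hp]
    rw [tsum_div_const, div_self hD.ne']
    exact zero_add 1
  refine ⟨p, hp0, hp1, ?_, rfl, fun k => ?_⟩
  · rintro ⟨k, hk⟩
    obtain ⟨j, hj, hjk⟩ : ∃ j, 0 < p j ∧ j ≠ k := by
      by_cases h1 : k = 1
      · exact ⟨2, hpos 1, by omega⟩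
      · exact ⟨1, hpos 0, Ne.symm h1⟩
    have h2 := hps.sum_le_tsum {j, k} fun i _ => hp0 i
    rw [Finset.sum_pair hjk] at h2
    linarith
  · refine ((h k).div hsum hD.ne').congr fun n => ?_
    exact mul_div_mul_left _ _ (inv_pos.2 (hw n)).ne'

variable {Ω : Type*} [MeasurableSpace Ω] {μ : Measure Ω} {Q : ℕ → Ω → Measure ℕ}
  [IsProbabilityMeasure μ]

lemma cond_extinct_map_toReal {Z : ℕ → Ω → ℕ} (hZm : ∀ n, Measurable (Z n))
    (hZ : ∀ n ω, Z n ω = 0 → Z (n + 1) ω = 0) (n k : ℕ) :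
    ((μ[|{ω | extinctTime Z ω = n + 1}]).map (Z n) {k}).toReal
      = (if k = 0 then 0 else μ.real {ω | Z n ω = k ∧ Z (n + 1) ω = 0})
        / ∑' j, μ.real {ω | Z n ω = j + 1 ∧ Z (n + 1) ω = 0} := by
  have hm : ∀ k, MeasurableSet {ω | Z n ω = k ∧ Z (n + 1) ω = 0} := fun k =>
    (hZm n (measurableSet_singleton k)).inter (hZm (n + 1) (measurableSet_singleton 0))
  have hA : {ω | extinctTime Z ω = n + 1} = ⋃ j, {ω | Z n ω = j + 1 ∧ Z (n + 1) ω = 0} := by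
    ext ω
    simp only [mem_ofPred_eq, mem_iUnion, extinctTime_eq_succ_iff hZ]
    refine ⟨fun ⟨h1, h2⟩ => ⟨Z n ω - 1, by omega, h1⟩, fun ⟨j, h1, h2⟩ => ⟨h2, by omega⟩⟩
  have hd : Pairwise (Function.onFun Disjoint fun j => {ω | Z n ω = j + 1 ∧ Z (n + 1) ω = 0}) :=
    fun i j hij => Set.disjoint_left.2 fun ω h1 h2 => hij (by have := h1.1; have := h2.1; omega)
  have hAm : MeasurableSet {ω | extinctTime Z ω = n + 1} := by
    rw [hA]; exact MeasurableSet.iUnion fun j => hm _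
  have hμA : (μ {ω | extinctTime Z ω = n + 1}).toReal
      = ∑' j, μ.real {ω | Z n ω = j + 1 ∧ Z (n + 1) ω = 0} := by
    rw [hA, measure_iUnion hd fun j => hm _, ENNReal.tsum_toReal_eq fun j => measure_ne_top _ _]
    rfl
  rw [Measure.map_apply (hZm n) (measurableSet_singleton k), cond_apply hAm, ENNReal.toReal_mul,
    ENNReal.toReal_inv, hμA, div_eq_inv_mul]
  congr 1
  by_cases hk : k = 0
  · rw [if_pos hk]
    have : {ω | extinctTime Z ω = n + 1} ∩ Z n ⁻¹' {k} = ∅ := by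
      ext ω
      simp only [mem_inter_iff, mem_ofPred_eq, extinctTime_eq_succ_iff hZ, mem_preimage,
        mem_singleton_iff, mem_empty_iff_false, iff_false]
      omega
    simp [this]
  · rw [if_neg hk, Measure.real]
    congr 2
    ext ω
    simp only [mem_inter_iff, mem_ofPred_eq, extinctTime_eq_succ_iff hZ, mem_preimage,
      mem_singleton_iff]
    omega

lemma integral_pgf_zero_pow_mem (hQ : ∀ n ω, IsProbabilityMeasure (Q n ω)) (hf : FracLinear Q)
    (h : IIDseq μ Q) {χ : ℝ} (hA1 : AssumptionA1With μ Q χ) (k : ℕ) :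
    0 < ∫ ω, pgf Q 1 ω 0 ^ k ∂μ ∧ ∫ ω, pgf Q 1 ω 0 ^ k ∂μ ≤ (1 - χ) ^ k := by
  obtain ⟨hχ, hχ2, hA⟩ := hA1
  have hm := (measurable_env hQ hf h le_rfl).2.2
  have hi : Integrable (fun ω => pgf Q 1 ω 0 ^ k) μ :=
    Integrable.of_bound (hm.pow_const k).aestronglyMeasurable 1 (ae_of_all _ fun ω => by
      have h0 := pgf_nonneg Q 1 ω le_rfl
      rw [Real.norm_of_nonneg (pow_nonneg h0 k)]
      exact pow_le_one₀ h0 (hf.pgf_lt_one le_rfl ω le_rfl one_pos).le)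
  constructor
  · refine (pow_pos hχ k).trans_le ?_
    calc χ ^ k = ∫ _, χ ^ k ∂μ := by simp
      _ ≤ _ := integral_mono_ae (integrable_const _) hi ((hA 1 le_rfl).mono fun ω hω =>
        pow_le_pow_left₀ hχ.le hω.1 k)
  · calc _ ≤ ∫ _, (1 - χ) ^ k ∂μ := integral_mono_ae hi (integrable_const _)
          ((hA 1 le_rfl).mono fun ω hω =>
            pow_le_pow_left₀ (pgf_nonneg Q 1 ω le_rfl) hω.2.1 k)
      _ = _ := by simp

end Limit

/-- **Theorem 1, second part.** Under A1–A3 the conditional law `L(Z_n | T = n+1)`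
converges weakly to the law of a non-degenerate random variable `Y` which is finite with
probability 1 (a probability distribution on `ℕ`, i.e. with no atom at infinity). -/
theorem statement1
    {Ω : Type*} [MeasurableSpace Ω] (μ : Measure Ω) [IsProbabilityMeasure μ]
    (Q : ℕ → Ω → Measure ℕ) (Z : ℕ → Ω → ℕ)
    (hQprob : ∀ n ω, IsProbabilityMeasure (Q n ω))
    (hiid : IIDseq μ Q) (hfrac : FracLinear Q)
    (hbranch : BranchingProperty μ Q Z)
    (hA1 : AssumptionA1 μ Q) (hA2 : AssumptionA2 μ Q) (hA3 : AssumptionA3 μ Q) :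
    ∃ p : ℕ → ℝ, (∀ k, 0 ≤ p k) ∧ (∑' k, p k) = 1 ∧ (¬ ∃ k, p k = 1) ∧
      ∀ k : ℕ, Tendsto
        (fun n : ℕ => (((μ[|{ω | extinctTime Z ω = n + 1}]).map (Z n)) {k}).toReal)
        atTop (𝓝 (p k)) := by
  obtain ⟨χ, hA1⟩ := hA1
  have hρ := envLaw_stepLaw hQprob hfrac hiid hA1 hA2
  obtain ⟨hX, hη, -⟩ := measurable_env hQprob hfrac hiid le_rfl
  have : IsProbabilityMeasure (stepLaw μ Q) :=
    Measure.isProbabilityMeasure_map (hX.prodMk hη).aemeasurable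
  have hχ := hA1.1
  have hM : 0 ≤ χ⁻¹ := (inv_pos.2 hχ).le
  have hθ := integral_pgf_zero_pow_mem hQprob hfrac hiid hA1
  choose l hl using fun k => hρ.tinf_tendsto hM (profile_geo k)
  obtain ⟨C, hC, hle⟩ := hρ.exists_tinf_le_ww
  have hr : Summable fun k : ℕ => C * (1 - χ) ^ (k + 1) :=
    ((summable_nat_add_iff 1).2 (summable_geometric_of_lt_one (by linarith [hA1.2.1])
      (by linarith))).mul_left C
  obtain ⟨p, hp0, hp1, hpn, hpz, hp⟩ := exists_tendsto_div_tsum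
    (a := fun n k => μ.real {ω | Z n ω = k + 1 ∧ Z (n + 1) ω = 0}) (w := ww)
    (L := fun k => l k * ∫ ω, pgf Q 1 ω 0 ^ (k + 1) ∂μ) hr (fun n k => measureReal_nonneg) ww_pos
    (fun n k => by
      rw [measureReal_inter_extinct_succ hQprob hfrac hiid hbranch, ← mul_assoc]
      refine mul_le_mul ?_ (hθ _).2 (hθ _).1.le hC
      rw [inv_mul_le_iff₀ (ww_pos n), mul_comm]
      exact hle (profile_geo k) n)
    (fun k => mul_pos (hρ.tinf_lower hM (profile_geo k) (geo_pos k) (hl k)) (hθ _).1)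
    (fun k => by
      simp_rw [measureReal_inter_extinct_succ hQprob hfrac hiid hbranch, ← mul_assoc]
      exact (hl k).mul_const _)
  refine ⟨p, hp0, hp1, hpn, fun k => ?_⟩
  simp_rw [cond_extinct_map_toReal hbranch.2.1 hbranch.2.2.1]
  cases k with
  | zero => simp [hpz]
  | succ k => simpa using hp k

end BPREpaper
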